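/- (Wright's representation theorem, difference-of-semi-inner-products form, for B(H).) Let H be a complex Hilbert space which is either infinite dimensional or of finite dimension greater than two, and let d be a bounded decoherence functional on H. Then there exist two maps s₁, s₂ : B(H) × B(H) → ℂ, each of which is a positive semidefinite hermitian sesquilinear form (ℂ-linear in the first argument, conjugate-linear in the second argument, with s_i(x,y) = conj(s_i(y,x)) and s_i(x,x) ≥ 0 for all bounded operators x, y), such that d(p,q) = s₁(p,q) − s₂(p,q) for all projections p, q on H. -/

import Mathlib

variable {H : Type*} [NormedAddCommGroup H] [InnerProductSpace ℂ H] [CompleteSpace H]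

/-- A positive semidefinite hermitian sesquilinear form on `B(H)`, linear in the
first argument and conjugate-linear in the second. -/
def IsPosSesquilinearForm (s : (H →L[ℂ] H) → (H →L[ℂ] H) → ℂ) : Prop :=
  (∀ x x' y : H →L[ℂ] H, s (x + x') y = s x y + s x' y) ∧
  (∀ (c : ℂ) (x y : H →L[ℂ] H), s (c • x) y = c * s x y) ∧
  (∀ x y y' : H →L[ℂ] H, s x (y + y') = s x y + s x y') ∧
  (∀ (c : ℂ) (x y : H →L[ℂ] H), s x (c • y) = (starRingEnd ℂ) c * s x y) ∧
  (∀ x y : H →L[ℂ] H, s x y = (starRingEnd ℂ) (s y x)) ∧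
  (∀ x : H →L[ℂ] H, (s x x).im = 0 ∧ 0 ≤ (s x x).re)

open scoped InnerProductSpace Topology
open Filter

/-- Euclidean three-space. -/
abbrev E3 := EuclideanSpace ℝ (Fin 3)

/-- A homogeneous frame function of weight `W` on three-space, in coordinates. -/
def IsCoordFrame (F : ℝ → ℝ → ℝ → ℝ) (W : ℝ) : Prop :=
  (∀ c x y z, F (c * x) (c * y) (c * z) = c ^ 2 * F x y z) ∧
  ∀ a b c x y z u v w N : ℝ, a * x + b * y + c * z = 0 → a * u + b * v + c * w = 0 →
    x * u + y * v + z * w = 0 → a ^ 2 + b ^ 2 + c ^ 2 = N → x ^ 2 + y ^ 2 + z ^ 2 = N →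
    u ^ 2 + v ^ 2 + w ^ 2 = N → F a b c + F x y z + F u v w = N * W

/-- A homogeneous frame function of weight `W` on three-space. -/
def IsFrameFn (f : E3 → ℝ) (W : ℝ) : Prop :=
  (∀ (c : ℝ) (v : E3), f (c • v) = c ^ 2 * f v) ∧
  ∀ u v w : E3, ⟪u, v⟫_ℝ = 0 → ⟪u, w⟫_ℝ = 0 → ⟪v, w⟫_ℝ = 0 → ‖v‖ = ‖u‖ → ‖w‖ = ‖u‖ →
    f u + f v + f w = ‖u‖ ^ 2 * W

theorem E3.inner_mk (a b c x y z : ℝ) :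
    ⟪(!₂[a, b, c] : E3), (!₂[x, y, z] : E3)⟫_ℝ = a * x + b * y + c * z := by
  simp [PiLp.inner_apply, Fin.sum_univ_three, mul_comm]

theorem E3.norm_sq_mk (a b c : ℝ) : ‖(!₂[a, b, c] : E3)‖ ^ 2 = a ^ 2 + b ^ 2 + c ^ 2 := by
  rw [← real_inner_self_eq_norm_sq, E3.inner_mk]; ring

theorem E3.smul_mk (t a b c : ℝ) : t • (!₂[a, b, c] : E3) = !₂[t * a, t * b, t * c] := by
  ext i; fin_cases i <;> simp

theorem E3.eta (v : E3) : v = !₂[v 0, v 1, v 2] := by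
  ext i; fin_cases i <;> simp

theorem IsFrameFn.coord {f : E3 → ℝ} {W : ℝ} (hf : IsFrameFn f W) :
    IsCoordFrame (fun x y z => f !₂[x, y, z]) W := by
  refine ⟨fun c x y z => ?_, fun a b c x y z u v w N h1 h2 h3 h4 h5 h6 => ?_⟩
  · rw [← hf.1, E3.smul_mk]
  · have e : ∀ {a b c x y z : ℝ}, a ^ 2 + b ^ 2 + c ^ 2 = N → x ^ 2 + y ^ 2 + z ^ 2 = N →
        ‖(!₂[a, b, c] : E3)‖ = ‖(!₂[x, y, z] : E3)‖ := by
      intro a b c x y z h h'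
      rw [← sq_eq_sq₀ (norm_nonneg _) (norm_nonneg _), E3.norm_sq_mk, E3.norm_sq_mk, h, h']
    rw [hf.2 _ _ _ (by rw [E3.inner_mk, h1]) (by rw [E3.inner_mk, h2]) (by rw [E3.inner_mk, h3])
      (e h5 h4) (e h6 h4), E3.norm_sq_mk, h4]

theorem IsFrameFn.comp {f : E3 → ℝ} {W : ℝ} (hf : IsFrameFn f W) (U : E3 ≃ₗᵢ[ℝ] E3) :
    IsFrameFn (fun v => f (U v)) W := by
  refine ⟨fun c v => by simp only [map_smul, hf.1], fun u v w h1 h2 h3 h4 h5 => ?_⟩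
  have := hf.2 (U u) (U v) (U w) (by simpa using h1) (by simpa using h2) (by simpa using h3)
    (by simpa using h4) (by simpa using h5)
  simpa using this

theorem IsFrameFn.lin {f g : E3 → ℝ} {W W' : ℝ} (hf : IsFrameFn f W) (hg : IsFrameFn g W')
    (a b : ℝ) : IsFrameFn (fun v => a * f v + b * g v) (a * W + b * W') := by
  refine ⟨fun c v => by simp only [hf.1, hg.1]; ring, fun u v w h1 h2 h3 h4 h5 => ?_⟩
  linear_combination a * hf.2 u v w h1 h2 h3 h4 h5 + b * hg.2 u v w h1 h2 h3 h4 h5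

theorem isFrameFn_normSq : IsFrameFn (fun v => ‖v‖ ^ 2) 3 := by
  refine ⟨fun c v => by simp [norm_smul, mul_pow], fun u v w h1 h2 h3 h4 h5 => ?_⟩
  simp only [h4, h5]; ring

theorem E3.exists_isometry {p r : E3} (hp : ‖p‖ = 1) (hr : ‖r‖ = 1) (h : ⟪p, r⟫_ℝ = 0) :
    ∃ U : E3 ≃ₗᵢ[ℝ] E3, U !₂[0, 0, 1] = p ∧ U !₂[1, 0, 0] = r := by
  let v : Fin 3 → E3 := ![r, 0, p]
  have hv : Orthonormal ℝ (({0, 2} : Set (Fin 3)).domRestrict v) := by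
    constructor
    · rintro ⟨i, hi | hi⟩ <;> subst hi <;> simp [v, Set.domRestrict, hp, hr]
    · rintro ⟨i, hi | hi⟩ ⟨j, hj | hj⟩ hij <;> subst hi hj <;> first | (simp at hij; done) | skip
      · simpa [v, Set.domRestrict, real_inner_comm] using h
      · simpa [v, Set.domRestrict] using h
  obtain ⟨b, hb⟩ := hv.exists_orthonormalBasis_extension_of_card_eq (by simp)
  refine ⟨b.repr.symm, ?_, ?_⟩
  · have : (!₂[0, 0, 1] : E3) = EuclideanSpace.single 2 1 := by
      ext i; fin_cases i <;> simp
    rw [this, OrthonormalBasis.repr_symm_single, hb 2 (by simp)]; simp [v]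
  · have : (!₂[1, 0, 0] : E3) = EuclideanSpace.single 0 1 := by
      ext i; fin_cases i <;> simp
    rw [this, OrthonormalBasis.repr_symm_single, hb 0 (by simp)]; simp [v]

theorem E3.exists_orthogonal_two (p q : E3) : ∃ r : E3, ‖r‖ = 1 ∧ ⟪p, r⟫_ℝ = 0 ∧ ⟪q, r⟫_ℝ = 0 := by
  have hd : Module.finrank ℝ (Submodule.span ℝ {p, q} : Submodule ℝ E3) ≤ 2 := by
    have := finrank_span_le_card (R := ℝ) ({p, q} : Set E3)
    refine this.trans ?_
    simpa using Finset.card_le_two (a := p) (b := q)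
  have hs := (Submodule.span ℝ {p, q} : Submodule ℝ E3).finrank_add_finrank_orthogonal
  have hpos : 0 < Module.finrank ℝ ((Submodule.span ℝ {p, q} : Submodule ℝ E3)ᗮ) := by
    have : Module.finrank ℝ E3 = 3 := by simp
    omega
  have := Module.finrank_pos_iff.mp hpos
  obtain ⟨⟨r, hr⟩, hr0⟩ := exists_ne (0 : ((Submodule.span ℝ {p, q} : Submodule ℝ E3)ᗮ))
  have hr0 : r ≠ 0 := fun h => hr0 (by simp [h])
  rw [Submodule.mem_orthogonal] at hr
  refine ⟨(‖r‖⁻¹) • r, ?_, ?_, ?_⟩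
  · rw [norm_smul, norm_inv, norm_norm, inv_mul_cancel₀ (norm_ne_zero_iff.2 hr0)]
  · rw [inner_smul_right, hr p (Submodule.subset_span (by simp)), mul_zero]
  · rw [inner_smul_right, hr q (Submodule.subset_span (by simp)), mul_zero]

theorem IsCoordFrame.pair {F : ℝ → ℝ → ℝ → ℝ} {W : ℝ} (hF : IsCoordFrame F W)
    {a b c x y z N : ℝ} (h1 : a * x + b * y + c * z = 0) (h2 : a ^ 2 + b ^ 2 + c ^ 2 = N)
    (h3 : x ^ 2 + y ^ 2 + z ^ 2 = N) (t : ℝ) :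
    F (a + t * x) (b + t * y) (c + t * z) + F (x - t * a) (y - t * b) (z - t * c)
      = (1 + t ^ 2) * (F a b c + F x y z) := by
  rcases eq_or_ne N 0 with hN | hN
  · have ha : a = 0 := by nlinarith [sq_nonneg a, sq_nonneg b, sq_nonneg c]
    have hb : b = 0 := by nlinarith [sq_nonneg a, sq_nonneg b, sq_nonneg c]
    have hc : c = 0 := by nlinarith [sq_nonneg a, sq_nonneg b, sq_nonneg c]
    have hx : x = 0 := by nlinarith [sq_nonneg x, sq_nonneg y, sq_nonneg z]
    have hy : y = 0 := by nlinarith [sq_nonneg x, sq_nonneg y, sq_nonneg z]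
    have hz : z = 0 := by nlinarith [sq_nonneg x, sq_nonneg y, sq_nonneg z]
    have h0 : F 0 0 0 = 0 := by simpa using hF.1 0 0 0 0
    subst ha hb hc hx hy hz
    simp [h0]
  have hNp : 0 < N := lt_of_le_of_ne (by rw [← h2]; positivity) hN.symm
  have hs : √N ^ 2 = N := Real.sq_sqrt hNp.le
  have hs0 : √N ≠ 0 := by positivity
  set r := √N with hr
  have hr1 : √(1 + t ^ 2) ^ 2 = 1 + t ^ 2 := Real.sq_sqrt (by positivity)
  set k := √(1 + t ^ 2) with hk
  have hrr : r⁻¹ ^ 2 * N = 1 := by rw [← hs]; field_simp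
  have e4 : (b * z - c * y) ^ 2 + (c * x - a * z) ^ 2 + (a * y - b * x) ^ 2 = N ^ 2 := by
    have : (b * z - c * y) ^ 2 + (c * x - a * z) ^ 2 + (a * y - b * x) ^ 2
      = (a ^ 2 + b ^ 2 + c ^ 2) * (x ^ 2 + y ^ 2 + z ^ 2) - (a * x + b * y + c * z) ^ 2 := by ring
    rw [this, h1, h2, h3]; ring
  have A := hF.2 a b c x y z (r⁻¹ * (b * z - c * y)) (r⁻¹ * (c * x - a * z))
    (r⁻¹ * (a * y - b * x)) N h1 (by ring) (by ring) h2 h3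
    (by linear_combination r⁻¹ ^ 2 * e4 + N * hrr)
  have B := hF.2 (a + t * x) (b + t * y) (c + t * z) (x - t * a) (y - t * b) (z - t * c)
    (k * (r⁻¹ * (b * z - c * y))) (k * (r⁻¹ * (c * x - a * z)))
    (k * (r⁻¹ * (a * y - b * x))) ((1 + t ^ 2) * N)
    (by linear_combination (1 - t ^ 2) * h1 - t * h2 + t * h3)
    (by ring) (by ring) (by linear_combination h2 + 2 * t * h1 + t ^ 2 * h3)
    (by linear_combination h3 - 2 * t * h1 + t ^ 2 * h2)
    (by linear_combination k ^ 2 * r⁻¹ ^ 2 * e4 + k ^ 2 * N * hrr + N * hr1)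
  rw [hF.1, hr1] at B
  linear_combination B - (1 + t ^ 2) * A

/-- Symmetrization of a function under the quarter turn about the third axis. -/
def quarterSum (F : ℝ → ℝ → ℝ → ℝ) (x y z : ℝ) : ℝ := F x y z + F (-y) x z

theorem IsCoordFrame.turnSum {F : ℝ → ℝ → ℝ → ℝ} {W : ℝ} (hF : IsCoordFrame F W) :
    IsCoordFrame (quarterSum F) (2 * W) := by
  refine ⟨fun c x y z => ?_, fun a b c x y z u v w N h1 h2 h3 h4 h5 h6 => ?_⟩
  · have := hF.1 c (-y) x z
    simp only [quarterSum, hF.1, mul_neg] at *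
    rw [this]; ring
  · simp only [quarterSum]
    have A := hF.2 a b c x y z u v w N h1 h2 h3 h4 h5 h6
    have B := hF.2 (-b) a c (-y) x z (-v) u w N (by linarith) (by linarith) (by linarith)
      (by linarith) (by linarith) (by linarith)
    linear_combination A + B

theorem IsCoordFrame.turnSum_equator {F : ℝ → ℝ → ℝ → ℝ} {W : ℝ} (hF : IsCoordFrame F W)
    (x y : ℝ) : quarterSum F x y 0 = (x ^ 2 + y ^ 2) * (W - F 0 0 1) := by
  have hs : √(x ^ 2 + y ^ 2) ^ 2 = x ^ 2 + y ^ 2 := Real.sq_sqrt (by positivity)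
  have A := hF.2 x y 0 (-y) x 0 0 0 (√(x ^ 2 + y ^ 2)) (x ^ 2 + y ^ 2) (by ring) (by ring)
    (by ring) (by ring) (by ring) (by linarith)
  have B := hF.1 (√(x ^ 2 + y ^ 2)) 0 0 1
  simp only [mul_zero, mul_one] at B
  rw [B, hs] at A
  simp only [quarterSum]; linear_combination A

/-- Values of the symmetrized function exceed those at the pole and the equator by a controlled
amount only. -/
theorem IsCoordFrame.turnSum_le {F : ℝ → ℝ → ℝ → ℝ} {W η : ℝ} (hF : IsCoordFrame F W)
    (h0 : ∀ x y z, 0 ≤ F x y z) (hη : F 0 0 1 ≤ η) (x y z : ℝ) :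
    quarterSum F x y z ≤ (x ^ 2 + y ^ 2 + z ^ 2) * (W - F 0 0 1 + 2 * η) := by
  have hβ : 0 ≤ W - F 0 0 1 := by
    have := hF.turnSum_equator 1 0
    have h1 : 0 ≤ quarterSum F 1 0 0 := add_nonneg (h0 _ _ _) (h0 _ _ _)
    rw [this] at h1; linarith
  have hp : quarterSum F 0 0 1 = 2 * F 0 0 1 := by simp [quarterSum]; ring
  have hz : quarterSum F 0 0 z = z ^ 2 * (2 * F 0 0 1) := by
    have := hF.turnSum.1 z 0 0 1
    simp only [mul_zero, mul_one] at this
    rw [this, hp]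
  rcases eq_or_ne (x ^ 2 + y ^ 2) 0 with hR | hR
  · have hx : x = 0 := by nlinarith [sq_nonneg x, sq_nonneg y]
    have hy : y = 0 := by nlinarith [sq_nonneg x, sq_nonneg y]
    subst hx hy
    rw [hz]
    nlinarith [sq_nonneg z, mul_nonneg (sq_nonneg z) hβ, mul_le_mul_of_nonneg_left hη (sq_nonneg z)]
  · have hRp : 0 < x ^ 2 + y ^ 2 := lt_of_le_of_ne (by positivity) hR.symm
    have hs : √(x ^ 2 + y ^ 2) ^ 2 = x ^ 2 + y ^ 2 := Real.sq_sqrt hRp.le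
    have hs0 : √(x ^ 2 + y ^ 2) ≠ 0 := by positivity
    set R := √(x ^ 2 + y ^ 2) with hRdef
    have A := hF.turnSum.pair (a := x) (b := y) (c := 0) (x := 0) (y := 0) (z := R)
      (N := x ^ 2 + y ^ 2) (by ring) (by ring) (by linarith) (z / R)
    have e1 : quarterSum F 0 0 R = R ^ 2 * (2 * F 0 0 1) := by
      have := hF.turnSum.1 R 0 0 1
      simp only [mul_zero, mul_one] at this
      rw [this, hp]
    have e2 : 0 ≤ quarterSum F (0 - z / R * x) (0 - z / R * y) (R - z / R * 0) :=
      add_nonneg (h0 _ _ _) (h0 _ _ _)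
    have e3 : x + z / R * 0 = x := by ring
    have e4 : y + z / R * 0 = y := by ring
    have e5 : 0 + z / R * R = z := by field_simp; ring
    rw [e3, e4, e5, hF.turnSum_equator, e1, hs] at A
    have e6 : (1 + (z / R) ^ 2) * (x ^ 2 + y ^ 2) = x ^ 2 + y ^ 2 + z ^ 2 := by
      rw [← hs]; field_simp
    have e7 : quarterSum F x y z ≤ ((1 + (z / R) ^ 2) * (x ^ 2 + y ^ 2)) *
        (W - F 0 0 1 + 2 * F 0 0 1) := by
      rw [← sub_nonneg]; rw [← sub_nonneg] at e2; linarith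
    rw [e6] at e7
    refine e7.trans ?_
    apply mul_le_mul_of_nonneg_left _ (by positivity)
    linarith

/-- The symmetrized function on the affine chart `z = 1`, normalized. -/
noncomputable def chart (F : ℝ → ℝ → ℝ → ℝ) (ζ : ℂ) : ℝ :=
  quarterSum F ζ.re ζ.im 1 / (Complex.normSq ζ + 1)

theorem IsCoordFrame.chart_le {F : ℝ → ℝ → ℝ → ℝ} {W η : ℝ} (hF : IsCoordFrame F W)
    (h0 : ∀ x y z, 0 ≤ F x y z) (hη : F 0 0 1 ≤ η) (ζ : ℂ) (τ : ℝ) :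
    chart F ζ ≤ chart F (ζ * (1 + τ * Complex.I)) + 2 * η := by
  have hη0 : 0 ≤ η := (h0 _ _ _).trans hη
  rcases eq_or_ne ζ 0 with rfl | hζ
  · simp; exact hη0
  have hRp : 0 < Complex.normSq ζ := Complex.normSq_pos.2 hζ
  have hRe : Complex.normSq ζ = ζ.re ^ 2 + ζ.im ^ 2 := by rw [Complex.normSq_apply]; ring
  obtain ⟨P, Q⟩ := ζ
  simp only at hRe
  set R2 := Complex.normSq ⟨P, Q⟩ with hR2
  set κ := √((R2 + 1) / R2) with hκ
  have hκ2 : κ ^ 2 = (R2 + 1) / R2 := Real.sq_sqrt (by positivity)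
  have hκ0 : κ ≠ 0 := by positivity
  have hκ3 : κ ^ 2 * R2 = R2 + 1 := by rw [hκ2]; field_simp
  have A := hF.turnSum.pair (a := P) (b := Q) (c := 1) (x := -κ * Q) (y := κ * P) (z := 0)
    (N := R2 + 1) (by ring) (by rw [hRe]; ring)
    (by rw [← hκ3, hRe]; ring) (τ / κ)
  have B := hF.turnSum_equator (-κ * Q) (κ * P)
  have C := hF.turnSum_le h0 hη (-κ * Q - τ / κ * P) (κ * P - τ / κ * Q) (0 - τ / κ * 1)
  have e1 : P + τ / κ * (-κ * Q) = P - τ * Q := by field_simp; ring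
  have e2 : Q + τ / κ * (κ * P) = Q + τ * P := by field_simp
  have e3 : (-κ * Q) ^ 2 + (κ * P) ^ 2 = R2 + 1 := by rw [← hκ3, hRe]; ring
  have e4 : (-κ * Q - τ / κ * P) ^ 2 + (κ * P - τ / κ * Q) ^ 2 + (0 - τ / κ * 1) ^ 2
      = (1 + (τ / κ) ^ 2) * (R2 + 1) := by
    linear_combination e3 - (τ / κ) ^ 2 * hRe
  have e5 : (1 : ℝ) + τ / κ * 0 = 1 := by ring
  rw [e3] at B
  rw [e4] at C
  rw [e1, e2, e5, B] at A
  have e6 : (1 + (τ / κ) ^ 2) * (R2 + 1) = R2 * (1 + τ ^ 2) + 1 := by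
    rw [div_pow, hκ2]; field_simp; ring
  have hc : chart F (⟨P, Q⟩ * (1 + τ * Complex.I))
      = quarterSum F (P - τ * Q) (Q + τ * P) 1 / ((1 + (τ / κ) ^ 2) * (R2 + 1)) := by
    rw [chart, e6, Complex.normSq_mul]
    congr 1
    · simp; congr 1 <;> ring
    · congr 2
      simp [Complex.normSq_apply]; ring
  rw [hc, chart, ← hR2]
  set t := τ / κ
  have ht : 0 < 1 + t ^ 2 := by positivity
  have hR1 : 0 < R2 + 1 := by positivity
  rw [div_add' _ _ _ (by positivity), div_le_div_iff₀ hR1 (by positivity)]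
  have : (1 + t ^ 2) * quarterSum F P Q 1 ≤ quarterSum F (P - τ * Q) (Q + τ * P) 1
      + (1 + t ^ 2) * (R2 + 1) * (2 * η) := by
    nlinarith
  simp only
  nlinarith [mul_le_mul_of_nonneg_right this hR1.le]

theorem additive_bounded_unitInterval {E : ℝ → ℝ} {K : ℝ}
    (hE : ∀ a b, 0 ≤ a → 0 ≤ b → a + b ≤ 1 → E (a + b) = E a + E b) (h1 : E 1 = 0)
    (hK : ∀ a, 0 ≤ a → a ≤ 1 → |E a| ≤ K) (a : ℝ) (ha : 0 ≤ a) (ha' : a ≤ 1) : E a = 0 := by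
  have key : ∀ n : ℕ, ∀ a, 0 ≤ a → a ≤ 1 → |E a| ≤ K * (1 / 2) ^ n := by
    intro n
    induction n with
    | zero => simpa using hK
    | succ n ih =>
      have half : ∀ a, 0 ≤ a → a ≤ 1 / 2 → |E a| ≤ K * (1 / 2) ^ (n + 1) := by
        intro a h0 h2
        have := ih (a + a) (by linarith) (by linarith)
        rw [hE a a h0 h0 (by linarith), ← two_mul, abs_mul, abs_two] at this
        rw [pow_succ]; linarith
      intro a h0 h2
      rcases le_total a (1 / 2) with h | h
      · exact half a h0 h
      · have h3 := hE a (1 - a) h0 (by linarith) (by linarith)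
        rw [add_sub_cancel, h1] at h3
        have h4 : E a = -E (1 - a) := by linarith
        rw [h4, abs_neg]
        exact half _ (by linarith) (by linarith)
  have lim : Tendsto (fun n : ℕ => K * (1 / 2 : ℝ) ^ n) atTop (𝓝 (K * 0)) :=
    (tendsto_pow_atTop_nhds_zero_of_lt_one (by norm_num) (by norm_num)).const_mul K
  rw [mul_zero] at lim
  have := ge_of_tendsto' lim (fun n => key n a ha ha')
  exact abs_nonpos_iff.1 this

theorem IsCoordFrame.chart_rotate {F : ℝ → ℝ → ℝ → ℝ} {W : ℝ} (hF : IsCoordFrame F W)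
    (h0 : ∀ x y z, 0 ≤ F x y z) (hp : F 0 0 1 = 0) (hc : Continuous (chart F)) (ζ : ℂ) (φ : ℝ) :
    chart F ζ ≤ chart F (ζ * Complex.exp (φ * Complex.I)) := by
  have step : ∀ (k : ℕ) (τ : ℝ), chart F ζ ≤ chart F (ζ * (1 + τ * Complex.I) ^ k) := by
    intro k τ
    induction k with
    | zero => simp
    | succ k ih =>
      refine ih.trans ?_
      have := hF.chart_le h0 hp.le (ζ * (1 + τ * Complex.I) ^ k) τ
      rw [pow_succ, ← mul_assoc]; linarith
  have lim : Tendsto (fun k : ℕ => chart F (ζ * (1 + (φ * Complex.I) / k) ^ k)) atTop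
      (𝓝 (chart F (ζ * Complex.exp (φ * Complex.I)))) :=
    (hc.tendsto _).comp ((Complex.tendsto_one_add_div_pow_exp (φ * Complex.I)).const_mul ζ)
  refine ge_of_tendsto' lim fun k => ?_
  have := step k (φ / k)
  have e : 1 + ((φ / k : ℝ) : ℂ) * Complex.I = 1 + (φ * Complex.I) / k := by push_cast; ring
  rwa [e] at this

theorem IsCoordFrame.turnSum_zonal {F : ℝ → ℝ → ℝ → ℝ} {W : ℝ} (hF : IsCoordFrame F W)
    (h0 : ∀ x y z, 0 ≤ F x y z) (hp : F 0 0 1 = 0)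
    (hc : Continuous fun v : ℝ × ℝ × ℝ => F v.1 v.2.1 v.2.2) (x y z : ℝ) :
    quarterSum F x y z = W * (x ^ 2 + y ^ 2) := by
  have hcc : Continuous (chart F) := by
    unfold chart quarterSum
    refine Continuous.div (Continuous.add ?_ ?_) (Complex.continuous_normSq.add continuous_const) fun ζ => ?_
    · exact hc.comp (f := fun ζ : ℂ => (ζ.re, ζ.im, (1 : ℝ))) (by fun_prop)
    · exact hc.comp (f := fun ζ : ℂ => (-ζ.im, ζ.re, (1 : ℝ))) (by fun_prop)
    · have := Complex.normSq_nonneg ζ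
      positivity
  have hrot : ∀ (ζ : ℂ), chart F ζ = chart F (‖ζ‖ : ℂ) := by
    intro ζ
    apply le_antisymm
    · have := hF.chart_rotate h0 hp hcc ζ (-ζ.arg)
      have e : ζ * Complex.exp ((-ζ.arg : ℝ) * Complex.I) = (‖ζ‖ : ℂ) := by
        calc ζ * Complex.exp ((-ζ.arg : ℝ) * Complex.I)
            = (‖ζ‖ * Complex.exp (ζ.arg * Complex.I)) * Complex.exp ((-ζ.arg : ℝ) * Complex.I) := by
              rw [Complex.norm_mul_exp_arg_mul_I]
          _ = _ := by rw [mul_assoc, ← Complex.exp_add]; simp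
      rwa [e] at this
    · have := hF.chart_rotate h0 hp hcc (‖ζ‖ : ℂ) ζ.arg
      rwa [Complex.norm_mul_exp_arg_mul_I] at this
  have hG := hF.turnSum
  set G := quarterSum F with hGdef
  have hzon1 : ∀ x y, G x y 1 = G (√(x ^ 2 + y ^ 2)) 0 1 := by
    intro x y
    have h := hrot ⟨x, y⟩
    have hn : ‖(⟨x, y⟩ : ℂ)‖ = √(x ^ 2 + y ^ 2) := by
      rw [Complex.norm_def, Complex.normSq_apply, sq, sq]
    rw [chart, chart, hn, ← hGdef] at h
    simp only [Complex.normSq_apply, Complex.ofReal_re, Complex.ofReal_im] at h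
    have e : √(x ^ 2 + y ^ 2) * √(x ^ 2 + y ^ 2) = x * x + y * y := by
      rw [Real.mul_self_sqrt (by positivity)]; ring
    rw [e] at h
    have h3 : x * x + y * y + 1 ≠ 0 := by nlinarith [mul_self_nonneg x, mul_self_nonneg y]
    rw [mul_zero, add_zero] at h
    exact (div_left_inj' h3).1 h
  -- the value on the unit sphere depends on the squared height only
  set k : ℝ → ℝ := fun a => G (√(1 - a)) 0 (√a) with hk
  have hG0 : ∀ x y, G x y 0 = W * (x ^ 2 + y ^ 2) := by
    intro x y
    rw [hGdef, hF.turnSum_equator, hp]; ring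
  have hG1 : G 0 0 1 = 0 := by simp [hGdef, quarterSum, hp]
  have hGneg : ∀ x y z, G (-x) (-y) (-z) = G x y z := by
    intro x y z
    have := hG.1 (-1) x y z
    simpa using this
  have hGk : ∀ x y z, x ^ 2 + y ^ 2 + z ^ 2 = 1 → G x y z = k (z ^ 2) := by
    intro x y z h
    have hxy : 1 - z ^ 2 = x ^ 2 + y ^ 2 := by linarith
    rw [hk]; simp only
    rw [hxy]
    rcases eq_or_ne z 0 with rfl | hz
    · simp only [ne_eq, OfNat.ofNat_ne_zero, not_false_eq_true, zero_pow, Real.sqrt_zero]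
      rw [hG0, hG0, Real.sq_sqrt (by positivity)]; ring
    · have a1 := hG.1 z (x / z) (y / z) 1
      have a2 := hG.1 |z| (√((x / z) ^ 2 + (y / z) ^ 2)) 0 1
      have b1 : z * (x / z) = x := by field_simp
      have b2 : z * (y / z) = y := by field_simp
      have b3 : |z| * √((x / z) ^ 2 + (y / z) ^ 2) = √(x ^ 2 + y ^ 2) := by
        rw [← Real.sqrt_sq_eq_abs, ← Real.sqrt_mul (by positivity)]
        congr 1; field_simp
      rw [b1, b2, mul_one] at a1
      rw [b3, mul_one, mul_zero, sq_abs] at a2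
      rw [Real.sqrt_sq_eq_abs, a1, a2, hzon1]
  have hk0 : k 0 = W := by simp [hk, hG0]
  have hk1 : k 1 = 0 := by simp [hk, hG1]
  have hkb : ∀ a, 0 ≤ a → a ≤ 1 → 0 ≤ k a ∧ k a ≤ W := by
    intro a h0' h1'
    refine ⟨add_nonneg (h0 _ _ _) (h0 _ _ _), ?_⟩
    have := hF.turnSum_le h0 hp.le (√(1 - a)) 0 (√a)
    rw [Real.sq_sqrt (by linarith), Real.sq_sqrt h0', hp] at this
    simp only [hk, hGdef]
    linarith
  have hW : 0 ≤ W := (hkb 0 le_rfl zero_le_one).1.trans_eq hk0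
  have hk3 : ∀ a b c, 0 ≤ a → 0 ≤ b → 0 ≤ c → a + b + c = 1 → k a + k b + k c = 2 * W := by
    intro a b c ha hb hc' habc
    have hp1 : ‖(!₂[√a, √b, √c] : E3)‖ = 1 := by
      rw [← sq_eq_sq₀ (norm_nonneg _) zero_le_one, E3.norm_sq_mk, Real.sq_sqrt ha,
        Real.sq_sqrt hb, Real.sq_sqrt hc', habc, one_pow]
    obtain ⟨r, hr, hr', -⟩ := E3.exists_orthogonal_two (!₂[√a, √b, √c] : E3) 0
    obtain ⟨U, hU, -⟩ := E3.exists_isometry hp1 hr hr'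
    have hin : ∀ v : E3, (U.symm v) 2 = ⟪v, !₂[√a, √b, √c]⟫_ℝ := by
      intro v
      rw [← hU, ← U.symm.inner_map_map, U.symm_apply_apply]
      conv_rhs => rw [E3.eta (U.symm v), E3.inner_mk]
      ring
    have hnrm : ∀ v : E3, ‖v‖ = 1 →
        (U.symm v 0) ^ 2 + (U.symm v 1) ^ 2 + (U.symm v 2) ^ 2 = 1 := by
      intro v hv
      rw [← E3.norm_sq_mk, ← E3.eta, U.symm.norm_map, hv, one_pow]
    have horth : ∀ v w : E3, ⟪v, w⟫_ℝ = 0 →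
        U.symm v 0 * U.symm w 0 + U.symm v 1 * U.symm w 1 + U.symm v 2 * U.symm w 2 = 0 := by
      intro v w h
      rw [← E3.inner_mk, ← E3.eta, ← E3.eta, U.symm.inner_map_map, h]
    have n1 : ‖(!₂[1, 0, 0] : E3)‖ = 1 := by
      rw [← sq_eq_sq₀ (norm_nonneg _) zero_le_one, E3.norm_sq_mk]; norm_num
    have n2 : ‖(!₂[0, 1, 0] : E3)‖ = 1 := by
      rw [← sq_eq_sq₀ (norm_nonneg _) zero_le_one, E3.norm_sq_mk]; norm_num
    have n3 : ‖(!₂[0, 0, 1] : E3)‖ = 1 := by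
      rw [← sq_eq_sq₀ (norm_nonneg _) zero_le_one, E3.norm_sq_mk]; norm_num
    have := hG.2 _ _ _ _ _ _ _ _ _ 1
      (horth !₂[1, 0, 0] !₂[0, 1, 0] (by rw [E3.inner_mk]; norm_num))
      (horth !₂[1, 0, 0] !₂[0, 0, 1] (by rw [E3.inner_mk]; norm_num))
      (horth !₂[0, 1, 0] !₂[0, 0, 1] (by rw [E3.inner_mk]; norm_num))
      (hnrm _ n1) (hnrm _ n2) (hnrm _ n3)
    rw [hGk _ _ _ (hnrm _ n1), hGk _ _ _ (hnrm _ n2), hGk _ _ _ (hnrm _ n3), hin, hin, hin,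
      E3.inner_mk, E3.inner_mk, E3.inner_mk] at this
    simp only [one_mul, zero_mul, add_zero, zero_add] at this
    rw [Real.sq_sqrt ha, Real.sq_sqrt hb, Real.sq_sqrt hc'] at this
    exact this
  have hklin : ∀ a, 0 ≤ a → a ≤ 1 → k a = W * (1 - a) := by
    intro a ha ha1
    have := additive_bounded_unitInterval (E := fun a => k a - W * (1 - a)) (K := W + W)
      (by
        intro a b ha hb hab
        have h1 := hk3 a b (1 - a - b) ha hb (by linarith) (by ring)
        have h2 := hk3 (a + b) 0 (1 - a - b) (by linarith) le_rfl (by linarith) (by ring)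
        rw [hk0] at h2
        linarith)
      (by simp [hk1])
      (by
        intro a ha ha1
        have := hkb a ha ha1
        rw [abs_le]; constructor <;> nlinarith)
      a ha ha1
    linarith
  rcases eq_or_ne (x ^ 2 + y ^ 2 + z ^ 2) 0 with hN | hN
  · have hz : z = 0 := by nlinarith [sq_nonneg x, sq_nonneg y, sq_nonneg z]
    subst hz
    exact hG0 x y
  · have hNp : 0 < x ^ 2 + y ^ 2 + z ^ 2 := lt_of_le_of_ne (by positivity) hN.symm
    set N := x ^ 2 + y ^ 2 + z ^ 2 with hNd
    have hs : √N ^ 2 = N := Real.sq_sqrt hNp.le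
    have hs0 : √N ≠ 0 := by positivity
    have u : (x / √N) ^ 2 + (y / √N) ^ 2 + (z / √N) ^ 2 = 1 := by
      rw [div_pow, div_pow, div_pow, hs]; field_simp; exact hNd.symm
    have a1 := hG.1 (√N) (x / √N) (y / √N) (z / √N)
    rw [hGk _ _ _ u, hklin _ (by positivity) (by nlinarith [sq_nonneg (x / √N), sq_nonneg (y / √N)]),
      mul_div_cancel₀ _ hs0, mul_div_cancel₀ _ hs0, mul_div_cancel₀ _ hs0, hs, div_pow, hs] at a1
    rw [a1]; field_simp; rw [hNd]; ring

/-- The degree-zero normalization of a homogeneous function of degree two. -/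
noncomputable def sphereVal (f : E3 → ℝ) (v : E3) : ℝ := f v / ‖v‖ ^ 2

theorem IsFrameFn.sphereVal_smul {f : E3 → ℝ} {W : ℝ} (hf : IsFrameFn f W) {c : ℝ} (hc : c ≠ 0)
    (v : E3) : sphereVal f (c • v) = sphereVal f v := by
  rw [sphereVal, sphereVal, hf.1, norm_smul, mul_pow, Real.norm_eq_abs, sq_abs]
  exact mul_div_mul_left _ _ (by positivity)

theorem IsFrameFn.sphereVal_pair {f : E3 → ℝ} {W : ℝ} (hf : IsFrameFn f W) {q u : E3}
    (hq : q ≠ 0) (hu : u ≠ 0) (h : ⟪q, u⟫_ℝ = 0) (τ : ℝ) :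
    sphereVal f q + sphereVal f u = sphereVal f (q + τ • u) +
      sphereVal f (‖q‖ ^ 2 • u - (τ * ‖u‖ ^ 2) • q) := by
  have hq0 : ‖q‖ ≠ 0 := norm_ne_zero_iff.2 hq
  have hu0 : ‖u‖ ≠ 0 := norm_ne_zero_iff.2 hu
  set κ := ‖q‖ / ‖u‖ with hκ
  have hκ0 : κ ≠ 0 := by positivity
  have hqn : q 0 ^ 2 + q 1 ^ 2 + q 2 ^ 2 = ‖q‖ ^ 2 := by rw [← E3.norm_sq_mk, ← E3.eta]
  have hun : u 0 ^ 2 + u 1 ^ 2 + u 2 ^ 2 = ‖u‖ ^ 2 := by rw [← E3.norm_sq_mk, ← E3.eta]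
  have hin : q 0 * u 0 + q 1 * u 1 + q 2 * u 2 = 0 := by
    rw [← E3.inner_mk, ← E3.eta, ← E3.eta, h]
  have A := hf.coord.pair (a := q 0) (b := q 1) (c := q 2) (x := κ * u 0) (y := κ * u 1)
    (z := κ * u 2) (N := ‖q‖ ^ 2) (by linear_combination κ * hin) hqn
    (by
      have : κ ^ 2 * ‖u‖ ^ 2 = ‖q‖ ^ 2 := by rw [hκ]; field_simp
      linear_combination κ ^ 2 * hun + this) (τ / κ)
  have e1 : (!₂[q 0 + τ / κ * (κ * u 0), q 1 + τ / κ * (κ * u 1), q 2 + τ / κ * (κ * u 2)] : E3)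
      = q + τ • u := by
    ext i; fin_cases i <;> simp <;> field_simp
  have e2 : (!₂[κ * u 0 - τ / κ * q 0, κ * u 1 - τ / κ * q 1, κ * u 2 - τ / κ * q 2] : E3)
      = (κ / ‖q‖ ^ 2) • (‖q‖ ^ 2 • u - (τ * ‖u‖ ^ 2) • q) := by
    ext i; fin_cases i <;> simp [hκ] <;> field_simp
  have e3 : (!₂[κ * u 0, κ * u 1, κ * u 2] : E3) = κ • u := by
    ext i; fin_cases i <;> simp
  simp only at A
  rw [e1, e2, e3, ← E3.eta, hf.1, hf.1] at A
  have n1 : ‖q + τ • u‖ ^ 2 = ‖q‖ ^ 2 + τ ^ 2 * ‖u‖ ^ 2 := by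
    rw [norm_add_sq_real, inner_smul_right, h, norm_smul, mul_pow, Real.norm_eq_abs, sq_abs]; ring
  have n2 : ‖‖q‖ ^ 2 • u - (τ * ‖u‖ ^ 2) • q‖ ^ 2
      = ‖q‖ ^ 2 * ‖u‖ ^ 2 * (‖q‖ ^ 2 + τ ^ 2 * ‖u‖ ^ 2) := by
    rw [norm_sub_sq_real, inner_smul_right, inner_smul_left, real_inner_comm, h, norm_smul,
      norm_smul, mul_pow, mul_pow, Real.norm_eq_abs, sq_abs, Real.norm_eq_abs, sq_abs]; ring
  rw [sphereVal, sphereVal, sphereVal, sphereVal, n1, n2]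
  have hp : ‖q‖ ^ 2 + τ ^ 2 * ‖u‖ ^ 2 ≠ 0 := by positivity
  rw [hκ] at A
  field_simp at A ⊢
  linear_combination -A

theorem sphereVal_comp (f : E3 → ℝ) (U : E3 ≃ₗᵢ[ℝ] E3) (v : E3) :
    sphereVal (fun v => f (U v)) v = sphereVal f (U v) := by
  simp [sphereVal]

/-- Oscillation bounds at the first coordinate vector transfer to the third one. -/
theorem IsFrameFn.osc_transfer_basis {f : E3 → ℝ} {W α : ℝ} (hf : IsFrameFn f W)
    (h : ∀ᶠ y in 𝓝 (!₂[1, 0, 0] : E3), |sphereVal f y - sphereVal f !₂[1, 0, 0]| ≤ α) :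
    ∀ᶠ y in 𝓝 (!₂[0, 0, 1] : E3), |sphereVal f y - sphereVal f !₂[0, 0, 1]| ≤ 4 * α := by
  set e₁ : E3 := !₂[1, 0, 0] with he₁
  set e₂ : E3 := !₂[0, 1, 0] with he₂
  set e₃ : E3 := !₂[0, 0, 1] with he₃
  have hc : ∀ ε : ℝ, Tendsto (fun σ : ℝ => e₁ + (ε * σ) • e₂) (𝓝 0) (𝓝 e₁) := by
    intro ε
    have : Continuous fun σ : ℝ => e₁ + (ε * σ) • e₂ := by fun_prop
    simpa using this.tendsto 0
  have h2 := (eventually_eventually_nhds.2 h)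
  obtain ⟨σ, hσp, hσm, hσ0⟩ := (((hc 1).eventually h2).filter_mono nhdsWithin_le_nhds |>.and
    ((((hc (-1)).eventually h2).filter_mono nhdsWithin_le_nhds).and
      (self_mem_nhdsWithin : ∀ᶠ σ in 𝓝[>] (0 : ℝ), σ ∈ Set.Ioi (0 : ℝ)))).exists
  set u₁ : E3 := e₁ + (1 * σ) • e₂ with hu₁
  let u₂ : E3 → E3 := fun q => (q 2) • e₁ - (σ * q 2) • e₂ + (σ * q 1 - q 0) • e₃
  let μ' : E3 → ℝ := fun q => (q 1 - σ * q 0) / (2 * σ * q 2)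
  let μ : E3 → ℝ := fun q => (q 1 + σ * q 0) / (2 * σ)
  let lam : E3 → ℝ := fun q => q 2 + μ' q * (σ * q 1 - q 0)
  have hco : ∀ i, ContinuousAt (fun q : E3 => q i) e₃ := fun i => by fun_prop
  have z0 : e₃ 0 = 0 := by simp [he₃]
  have z1 : e₃ 1 = 0 := by simp [he₃]
  have z2 : e₃ 2 = 1 := by simp [he₃]
  have cμ' : ContinuousAt μ' e₃ := by
    refine ContinuousAt.div (by fun_prop) (by fun_prop) ?_
    rw [z2]; positivity
  have cμ : ContinuousAt μ e₃ := by
    refine ContinuousAt.div (by fun_prop) (by fun_prop) ?_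
    positivity
  have clam : ContinuousAt lam e₃ := by fun_prop
  have cu₂ : ContinuousAt u₂ e₃ := by fun_prop
  have vμ' : μ' e₃ = 0 := by simp [μ', z0, z1]
  have vμ : μ e₃ = 0 := by simp [μ, z0, z1]
  have vlam : lam e₃ = 1 := by simp [lam, vμ', z2]
  have vu₂ : u₂ e₃ = e₁ + (-1 * σ) • e₂ := by
    simp only [u₂, z0, z1, z2]; module
  let B : E3 → E3 := fun q => ‖q‖ ^ 2 • u₂ q - (μ' q * ‖u₂ q‖ ^ 2) • q
  let C : E3 → E3 := fun q => ‖e₃‖ ^ 2 • u₁ - ((μ q / lam q) * ‖u₁‖ ^ 2) • e₃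
  have ne3 : ‖e₃‖ ^ 2 = 1 := by rw [he₃, E3.norm_sq_mk]; norm_num
  have cB : ContinuousAt B e₃ := by fun_prop
  have cdiv : ContinuousAt (fun q => μ q / lam q) e₃ := cμ.div clam (by rw [vlam]; norm_num)
  have cC : ContinuousAt C e₃ := by fun_prop
  have vB : B e₃ = e₁ + (-1 * σ) • e₂ := by
    simp only [B]; rw [vμ', vu₂, ne3]; module
  have vC : C e₃ = u₁ := by
    simp only [C]; rw [vμ, ne3]; module
  have pA := cu₂.tendsto.eventually (vu₂ ▸ hσm)
  have pB := cB.tendsto.eventually (vB ▸ hσm)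
  have pC := cC.tendsto.eventually (vC.symm ▸ hσp)
  have pu1 := hσp.self_of_nhds
  have hlam := clam.eventually_ne (vlam ▸ one_ne_zero : lam e₃ ≠ 0)
  have hr : ∀ᶠ q in 𝓝 e₃, q 2 ≠ 0 := (hco 2).eventually_ne (by rw [z2]; norm_num)
  filter_upwards [pA, pB, pC, hlam, hr] with q pA pB pC hlam hr
  have hq : q ≠ 0 := fun h => hr (by simp [h])
  have hu2 : u₂ q ≠ 0 := by
    intro h
    have := congrArg (fun v : E3 => v 0) h
    simp [u₂, he₁, he₂, he₃] at this
    exact hr this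
  have hu1 : u₁ ≠ 0 := by
    intro h
    have := congrArg (fun v : E3 => v 0) h
    simp [hu₁, he₁, he₂] at this
  have he3 : e₃ ≠ 0 := fun h => by simp [h] at z2
  have eu2 : u₂ q = !₂[q 2, -(σ * q 2), σ * q 1 - q 0] := by
    ext i; fin_cases i <;> simp [u₂, he₁, he₂, he₃]
  have eu1 : u₁ = !₂[1, σ, 0] := by
    ext i; fin_cases i <;> simp [hu₁, he₁, he₂]
  have E1 := hf.sphereVal_pair hq hu2 (by
    rw [eu2, E3.eta q, E3.inner_mk]; simp; ring) (μ' q)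
  have E2 := hf.sphereVal_pair he3 hu1 (by rw [eu1, he₃, E3.inner_mk]; ring) (μ q / lam q)
  have hx : q + μ' q • u₂ q = lam q • (e₃ + (μ q / lam q) • u₁) := by
    rw [eu2, eu1]
    ext i; fin_cases i <;> simp [he₃] <;> field_simp <;> simp only [μ, μ', lam] <;> field_simp <;>
      ring
  rw [hx, hf.sphereVal_smul hlam] at E1
  change _ = _ + sphereVal f (B q) at E1
  change _ = _ + sphereVal f (C q) at E2
  rw [abs_le] at *
  constructor <;> linarith [pA.1, pA.2, pB.1, pB.2, pC.1, pC.2, pu1.1, pu1.2]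

theorem IsFrameFn.osc_transfer {f : E3 → ℝ} {W α : ℝ} (hf : IsFrameFn f W) {u q : E3}
    (hu : u ≠ 0) (hq : q ≠ 0) (huq : ⟪q, u⟫_ℝ = 0)
    (h : ∀ᶠ y in 𝓝 u, |sphereVal f y - sphereVal f u| ≤ α) :
    ∀ᶠ y in 𝓝 q, |sphereVal f y - sphereVal f q| ≤ 4 * α := by
  have hu0 : ‖u‖ ≠ 0 := norm_ne_zero_iff.2 hu
  have hq0 : ‖q‖ ≠ 0 := norm_ne_zero_iff.2 hq
  obtain ⟨U, hU3, hU1⟩ := E3.exists_isometry (p := ‖q‖⁻¹ • q) (r := ‖u‖⁻¹ • u)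
    (by rw [norm_smul, norm_inv, norm_norm, inv_mul_cancel₀ hq0])
    (by rw [norm_smul, norm_inv, norm_norm, inv_mul_cancel₀ hu0])
    (by rw [inner_smul_left, inner_smul_right, huq]; simp)
  have hf' := hf.comp U
  have c1 : Continuous fun y : E3 => ‖u‖ • U y := by fun_prop
  have c2 : Continuous fun y : E3 => ‖q‖⁻¹ • U.symm y := by fun_prop
  have v1 : ‖u‖ • U !₂[1, 0, 0] = u := by rw [hU1, smul_smul, mul_inv_cancel₀ hu0, one_smul]
  have v2 : ‖q‖⁻¹ • U.symm q = !₂[0, 0, 1] := by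
    rw [← map_smul, ← hU3, U.symm_apply_apply]
  have s1 : ∀ y, sphereVal f (‖u‖ • U y) = sphereVal (fun v => f (U v)) y := by
    intro y; rw [hf.sphereVal_smul hu0, sphereVal_comp]
  have s2 : ∀ y, sphereVal (fun v => f (U v)) (‖q‖⁻¹ • U.symm y) = sphereVal f y := by
    intro y; rw [hf'.sphereVal_smul (inv_ne_zero hq0), sphereVal_comp, U.apply_symm_apply]
  have A := hf'.osc_transfer_basis (α := α) (by
    have := (c1.tendsto !₂[1, 0, 0]).eventually (by rw [v1]; exact h)
    filter_upwards [this] with y hy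
    rwa [← s1, ← s1, v1])
  have := (c2.tendsto q).eventually (by rw [v2]; exact A)
  filter_upwards [this] with y hy
  rwa [s2, ← v2, s2] at hy

theorem IsFrameFn.osc_transfer_all {f : E3 → ℝ} {W α : ℝ} (hf : IsFrameFn f W) {u q : E3}
    (hu : u ≠ 0) (hq : q ≠ 0)
    (h : ∀ᶠ y in 𝓝 u, |sphereVal f y - sphereVal f u| ≤ α) :
    ∀ᶠ y in 𝓝 q, |sphereVal f y - sphereVal f q| ≤ 16 * α := by
  obtain ⟨r, hr, h1, h2⟩ := E3.exists_orthogonal_two u q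
  have hr0 : r ≠ 0 := fun h => by simp [h] at hr
  have A := hf.osc_transfer hu hr0 (by rw [real_inner_comm, h1]) h
  have B := hf.osc_transfer hr0 hq h2 A
  filter_upwards [B] with y hy
  linarith

theorem IsCoordFrame.isFrameFn {F : ℝ → ℝ → ℝ → ℝ} {W : ℝ} (hF : IsCoordFrame F W) :
    IsFrameFn (fun v => F (v 0) (v 1) (v 2)) W := by
  refine ⟨fun c v => ?_, fun u v w h1 h2 h3 h4 h5 => ?_⟩
  · simpa using hF.1 c (v 0) (v 1) (v 2)
  · have n : ∀ u : E3, u 0 ^ 2 + u 1 ^ 2 + u 2 ^ 2 = ‖u‖ ^ 2 := fun u => by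
      rw [← E3.norm_sq_mk, ← E3.eta]
    have i : ∀ u v : E3, u 0 * v 0 + u 1 * v 1 + u 2 * v 2 = ⟪u, v⟫_ℝ := fun u v => by
      rw [← E3.inner_mk, ← E3.eta, ← E3.eta]
    exact hF.2 _ _ _ _ _ _ _ _ _ _ (by rw [i, h1]) (by rw [i, h2]) (by rw [i, h3]) (n u)
      (by rw [n, h4]) (by rw [n, h5])

theorem IsCoordFrame.exists_small_osc {F : ℝ → ℝ → ℝ → ℝ} {W η : ℝ} (hF : IsCoordFrame F W)
    (h0 : ∀ x y z, 0 ≤ F x y z) (hη : F 0 0 1 ≤ η) (hη0 : 0 < η) :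
    ∃ ζ₁ : ℂ, ∀ᶠ ζ in 𝓝 ζ₁, |chart F ζ - chart F ζ₁| ≤ 5 * η := by
  have hnn : ∀ ζ, 0 ≤ chart F ζ := fun ζ =>
    div_nonneg (add_nonneg (h0 _ _ _) (h0 _ _ _)) (by have := Complex.normSq_nonneg ζ; positivity)
  set S : Set ℝ := chart F '' {ζ | ζ ≠ 0} with hS
  have hSne : S.Nonempty := ⟨_, 1, one_ne_zero, rfl⟩
  have hSb : BddBelow S := ⟨0, by rintro _ ⟨ζ, -, rfl⟩; exact hnn ζ⟩
  obtain ⟨_, ⟨ζ₀, hζ₀, rfl⟩, hlt⟩ := exists_lt_of_csInf_lt hSne (lt_add_of_pos_right (sInf S) hη0)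
  have hγ : ∀ ζ, ζ ≠ 0 → sInf S ≤ chart F ζ := fun ζ h => csInf_le hSb ⟨ζ, h, rfl⟩
  have up : ∀ ζ, ζ ≠ 0 → 4 * (1 - (ζ₀ / ζ).re) ≤ (ζ₀ / ζ).im ^ 2 →
      chart F ζ ≤ sInf S + 5 * η := by
    intro ζ hζ hw
    set w := ζ₀ / ζ
    set D := √(w.im ^ 2 - 4 * (1 - w.re)) with hD
    have hD2 : D ^ 2 = w.im ^ 2 - 4 * (1 - w.re) := Real.sq_sqrt (by linarith)
    have e : w = (1 + ((w.im + D) / 2 : ℝ) * Complex.I) * (1 + ((w.im - D) / 2 : ℝ) * Complex.I) := by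
      apply Complex.ext
      · simp; linear_combination -hD2 / 4
      · simp; ring
    have s1 := hF.chart_le h0 hη ζ ((w.im + D) / 2)
    have s2 := hF.chart_le h0 hη (ζ * (1 + ((w.im + D) / 2 : ℝ) * Complex.I)) ((w.im - D) / 2)
    rw [mul_assoc, ← e, mul_div_cancel₀ _ hζ] at s2
    linarith
  refine ⟨ζ₀ / 2, ?_⟩
  have h2 : ζ₀ / 2 ≠ 0 := div_ne_zero hζ₀ two_ne_zero
  have hζ₀' : ζ₀ ≠ 0 := hζ₀
  have v2 : ζ₀ / (ζ₀ / 2) = 2 := by field_simp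
  have hc : ContinuousAt (fun ζ => ζ₀ / ζ) (ζ₀ / 2) := continuousAt_const.div continuousAt_id h2
  have ev : ∀ᶠ ζ in 𝓝 (ζ₀ / 2), 4 * (1 - (ζ₀ / ζ).re) < (ζ₀ / ζ).im ^ 2 := by
    have c1 : ContinuousAt (fun ζ => 4 * (1 - (ζ₀ / ζ).re)) (ζ₀ / 2) := by
      have := Complex.continuous_re.continuousAt.comp hc
      exact continuousAt_const.mul (continuousAt_const.sub this)
    have c2 : ContinuousAt (fun ζ => (ζ₀ / ζ).im ^ 2) (ζ₀ / 2) := by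
      have := Complex.continuous_im.continuousAt.comp hc
      exact this.pow 2
    apply c1.eventually_lt c2
    rw [v2]; norm_num
  have b0 := hγ _ h2
  have b1 := up _ h2 ev.self_of_nhds.le
  filter_upwards [ev, continuousAt_id.eventually_ne h2] with ζ h hζ
  have b2 := hγ ζ hζ
  have b3 := up ζ hζ h.le
  rw [abs_le]; constructor <;> linarith

theorem IsFrameFn.osc_of_small {f : E3 → ℝ} {W η : ℝ} (hf : IsFrameFn f W)
    (h0 : ∀ v, 0 ≤ f v) (hη0 : 0 < η) {p : E3} (hp : ‖p‖ = 1) (hη : f p ≤ η) {q : E3}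
    (hq : q ≠ 0) : ∀ᶠ y in 𝓝 q, |sphereVal f y - sphereVal f q| ≤ 16 * (82 * η) := by
  have hp0 : p ≠ 0 := fun h => by simp [h] at hp
  obtain ⟨r, hr, hr', -⟩ := E3.exists_orthogonal_two p 0
  obtain ⟨U, hU, -⟩ := E3.exists_isometry hp hr hr'
  have hf' := hf.comp U
  set F : ℝ → ℝ → ℝ → ℝ := fun x y z => f (U !₂[x, y, z]) with hF
  have hFc : IsCoordFrame F W := hf'.coord
  have hF0 : ∀ x y z, 0 ≤ F x y z := fun x y z => h0 _
  have hFη : F 0 0 1 ≤ η := by simp only [hF, hU]; exact hη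
  obtain ⟨ζ₁, hζ₁⟩ := hFc.exists_small_osc hF0 hFη hη0
  set g : E3 → ℝ := fun v => quarterSum F (v 0) (v 1) (v 2) with hg
  have hgf : IsFrameFn g (2 * W) := hFc.turnSum.isFrameFn
  have gchart : ∀ v : E3, v 2 ≠ 0 → sphereVal g v = chart F ⟨v 0 / v 2, v 1 / v 2⟩ := by
    intro v hv
    have e : v = v 2 • (!₂[v 0 / v 2, v 1 / v 2, 1] : E3) := by
      ext i; fin_cases i <;> simp <;> field_simp
    conv_lhs => rw [e, hgf.sphereVal_smul hv, sphereVal, E3.norm_sq_mk]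
    rw [chart, Complex.normSq_apply]
    simp only [hg]
    simp
    ring
  have hosc : ∀ᶠ y in 𝓝 (!₂[ζ₁.re, ζ₁.im, 1] : E3),
      |sphereVal g y - sphereVal g !₂[ζ₁.re, ζ₁.im, 1]| ≤ 5 * η := by
    set u : E3 := !₂[ζ₁.re, ζ₁.im, 1] with hu
    have u2 : u 2 = 1 := by simp [hu]
    have ca : ContinuousAt (fun v : E3 => (⟨v 0 / v 2, v 1 / v 2⟩ : ℂ)) u := by
      have c : ∀ i, ContinuousAt (fun v : E3 => v i) u := fun i => by fun_prop
      have a0 : ContinuousAt (fun v : E3 => v 0 / v 2) u := (c 0).div (c 2) (by rw [u2]; norm_num)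
      have a1 : ContinuousAt (fun v : E3 => v 1 / v 2) u := (c 1).div (c 2) (by rw [u2]; norm_num)
      have : (fun v : E3 => (⟨v 0 / v 2, v 1 / v 2⟩ : ℂ)) =
          fun v : E3 => ((v 0 / v 2 : ℝ) : ℂ) + ((v 1 / v 2 : ℝ) : ℂ) * Complex.I := by
        funext v; exact Complex.mk_eq_add_mul_I _ _
      rw [this]
      exact (Complex.continuous_ofReal.continuousAt.comp a0).add
        ((Complex.continuous_ofReal.continuousAt.comp a1).mul continuousAt_const)
    have vu : (⟨u 0 / u 2, u 1 / u 2⟩ : ℂ) = ζ₁ := by simp [hu]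
    have e1 := ca.tendsto.eventually (by rw [vu]; exact hζ₁)
    have e2 : ∀ᶠ v : E3 in 𝓝 u, v 2 ≠ 0 := by
      have c : ContinuousAt (fun v : E3 => v 2) u := by fun_prop
      exact c.eventually_ne (by rw [u2]; norm_num)
    filter_upwards [e1, e2] with v h1 h2
    rw [gchart v h2, gchart u (by rw [u2]; norm_num), vu]
    exact h1
  have hu0 : (!₂[ζ₁.re, ζ₁.im, 1] : E3) ≠ 0 := fun h => by
    have := congrArg (fun v : E3 => v 2) h
    simp at this
  have he0 : (!₂[0, 0, 1] : E3) ≠ 0 := fun h => by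
    have := congrArg (fun v : E3 => v 2) h
    simp at this
  have he1 : ‖(!₂[0, 0, 1] : E3)‖ ^ 2 = 1 := by rw [E3.norm_sq_mk]; norm_num
  have A := hgf.osc_transfer_all hu0 he0 hosc
  have gpole : sphereVal g !₂[0, 0, 1] ≤ 2 * η := by
    rw [sphereVal, he1]
    simp [hg, quarterSum]; linarith
  have fle : ∀ v, sphereVal (fun v => f (U v)) v ≤ sphereVal g v := by
    intro v
    apply div_le_div_of_nonneg_right _ (by positivity)
    simp only [hg, quarterSum, hF]
    rw [← E3.eta]
    linarith [h0 (U !₂[-v 1, v 0, v 2])]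
  have fnn : ∀ v, 0 ≤ sphereVal (fun v => f (U v)) v := fun v => div_nonneg (h0 _) (by positivity)
  have B : ∀ᶠ y in 𝓝 p, |sphereVal f y - sphereVal f p| ≤ 82 * η := by
    have c : Continuous fun y : E3 => U.symm y := by fun_prop
    have vp : U.symm p = !₂[0, 0, 1] := by rw [← hU, U.symm_apply_apply]
    have := (c.tendsto p).eventually (by rw [vp]; exact A)
    filter_upwards [this] with y hy
    have k : ∀ y, sphereVal f y = sphereVal (fun v => f (U v)) (U.symm y) := fun y => by
      rw [sphereVal_comp, U.apply_symm_apply]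
    rw [k y, k p, vp]
    have h1 := fle (U.symm y)
    have h2 := fle !₂[0, 0, 1]
    have h3 := fnn (U.symm y)
    have h4 := fnn !₂[0, 0, 1]
    rw [abs_le] at *
    constructor <;> linarith
  exact hf.osc_transfer_all hp0 hq B

/-- Bounded frame functions on three-space are continuous. -/
theorem IsFrameFn.continuous {f : E3 → ℝ} {W C : ℝ} (hf : IsFrameFn f W)
    (hC : ∀ v, |f v| ≤ C * ‖v‖ ^ 2) : Continuous f := by
  set S : Set ℝ := f '' Metric.sphere 0 1 with hS
  have hS1 : S.Nonempty := by
    obtain ⟨r, hr, -, -⟩ := E3.exists_orthogonal_two 0 0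
    exact ⟨_, r, by simpa using hr, rfl⟩
  have hSb : BddBelow S := by
    refine ⟨-C, ?_⟩
    rintro _ ⟨v, hv, rfl⟩
    have := (abs_le.1 (hC v)).1
    simp at hv
    rw [hv] at this; linarith
  set m := sInf S with hm
  set g : E3 → ℝ := fun v => 1 * f v + (-m) * ‖v‖ ^ 2 with hg
  have hgf : IsFrameFn g _ := hf.lin isFrameFn_normSq 1 (-m)
  have hC0 : ∀ v, v = 0 → f v = 0 := fun v h => by
    have := hC v; rw [h] at this; simpa [h] using this
  have hg0 : ∀ v, 0 ≤ g v := by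
    intro v
    rcases eq_or_ne v 0 with h | h
    · subst h; simp [hg, hC0 0 rfl]
    · have hn : ‖v‖ ≠ 0 := norm_ne_zero_iff.2 h
      have h1 : m ≤ f (‖v‖⁻¹ • v) := csInf_le hSb ⟨_, by simp [norm_smul, hn], rfl⟩
      rw [hf.1] at h1
      simp only [hg]
      have : 0 < ‖v‖ ^ 2 := by positivity
      have h2 := mul_le_mul_of_nonneg_left h1 this.le
      have h3 : ‖v‖ ^ 2 * (‖v‖⁻¹ ^ 2 * f v) = f v := by field_simp
      rw [h3] at h2; linarith
  have hcont : Continuous g := by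
    rw [continuous_iff_continuousAt]
    intro q
    rcases eq_or_ne q 0 with rfl | hq
    · have hgC : ∀ v, |g v| ≤ (C + |m|) * ‖v‖ ^ 2 := by
        intro v
        have h1 := hC v
        have h2 : |m * ‖v‖ ^ 2| = |m| * ‖v‖ ^ 2 := by rw [abs_mul, abs_of_nonneg (sq_nonneg ‖v‖)]
        have h3 := abs_sub (f v) (m * ‖v‖ ^ 2)
        have h4 : g v = f v - m * ‖v‖ ^ 2 := by simp only [hg]; ring
        rw [h4]; linarith
      have hg00 : g 0 = 0 := by simpa using hgC 0
      rw [ContinuousAt, hg00]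
      apply squeeze_zero_norm (a := fun v => (C + |m|) * ‖v‖ ^ 2) hgC
      have : Continuous fun v : E3 => (C + |m|) * ‖v‖ ^ 2 := by fun_prop
      simpa using this.tendsto 0
    · have hs : ContinuousAt (sphereVal g) q := by
        rw [Metric.continuousAt_iff']
        intro ε hε
        set η := ε / (2 * (16 * 82)) with hη
        have hη0 : 0 < η := by positivity
        obtain ⟨_, ⟨p, hp, rfl⟩, hlt⟩ := exists_lt_of_csInf_lt hS1
          (lt_add_of_pos_right m hη0)
        have hp1 : ‖p‖ = 1 := by simpa using hp
        have := hgf.osc_of_small hg0 hη0 hp1 (by simp only [hg, hp1]; linarith) hq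
        filter_upwards [this] with y hy
        rw [Real.dist_eq]
        refine hy.trans_lt ?_
        rw [hη]; linarith
      have h1 : ContinuousAt (fun v => sphereVal g v * ‖v‖ ^ 2) q :=
        hs.mul (by fun_prop)
      refine h1.congr ?_
      filter_upwards [continuousAt_id.eventually_ne hq] with v hv
      have hn : ‖v‖ ≠ 0 := norm_ne_zero_iff.2 hv
      rw [sphereVal]; field_simp
  have : f = fun v => g v + m * ‖v‖ ^ 2 := by funext v; simp only [hg]; ring
  rw [this]
  fun_prop

theorem IsFrameFn.zonal {f : E3 → ℝ} {W : ℝ} (hf : IsFrameFn f W) (hc : Continuous f)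
    (h0 : ∀ v, 0 ≤ f v) (hp : f !₂[0, 0, 1] = 0) (x y z : ℝ) :
    f !₂[x, y, z] + f !₂[-y, x, z] = W * (x ^ 2 + y ^ 2) := by
  refine hf.coord.turnSum_zonal (fun _ _ _ => h0 _) hp ?_ x y z
  apply hc.comp
  fun_prop

theorem IsFrameFn.le_of_zero {f : E3 → ℝ} {W : ℝ} (hf : IsFrameFn f W) (hc : Continuous f)
    (h0 : ∀ v, 0 ≤ f v) {p : E3} (hp1 : ‖p‖ = 1) (hp : f p = 0) (v : E3) :
    f v ≤ W * (‖v‖ ^ 2 - ⟪v, p⟫_ℝ ^ 2) := by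
  obtain ⟨r, hr, hr', -⟩ := E3.exists_orthogonal_two p 0
  obtain ⟨U, hU, -⟩ := E3.exists_isometry hp1 hr hr'
  have A := (hf.comp U).zonal (by fun_prop) (fun v => h0 _) (by rw [hU, hp]) (U.symm v 0)
    (U.symm v 1) (U.symm v 2)
  rw [← E3.eta, U.apply_symm_apply] at A
  have n : (U.symm v 0) ^ 2 + (U.symm v 1) ^ 2 + (U.symm v 2) ^ 2 = ‖v‖ ^ 2 := by
    rw [← E3.norm_sq_mk, ← E3.eta, U.symm.norm_map]
  have i : ⟪v, p⟫_ℝ = U.symm v 2 := by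
    rw [← hU, ← U.symm.inner_map_map, U.symm_apply_apply]
    conv_lhs => rw [E3.eta (U.symm v), E3.inner_mk]
    ring
  rw [i, ← n]
  have := h0 (U !₂[-U.symm v 1, U.symm v 0, U.symm v 2])
  have e : U.symm v 0 ^ 2 + U.symm v 1 ^ 2 + U.symm v 2 ^ 2 - U.symm v 2 ^ 2
      = U.symm v 0 ^ 2 + U.symm v 1 ^ 2 := by ring
  rw [e]; linarith

theorem IsFrameFn.exists_max {f : E3 → ℝ} {W : ℝ} (hf : IsFrameFn f W) (hc : Continuous f) :
    ∃ p : E3, ‖p‖ = 1 ∧ ∀ v, f v ≤ f p * ‖v‖ ^ 2 := by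
  obtain ⟨r, hr, -, -⟩ := E3.exists_orthogonal_two 0 0
  obtain ⟨p, hp, hmax⟩ := (isCompact_sphere (0 : E3) 1).exists_isMaxOn ⟨r, by simpa using hr⟩
    hc.continuousOn
  refine ⟨p, by simpa using hp, fun v => ?_⟩
  rcases eq_or_ne v 0 with rfl | hv
  · have := hf.1 0 0; simp at this; simp [this]
  · have hn : ‖v‖ ≠ 0 := norm_ne_zero_iff.2 hv
    have h1 : f (‖v‖⁻¹ • v) ≤ f p := hmax (by simp [norm_smul, hn])
    rw [hf.1] at h1
    have h2 := mul_le_mul_of_nonneg_right h1 (sq_nonneg ‖v‖)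
    have h3 : ‖v‖⁻¹ ^ 2 * f v * ‖v‖ ^ 2 = f v := by field_simp
    rwa [h3] at h2

theorem E3.inner_mk_left (a b c : ℝ) (p : E3) :
    ⟪(!₂[a, b, c] : E3), p⟫_ℝ = a * p 0 + b * p 1 + c * p 2 := by
  conv_lhs => rw [E3.eta p, E3.inner_mk]

/-- A continuous weightless frame function vanishing wherever two coordinates agree up to sign is
nonpositive. -/
theorem IsFrameFn.nonpos_of_vanish {f : E3 → ℝ} (hf : IsFrameFn f 0) (hc : Continuous f)
    (h1 : ∀ x ε z, ε ^ 2 = 1 → f !₂[x, ε * x, z] = 0)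
    (h2 : ∀ x ε z, ε ^ 2 = 1 → f !₂[z, x, ε * x] = 0)
    (h3 : ∀ x ε z, ε ^ 2 = 1 → f !₂[x, z, ε * x] = 0) (v : E3) : f v ≤ 0 := by
  obtain ⟨p, hp, hmax⟩ := hf.exists_max hc
  set M := f p with hM
  suffices M ≤ 0 by
    exact (hmax v).trans (mul_nonpos_of_nonpos_of_nonneg this (sq_nonneg _))
  by_contra hM0
  push Not at hM0
  have hg := isFrameFn_normSq.lin hf M (-1)
  have key : ∀ s : E3, f s = 0 → ‖s‖ ^ 2 ≤ 3 * (‖s‖ ^ 2 - ⟪s, p⟫_ℝ ^ 2) := by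
    intro s hs
    have := hg.le_of_zero (by fun_prop) (fun v => by linarith [hmax v]) hp (by rw [hp]; ring) s
    rw [hs] at this
    nlinarith
  have hpn : p 0 ^ 2 + p 1 ^ 2 + p 2 ^ 2 = 1 := by rw [← E3.norm_sq_mk, ← E3.eta, hp, one_pow]
  have hsg : ∀ a b : ℝ, ∃ ε : ℝ, ε ^ 2 = 1 ∧ 0 ≤ ε * a * b := by
    intro a b
    rcases le_total 0 (a * b) with h | h
    · exact ⟨1, by norm_num, by linarith⟩
    · exact ⟨-1, by norm_num, by linarith⟩
  -- projecting `p` to a plane where two coordinates agree up to sign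
  have fin : ∀ a b c ε : ℝ, a ^ 2 + b ^ 2 + c ^ 2 = 1 → ε ^ 2 = 1 →
      0 ≤ ε * a * b → a ^ 2 + b ^ 2 - 2 * (ε * a * b) < 2 / 3 →
      ∀ N i : ℝ, N = 2 * ((a + ε * b) / 2) ^ 2 + c ^ 2 →
      i = (a + ε * b) / 2 * a + ε * ((a + ε * b) / 2) * b + c ^ 2 → ¬ N ≤ 3 * (N - i ^ 2) := by
    intro a b c ε hn he hab hlt N i hN hi h
    have e : i = N := by rw [hN, hi]; ring
    have eN : N = 1 - (a ^ 2 + b ^ 2) / 2 + ε * a * b := by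
      rw [hN]; linear_combination hn + b ^ 2 / 2 * he
    rw [e] at h
    nlinarith
  obtain ⟨ε1, he1, hab1⟩ := hsg (p 0) (p 1)
  have c1 : ¬ (p 0 ^ 2 + p 1 ^ 2 - 2 * (ε1 * p 0 * p 1) < 2 / 3) := by
    intro hlt
    have := key _ (h1 ((p 0 + ε1 * p 1) / 2) ε1 (p 2) he1)
    rw [E3.norm_sq_mk, E3.inner_mk_left] at this
    exact fin _ _ (p 2) _ (by linarith) he1 hab1 hlt _ _
      (by linear_combination ((p 0 + ε1 * p 1) / 2) ^ 2 * he1) (by ring) this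
  obtain ⟨ε2, he2, hab2⟩ := hsg (p 1) (p 2)
  have c2 : ¬ (p 1 ^ 2 + p 2 ^ 2 - 2 * (ε2 * p 1 * p 2) < 2 / 3) := by
    intro hlt
    have := key _ (h2 ((p 1 + ε2 * p 2) / 2) ε2 (p 0) he2)
    rw [E3.norm_sq_mk, E3.inner_mk_left] at this
    exact fin _ _ (p 0) _ (by linarith) he2 hab2 hlt _ _
      (by linear_combination ((p 1 + ε2 * p 2) / 2) ^ 2 * he2) (by ring) this
  obtain ⟨ε3, he3, hab3⟩ := hsg (p 0) (p 2)
  have c3 : ¬ (p 0 ^ 2 + p 2 ^ 2 - 2 * (ε3 * p 0 * p 2) < 2 / 3) := by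
    intro hlt
    have := key _ (h3 ((p 0 + ε3 * p 2) / 2) ε3 (p 1) he3)
    rw [E3.norm_sq_mk, E3.inner_mk_left] at this
    exact fin _ _ (p 1) _ (by linarith) he3 hab3 hlt _ _
      (by linear_combination ((p 0 + ε3 * p 2) / 2) ^ 2 * he3) (by ring) this
  push Not at c1 c2 c3
  have z1 : ε1 * p 0 * p 1 = 0 := by linarith
  have z2 : ε2 * p 1 * p 2 = 0 := by linarith
  have z3 : ε3 * p 0 * p 2 = 0 := by linarith
  rw [z1] at c1
  rw [z2] at c2
  rw [z3] at c3
  have e0 : p 0 ^ 2 = 1 / 3 := by linarith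
  have e1 : p 1 ^ 2 = 1 / 3 := by linarith
  have : (ε1 * p 0 * p 1) ^ 2 = 1 / 9 := by rw [mul_pow, mul_pow, he1, e0, e1]; norm_num
  rw [z1] at this
  norm_num at this

theorem IsFrameFn.eq_zero_of_turns {f : E3 → ℝ} (hf : IsFrameFn f 0) (hc : Continuous f)
    (h3 : ∀ x y z, f !₂[-y, x, z] = -f !₂[x, y, z])
    (h1 : ∀ x y z, f !₂[x, -z, y] = -f !₂[x, y, z]) (v : E3) : f v = 0 := by
  have neg : ∀ x y z, f !₂[-x, -y, -z] = f !₂[x, y, z] := by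
    intro x y z
    have := hf.1 (-1) !₂[x, y, z]
    rw [E3.smul_mk] at this
    simpa using this
  have s12 : ∀ x y z, f !₂[-x, -y, z] = f !₂[x, y, z] := fun x y z => by
    rw [h3, h3, neg_neg]
  have s23 : ∀ x y z, f !₂[x, -y, -z] = f !₂[x, y, z] := fun x y z => by
    rw [h1, h1, neg_neg]
  have s1 : ∀ x y z, f !₂[-x, y, z] = f !₂[x, y, z] := fun x y z => by
    rw [← s23, neg]
  have s3 : ∀ x y z, f !₂[x, y, -z] = f !₂[x, y, z] := fun x y z => by
    rw [← s12, neg]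
  have s2 : ∀ x y z, f !₂[x, -y, z] = f !₂[x, y, z] := fun x y z => by
    rw [← s1, s12]
  have hε : ∀ ε : ℝ, ε ^ 2 = 1 → ε = 1 ∨ ε = -1 := fun ε h => by
    have h' : (ε - 1) * (ε + 1) = 0 := by linear_combination h
    rcases mul_eq_zero.1 h' with h' | h'
    · left; linarith
    · right; linarith
  have v1 : ∀ x ε z, ε ^ 2 = 1 → f !₂[x, ε * x, z] = 0 := by
    intro x ε z h
    have := h3 x x z
    rw [s1] at this
    rcases hε ε h with rfl | rfl
    · rw [one_mul]; linarith
    · rw [neg_one_mul, s2]; linarith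
  have v2 : ∀ x ε z, ε ^ 2 = 1 → f !₂[z, x, ε * x] = 0 := by
    intro x ε z h
    have := h1 z x x
    rw [s2] at this
    rcases hε ε h with rfl | rfl
    · rw [one_mul]; linarith
    · rw [neg_one_mul, s3]; linarith
  have v3 : ∀ x ε z, ε ^ 2 = 1 → f !₂[x, z, ε * x] = 0 := by
    intro x ε z h
    have a := h3 x z (ε * x)
    rw [s1] at a
    have := v2 x ε z h
    rw [this] at a; linarith
  apply le_antisymm (hf.nonpos_of_vanish hc v1 v2 v3 v)
  have hn := hf.lin hf (-1) 0
  rw [mul_zero, mul_zero, add_zero] at hn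
  have := hn.nonpos_of_vanish (by fun_prop) (fun x ε z h => by rw [v1 x ε z h]; ring)
    (fun x ε z h => by rw [v2 x ε z h]; ring) (fun x ε z h => by rw [v3 x ε z h]; ring) v
  linarith

theorem isFrameFn_diag (a b c : ℝ) :
    IsFrameFn (fun v => a * (v 0) ^ 2 + b * (v 1) ^ 2 + c * (v 2) ^ 2) (a + b + c) := by
  obtain hh : ∀ p : E3, ‖p‖ = 1 → IsFrameFn (fun v => ⟪p, v⟫_ℝ ^ 2) 1 := by
    intro p hp
    refine ⟨fun c v => by simp only [inner_smul_right]; ring, fun u v w h1 h2 h3 h4 h5 => ?_⟩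
    rcases eq_or_ne u 0 with rfl | hu
    · have hv : v = 0 := by simpa using h4
      have hw : w = 0 := by simpa using h5
      simp [hv, hw]
    have hn : ‖u‖ ≠ 0 := norm_ne_zero_iff.2 hu
    let e : Fin 3 → E3 := ![‖u‖⁻¹ • u, ‖u‖⁻¹ • v, ‖u‖⁻¹ • w]
    have he : Orthonormal ℝ e := by
      constructor
      · intro i; fin_cases i <;> simp [e, norm_smul, h4, h5, hn]
      · intro i j hij
        fin_cases i <;> fin_cases j <;> simp at hij <;>
          simp [e, inner_smul_left, inner_smul_right, h1, h2, h3, real_inner_comm u v,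
            real_inner_comm u w, real_inner_comm v w]
    let b : OrthonormalBasis (Fin 3) ℝ E3 := OrthonormalBasis.mk he (by
      have := he.linearIndependent.span_eq_top_of_card_eq_finrank' (by simp)
      rw [this])
    have := b.sum_sq_inner_left p
    simp [Fin.sum_univ_three, b, e, inner_smul_left, inner_smul_right, hp] at this
    field_simp at this
    simpa using this
  have n1 : ‖(!₂[1, 0, 0] : E3)‖ = 1 := by
    rw [← sq_eq_sq₀ (norm_nonneg _) zero_le_one, E3.norm_sq_mk]; norm_num
  have n2 : ‖(!₂[0, 1, 0] : E3)‖ = 1 := by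
    rw [← sq_eq_sq₀ (norm_nonneg _) zero_le_one, E3.norm_sq_mk]; norm_num
  have n3 : ‖(!₂[0, 0, 1] : E3)‖ = 1 := by
    rw [← sq_eq_sq₀ (norm_nonneg _) zero_le_one, E3.norm_sq_mk]; norm_num
  have := ((hh _ n1).lin (hh _ n2) a b).lin (hh _ n3) 1 c
  simp only [E3.inner_mk_left] at this
  simpa using this

/-- **Gleason's theorem** on three-space: a bounded frame function is a quadratic form. -/
theorem IsFrameFn.parallelogram {f : E3 → ℝ} {W C : ℝ} (hf : IsFrameFn f W)
    (hC : ∀ v, |f v| ≤ C * ‖v‖ ^ 2) (u v : E3) : f (u + v) + f (u - v) = 2 * f u + 2 * f v := by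
  have hc := hf.continuous hC
  obtain ⟨p, hp, hmax⟩ := hf.exists_max hc
  have hnc : Continuous fun v => -1 * f v + 0 * f v := by fun_prop
  obtain ⟨r₀, hr₀, hmin⟩ := (hf.lin hf (-1) 0).exists_max hnc
  set M := f p with hM
  set m := f r₀ with hm
  have hmin : ∀ v, m * ‖v‖ ^ 2 ≤ f v := fun v => by
    have := hmin v
    nlinarith
  obtain ⟨r, hr, hpr, hfr⟩ : ∃ r : E3, ‖r‖ = 1 ∧ ⟪p, r⟫_ℝ = 0 ∧ f r = m := by
    set w := r₀ - ⟪p, r₀⟫_ℝ • p with hw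
    have hpw : ⟪p, w⟫_ℝ = 0 := by
      rw [hw, inner_sub_right, inner_smul_right, real_inner_self_eq_norm_sq, hp]; ring
    obtain ⟨r, hr, hpr, c, s, hrs⟩ : ∃ r : E3, ‖r‖ = 1 ∧ ⟪p, r⟫_ℝ = 0 ∧
        ∃ c s : ℝ, r₀ = c • p + s • r := by
      rcases eq_or_ne w 0 with h0 | h0
      · obtain ⟨r, hr, hr', -⟩ := E3.exists_orthogonal_two p 0
        refine ⟨r, hr, hr', ⟪p, r₀⟫_ℝ, 0, ?_⟩
        rw [zero_smul, add_zero, ← sub_eq_zero]; exact h0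
      · have hn : ‖w‖ ≠ 0 := norm_ne_zero_iff.2 h0
        refine ⟨‖w‖⁻¹ • w, by rw [norm_smul, norm_inv, norm_norm, inv_mul_cancel₀ hn],
          by rw [inner_smul_right, hpw, mul_zero], ⟪p, r₀⟫_ℝ, ‖w‖, ?_⟩
        rw [smul_smul, mul_inv_cancel₀ hn, one_smul, hw]; abel
    refine ⟨r, hr, hpr, ?_⟩
    have hcs : c ^ 2 + s ^ 2 = 1 := by
      have : ‖r₀‖ ^ 2 = 1 := by rw [hr₀, one_pow]
      rw [hrs, norm_add_sq_real, inner_smul_left, inner_smul_right, hpr, norm_smul, norm_smul,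
        mul_pow, mul_pow, Real.norm_eq_abs, Real.norm_eq_abs, sq_abs, sq_abs, hp, hr] at this
      simpa using this
    have mr := hmin r
    rw [hr] at mr
    have hsum : f p + f r = f r₀ + f (c • r - s • p) := by
      obtain ⟨q, hq, h1, h2⟩ := E3.exists_orthogonal_two p r
      have A := hf.2 p r q hpr h1 h2 (by rw [hr, hp]) (by rw [hq, hp])
      have hn2 : ‖c • r - s • p‖ = 1 := by
        rw [← sq_eq_sq₀ (norm_nonneg _) zero_le_one, norm_sub_sq_real, inner_smul_left,
          inner_smul_right, real_inner_comm, hpr, norm_smul, norm_smul,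
        mul_pow, mul_pow, Real.norm_eq_abs, Real.norm_eq_abs, sq_abs, sq_abs, hp, hr]
        simpa using hcs
      have B := hf.2 r₀ (c • r - s • p) q (by
          rw [hrs]
          simp only [inner_add_left, inner_sub_right, inner_smul_left, inner_smul_right, hpr,
            real_inner_comm p r, real_inner_self_eq_norm_sq, hp, hr]
          simp; ring)
        (by rw [hrs, inner_add_left, inner_smul_left, inner_smul_left, h1, h2]; simp)
        (by rw [inner_sub_left, inner_smul_left, inner_smul_left, h1, h2]; simp)
        (by rw [hn2, hr₀]) (by rw [hq, hr₀])
      rw [hp] at A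
      rw [hr₀] at B
      linarith
    have hle := hmax (c • r - s • p)
    have hn2 : ‖c • r - s • p‖ ^ 2 = 1 := by
      rw [norm_sub_sq_real, inner_smul_left,
          inner_smul_right, real_inner_comm, hpr, norm_smul, norm_smul,
        mul_pow, mul_pow, Real.norm_eq_abs, Real.norm_eq_abs, sq_abs, sq_abs, hp, hr]
      simpa using hcs
    rw [hn2] at hle
    linarith
  obtain ⟨U, hU3, hU1⟩ := E3.exists_isometry hp hr hpr
  have hg := hf.comp U
  have hgc : Continuous fun v => f (U v) := by fun_prop
  set g : E3 → ℝ := fun v => f (U v) with hgdef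
  set k := g !₂[0, 1, 0] with hk
  have g3 : g !₂[0, 0, 1] = M := by simp only [hgdef, hU3, hM]
  have g1 : g !₂[1, 0, 0] = m := by simp only [hgdef, hU1, hfr]
  have hW : m + k + M = W := by
    have := hg.coord.2 1 0 0 0 1 0 0 0 1 1 (by ring) (by ring) (by ring) (by ring) (by ring)
      (by ring)
    simp only at this
    rw [g3, g1, ← hk] at this
    linarith
  have gmax : ∀ v, g v ≤ M * ‖v‖ ^ 2 := fun v => by
    have := hmax (U v); rwa [U.norm_map] at this
  have gmin : ∀ v, m * ‖v‖ ^ 2 ≤ g v := fun v => by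
    have := hmin (U v); rwa [U.norm_map] at this
  have hd := isFrameFn_diag m k M
  have hh := hg.lin hd 1 (-1)
  have hw0 : 1 * W + -1 * (m + k + M) = 0 := by linarith
  rw [hw0] at hh
  have t3 := (isFrameFn_normSq.lin hg M (-1)).zonal (by fun_prop) (fun v => by linarith [gmax v])
    (by rw [g3, E3.norm_sq_mk]; ring)
  -- the same for the minimum, after exchanging the first and third axes
  have t1 : ∀ x y z, (g !₂[x, y, z] - m * (x ^ 2 + y ^ 2 + z ^ 2)) +
      (g !₂[x, -z, y] - m * (x ^ 2 + y ^ 2 + z ^ 2)) = (W - 3 * m) * (y ^ 2 + z ^ 2) := by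
    have hc' : IsCoordFrame (fun x y z => g !₂[z, x, y]) W := by
      refine ⟨fun c x y z => hg.coord.1 c z x y, fun a b c x y z u v w N h1 h2 h3 h4 h5 h6 => ?_⟩
      exact hg.coord.2 c a b z x y w u v N (by linarith) (by linarith) (by linarith) (by linarith)
        (by linarith) (by linarith)
    have hc2 := (hc'.isFrameFn.lin isFrameFn_normSq 1 (-m)).zonal (by
        apply Continuous.add _ (by fun_prop)
        apply continuous_const.mul
        apply hgc.comp
        fun_prop)
      (fun v => by
        have := gmin !₂[v 2, v 0, v 1]
        have e : ‖(!₂[v 2, v 0, v 1] : E3)‖ ^ 2 = ‖v‖ ^ 2 := by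
          conv_rhs => rw [E3.eta v]
          rw [E3.norm_sq_mk, E3.norm_sq_mk]; ring
        rw [e] at this
        linarith)
      (by
        rw [E3.norm_sq_mk]
        have : g !₂[(!₂[0, 0, 1] : E3) 2, (!₂[0, 0, 1] : E3) 0, (!₂[0, 0, 1] : E3) 1] = m := g1
        rw [this]; ring)
    intro x y z
    have := hc2 y z x
    simp only [E3.norm_sq_mk] at this
    simp at this
    linarith
  have hz := hh.eq_zero_of_turns (by fun_prop)
    (fun x y z => by
      have := t3 x y z
      simp only [E3.norm_sq_mk] at this
      rw [← hW] at this
      simp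
      linear_combination (-1 : ℝ) * this)
    (fun x y z => by
      have := t1 x y z
      rw [← hW] at this
      simp
      linear_combination this)
  have gq : ∀ v : E3, g v = m * (v 0) ^ 2 + k * (v 1) ^ 2 + M * (v 2) ^ 2 := fun v => by
    linarith [hz v]
  have fq : ∀ v, f v = g (U.symm v) := fun v => by simp [hgdef]
  rw [fq, fq, fq, fq, gq, gq, gq, gq]
  simp
  ring

theorem IsFrameFn.polar_linear {f : E3 → ℝ} {W C : ℝ} (hf : IsFrameFn f W)
    (hC : ∀ v, |f v| ≤ C * ‖v‖ ^ 2) (u v w : E3) (c s : ℝ) :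
    f (u + (c • v + s • w)) - f (u - (c • v + s • w)) =
      c * (f (u + v) - f (u - v)) + s * (f (u + w) - f (u - w)) := by
  have hp := hf.parallelogram hC
  have hc := hf.continuous hC
  have h0 : f 0 = 0 := by simpa using hf.1 0 0
  have hneg : ∀ x, f (-x) = f x := fun x => by simpa using hf.1 (-1) x
  let b : E3 →+ ℝ :=
    { toFun := fun v => f (u + v) - f (u - v)
      map_zero' := by simp
      map_add' := fun x y => by
        have e1 := hp (u + x) y
        have e2 := hp (u - x) y
        have e3 := hp (u + y) x
        have e4 := hp (u - y) x
        have r1 : u + x + y = u + (x + y) := by abel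
        have r2 : u - x - y = u - (x + y) := by abel
        have r3 : u + y + x = u + (x + y) := by abel
        have r4 : u - y - x = u - (x + y) := by abel
        have r5 : u - x + y = u + y - x := by abel
        have r6 : u - y + x = u + x - y := by abel
        rw [r1] at e1
        rw [r2, r5] at e2
        rw [r3] at e3
        rw [r4, r6] at e4
        linarith }
  have hb : Continuous b := by
    change Continuous fun v => f (u + v) - f (u - v)
    fun_prop
  have := (b.toRealLinearMap hb).map_add (c • v) (s • w)
  rw [map_smul, map_smul] at this
  exact this

section Frame

variable {A : Type*} [CStarAlgebra A]

/-- A bounded finitely additive function on the projections of a C*-algebra. -/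
structure IsProjMeasure (m : A → ℝ) (M : ℝ) : Prop where
  add : ∀ p q, IsStarProjection p → IsStarProjection q → p * q = 0 → m (p + q) = m p + m q
  bdd : ∀ p, IsStarProjection p → |m p| ≤ M

theorem IsProjMeasure.zero {m : A → ℝ} {M : ℝ} (hm : IsProjMeasure m M) : m 0 = 0 := by
  have := hm.add 0 0 (.zero A) (.zero A) (by simp)
  simpa using this

/-- The combination of three operators with coefficients in three-space. -/
noncomputable def frameComb (a : Fin 3 → A) (v : E3) : A := v 0 • a 0 + v 1 • a 1 + v 2 • a 2

/-- The function on three-space obtained by measuring the range projection of `frameComb a v`. -/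
noncomputable def frameVal (m : A → ℝ) (a : Fin 3 → A) (v : E3) : ℝ :=
  ‖v‖ ^ 2 * m ((‖v‖ ^ 2)⁻¹ • (frameComb a v * star (frameComb a v)))

theorem star_frameComb_mul {a : Fin 3 → A} {P : A}
    (ha : ∀ i j, star (a i) * a j = if i = j then P else 0) (u v : E3) :
    star (frameComb a u) * frameComb a v = ⟪u, v⟫_ℝ • P := by
  simp only [frameComb, star_add, star_smul, star_trivial, mul_add, add_mul,
    smul_mul_smul_comm, ha]
  simp [PiLp.inner_apply, Fin.sum_univ_three]
  module

theorem isStarProjection_frameComb {a : Fin 3 → A} {P : A}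
    (ha : ∀ i j, star (a i) * a j = if i = j then P else 0) (haP : ∀ i, a i * P = a i) (v : E3) :
    IsStarProjection ((‖v‖ ^ 2)⁻¹ • (frameComb a v * star (frameComb a v))) := by
  have hP : frameComb a v * P = frameComb a v := by
    simp [frameComb, add_mul, haP]
  constructor
  · change _ * _ = _
    rw [smul_mul_smul_comm, mul_assoc, ← mul_assoc (star _), star_frameComb_mul ha,
      real_inner_self_eq_norm_sq, smul_mul_assoc, mul_smul_comm, ← mul_assoc, hP, smul_smul]
    congr 1
    by_cases h : ‖v‖ = 0
    · simp [h]
    · field_simp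
  · simp [IsSelfAdjoint]

theorem frameComb_smul (a : Fin 3 → A) (c : ℝ) (v : E3) :
    frameComb a (c • v) = c • frameComb a v := by
  simp [frameComb, smul_smul]

theorem frameComb_sum (a : Fin 3 → A) {u v w : E3} (h1 : ⟪u, v⟫_ℝ = 0) (h2 : ⟪u, w⟫_ℝ = 0)
    (h3 : ⟪v, w⟫_ℝ = 0) (h4 : ‖v‖ = ‖u‖) (h5 : ‖w‖ = ‖u‖) :
    frameComb a u * star (frameComb a u) + frameComb a v * star (frameComb a v) +
      frameComb a w * star (frameComb a w) =
    ‖u‖ ^ 2 • (a 0 * star (a 0) + a 1 * star (a 1) + a 2 * star (a 2)) := by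
  by_cases hu : ‖u‖ = 0
  · have hu' := norm_eq_zero.1 hu
    have hv' := norm_eq_zero.1 (h4.trans hu)
    have hw' := norm_eq_zero.1 (h5.trans hu)
    subst hu' hv' hw'
    simp [frameComb]
  set N := ‖u‖ ^ 2 with hN
  have hN0 : N ≠ 0 := pow_ne_zero 2 hu
  have k1 : ⟪u, u⟫_ℝ = N := real_inner_self_eq_norm_sq u
  have k2 : ⟪v, v⟫_ℝ = N := by rw [real_inner_self_eq_norm_sq, h4]
  have k3 : ⟪w, w⟫_ℝ = N := by rw [real_inner_self_eq_norm_sq, h5]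
  simp only [PiLp.inner_apply, Fin.sum_univ_three, RCLike.inner_apply, conj_trivial] at h1 h2 h3 k1 k2 k3
  let X : Matrix (Fin 3) (Fin 3) ℝ := Matrix.of fun i j => (![u, v, w] : Fin 3 → E3) i j
  have hX0 : X * X.transpose = N • 1 := by
    ext i j
    rw [Matrix.mul_apply, Fin.sum_univ_three]
    simp only [Matrix.transpose_apply, X, Matrix.of_apply]
    fin_cases i <;> fin_cases j <;> simp <;> linarith
  have hX : X * (N⁻¹ • X.transpose) = 1 := by
    rw [Matrix.mul_smul, hX0, smul_smul, inv_mul_cancel₀ hN0, one_smul]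
  have hX' := mul_eq_one_comm.1 hX
  have key : ∀ i j, u i * u j + v i * v j + w i * w j = if i = j then N else 0 := by
    intro i j
    have hX1 : X.transpose * X = N • 1 := by
      rw [← hX', Matrix.smul_mul, smul_smul, mul_inv_cancel₀ hN0, one_smul]
    have := congrFun (congrFun hX1 i) j
    rw [Matrix.mul_apply, Fin.sum_univ_three] at this
    simp only [Matrix.transpose_apply, X, Matrix.of_apply] at this
    simpa [Matrix.one_apply] using this
  have k00 := key 0 0
  have k01 := key 0 1
  have k02 := key 0 2
  have k11 := key 1 1
  have k12 := key 1 2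
  have k22 := key 2 2
  simp at k00 k01 k02 k11 k12 k22
  simp only [frameComb, star_add, star_smul, star_trivial, mul_add, add_mul, smul_mul_smul_comm]
  linear_combination (norm := module) k00 • (a 0 * star (a 0)) + k11 • (a 1 * star (a 1)) +
    k22 • (a 2 * star (a 2)) + k01 • (a 0 * star (a 1)) + k01 • (a 1 * star (a 0)) +
    k02 • (a 0 * star (a 2)) + k02 • (a 2 * star (a 0)) +
    k12 • (a 1 * star (a 2)) + k12 • (a 2 * star (a 1))

theorem IsProjMeasure.abs_frameVal_le {m : A → ℝ} {M : ℝ} (hm : IsProjMeasure m M)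
    {a : Fin 3 → A} {P : A}
    (ha : ∀ i j, star (a i) * a j = if i = j then P else 0) (haP : ∀ i, a i * P = a i) (v : E3) :
    |frameVal m a v| ≤ M * ‖v‖ ^ 2 := by
  rw [frameVal, abs_mul, abs_of_nonneg (sq_nonneg _), mul_comm]
  exact mul_le_mul_of_nonneg_right (hm.bdd _ (isStarProjection_frameComb ha haP v)) (sq_nonneg _)

theorem IsProjMeasure.isFrameFn {m : A → ℝ} {M : ℝ} (hm : IsProjMeasure m M)
    {a : Fin 3 → A} {P : A}
    (ha : ∀ i j, star (a i) * a j = if i = j then P else 0) (haP : ∀ i, a i * P = a i) :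
    IsFrameFn (frameVal m a)
      (m (a 0 * star (a 0) + a 1 * star (a 1) + a 2 * star (a 2))) := by
  refine ⟨fun c v => ?_, fun u v w h1 h2 h3 h4 h5 => ?_⟩
  · by_cases hc : c = 0
    · simp [hc, frameVal]
    rw [frameVal, frameVal, frameComb_smul, norm_smul, mul_pow, Real.norm_eq_abs, sq_abs, star_smul,
      star_trivial, smul_mul_smul_comm, smul_smul]
    have : (c ^ 2 * ‖v‖ ^ 2)⁻¹ * (c * c) = (‖v‖ ^ 2)⁻¹ := by
      by_cases h : ‖v‖ = 0
      · simp [h]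
      · field_simp
    rw [this]; ring
  · by_cases hu : ‖u‖ = 0
    · simp [frameVal, h4, h5, hu]
    have hs := frameComb_sum a h1 h2 h3 h4 h5
    have hmul : ∀ x y : E3, ⟪x, y⟫_ℝ = 0 →
        ((‖x‖ ^ 2)⁻¹ • (frameComb a x * star (frameComb a x))) *
          ((‖y‖ ^ 2)⁻¹ • (frameComb a y * star (frameComb a y))) = 0 := by
      intro x y hxy
      rw [smul_mul_smul_comm, mul_assoc, ← mul_assoc (star _), star_frameComb_mul ha, hxy]
      simp
    have pu := isStarProjection_frameComb ha haP u
    have pv := isStarProjection_frameComb ha haP v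
    have pw := isStarProjection_frameComb ha haP w
    have e1 := hm.add _ _ pu pv (hmul _ _ h1)
    have e2 := hm.add _ _ (pu.add pv (hmul _ _ h1)) pw (by rw [add_mul, hmul _ _ h2, hmul _ _ h3, add_zero])
    simp only [frameVal]
    rw [h4, h5] at *
    rw [← smul_add, ← smul_add, hs, smul_smul, inv_mul_cancel₀ (pow_ne_zero 2 hu), one_smul,
      smul_add, e1] at e2
    rw [e2]; ring

end Frame

section Polar

variable {A : Type*} [CStarAlgebra A]

/-- Isometries with pairwise orthogonal ranges. -/
def OrthIsos {ι : Type*} [DecidableEq ι] (v : ι → A) : Prop :=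
  ∀ i j, star (v i) * v j = if i = j then 1 else 0

theorem OrthIsos.mul_left {ι : Type*} [DecidableEq ι] {v : ι → A} (hv : OrthIsos v) (i j : ι)
    (x : A) : star (v i) * (v j * x) = if i = j then x else 0 := by
  rw [← mul_assoc, hv]; split_ifs <;> simp

theorem OrthIsos.comp {ι κ : Type*} [DecidableEq ι] [DecidableEq κ] {v : ι → A} (hv : OrthIsos v)
    {e : κ → ι} (he : Function.Injective e) : OrthIsos (v ∘ e) := fun i j => by
  simp [hv _ _, he.eq_iff]

theorem isStarProjection_half {X : A} (h : star X * X = (2 : ℝ) • 1) :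
    IsStarProjection ((1 / 2 : ℝ) • (X * star X)) := by
  constructor
  · change _ * _ = _
    rw [smul_mul_smul_comm, mul_assoc, ← mul_assoc (star X), h]
    simp [smul_smul]
  · simp [IsSelfAdjoint]

/-- The polarization of the measure of the range of an isometry. -/
noncomputable def polarVal (m : A → ℝ) (Y W : A) : ℝ :=
  m ((1 / 2 : ℝ) • ((Y + W) * star (Y + W))) - m ((1 / 2 : ℝ) • ((Y - W) * star (Y - W)))

theorem polarVal_neg (m : A → ℝ) (Y W : A) : polarVal m Y (-W) = -polarVal m Y W := by
  simp [polarVal, sub_eq_add_neg]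

theorem IsProjMeasure.abs_polarVal_le {m : A → ℝ} {M : ℝ} (hm : IsProjMeasure m M) {Y W : A}
    (hY : star Y * Y = 1) (hW : star W * W = 1) (hYW : star Y * W = 0) :
    |polarVal m Y W| ≤ 2 * M := by
  have hWY : star W * Y = 0 := by simpa using congrArg star hYW
  have h1 := hm.bdd _ (isStarProjection_half (X := Y + W) (by
    simp [mul_add, add_mul, hY, hW, hYW, hWY, two_smul]))
  have h2 := hm.bdd _ (isStarProjection_half (X := Y - W) (by
    simp [mul_sub, sub_mul, hY, hW, hYW, hWY, two_smul]))
  rw [abs_le] at h1 h2 ⊢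
  unfold polarVal
  constructor <;> linarith

theorem IsProjMeasure.polarVal_linear {m : A → ℝ} {M : ℝ} (hm : IsProjMeasure m M) {a : Fin 3 → A}
    (ha : OrthIsos a) {c s : ℝ} (hcs : c ^ 2 + s ^ 2 = 1) :
    polarVal m (a 0) (c • a 1 + s • a 2) =
      c * polarVal m (a 0) (a 1) + s * polarVal m (a 0) (a 2) := by
  have hl := (hm.isFrameFn ha (fun i => mul_one _)).polar_linear
    (hm.abs_frameVal_le ha (fun i => mul_one _)) !₂[1, 0, 0] !₂[0, 1, 0] !₂[0, 0, 1] c s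
  have hv : ∀ x y z : ℝ, x ^ 2 + y ^ 2 + z ^ 2 = 2 → frameVal m a !₂[x, y, z] =
      2 * m ((1 / 2 : ℝ) • ((x • a 0 + y • a 1 + z • a 2) *
        star (x • a 0 + y • a 1 + z • a 2))) := by
    intro x y z h
    rw [frameVal, E3.norm_sq_mk, h]
    simp [frameComb]
  have e1 : (!₂[1, 0, 0] + (c • !₂[0, 1, 0] + s • !₂[0, 0, 1]) : E3) = !₂[1, c, s] := by
    ext i; fin_cases i <;> simp
  have e2 : (!₂[1, 0, 0] - (c • !₂[0, 1, 0] + s • !₂[0, 0, 1]) : E3) = !₂[1, -c, -s] := by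
    ext i; fin_cases i <;> simp
  have e3 : (!₂[1, 0, 0] + !₂[0, 1, 0] : E3) = !₂[1, 1, 0] := by
    ext i; fin_cases i <;> simp
  have e4 : (!₂[1, 0, 0] - !₂[0, 1, 0] : E3) = !₂[1, -1, 0] := by
    ext i; fin_cases i <;> simp
  have e5 : (!₂[1, 0, 0] + !₂[0, 0, 1] : E3) = !₂[1, 0, 1] := by
    ext i; fin_cases i <;> simp
  have e6 : (!₂[1, 0, 0] - !₂[0, 0, 1] : E3) = !₂[1, 0, -1] := by
    ext i; fin_cases i <;> simp
  rw [e1, e2, e3, e4, e5, e6, hv _ _ _ (by linarith), hv _ _ _ (by linarith),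
    hv _ _ _ (by norm_num), hv _ _ _ (by norm_num), hv _ _ _ (by norm_num),
    hv _ _ _ (by norm_num)] at hl
  have g1 : (1 : ℝ) • a 0 + (-c) • a 1 + (-s) • a 2 = a 0 - (c • a 1 + s • a 2) := by module
  have g2 : (1 : ℝ) • a 0 + c • a 1 + s • a 2 = a 0 + (c • a 1 + s • a 2) := by module
  have g3 : (1 : ℝ) • a 0 + (1 : ℝ) • a 1 + (0 : ℝ) • a 2 = a 0 + a 1 := by module
  have g4 : (1 : ℝ) • a 0 + (-1 : ℝ) • a 1 + (0 : ℝ) • a 2 = a 0 - a 1 := by module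
  have g5 : (1 : ℝ) • a 0 + (0 : ℝ) • a 1 + (1 : ℝ) • a 2 = a 0 + a 2 := by module
  have g6 : (1 : ℝ) • a 0 + (0 : ℝ) • a 1 + (-1 : ℝ) • a 2 = a 0 - a 2 := by module
  rw [g1, g2, g3, g4, g5, g6] at hl
  unfold polarVal
  linarith

theorem inv_sqrt_two_mul_self : (√2)⁻¹ * (√2)⁻¹ = (1 / 2 : ℝ) := by
  rw [← mul_inv, Real.mul_self_sqrt (by norm_num)]; norm_num

theorem orthIsos_three {Y V W : A} (h1 : star Y * Y = 1) (h2 : star V * V = 1)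
    (h3 : star W * W = 1) (h4 : star Y * V = 0) (h5 : star Y * W = 0) (h6 : star V * W = 0) :
    OrthIsos ![Y, V, W] := by
  have h4' : star V * Y = 0 := by simpa using congrArg star h4
  have h5' : star W * Y = 0 := by simpa using congrArg star h5
  have h6' : star W * V = 0 := by simpa using congrArg star h6
  intro i j
  fin_cases i <;> fin_cases j <;> simp [*]

theorem IsProjMeasure.polarVal_add {m : A → ℝ} {M : ℝ} (hm : IsProjMeasure m M) {Y V W : A}
    (h1 : star Y * Y = 1) (h2 : star V * V = 1)
    (h3 : star W * W = 1) (h4 : star Y * V = 0) (h5 : star Y * W = 0) (h6 : star V * W = 0) :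
    polarVal m Y ((√2)⁻¹ • (V + W)) = (√2)⁻¹ * (polarVal m Y V + polarVal m Y W) := by
  have := hm.polarVal_linear (orthIsos_three h1 h2 h3 h4 h5 h6) (c := (√2)⁻¹) (s := (√2)⁻¹) (by
    rw [pow_two, inv_sqrt_two_mul_self]; norm_num)
  simp only [Matrix.cons_val] at this
  rw [smul_add, this]; ring

/-- The part of `polarVal` at `f w + h D` that does not depend on the sign of `h`. -/
noncomputable def avgVal (m : A → ℝ) (Y f h w D : A) : ℝ :=
  polarVal m Y (f * w + h * D) + polarVal m Y (f * w - h * D)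

theorem polarVal_neg_add (m : A → ℝ) (Y f h w D : A) :
    polarVal m Y (-(f * w) + h * D) = -polarVal m Y (f * w - h * D) := by
  rw [← polarVal_neg]; congr 1; abel

theorem IsProjMeasure.avgVal_indep {m : A → ℝ} {M : ℝ} (hm : IsProjMeasure m M) {v : Fin 5 → A}
    (hv : OrthIsos v) {w D : A} (hD : star D = D) (hwD : star w * w + D * D = 1) :
    avgVal m (v 0) (v 1) (v 3) w D = avgVal m (v 0) (v 1) (v 4) w D := by
  have hv' := hv.mul_left
  have hc : (√2 : ℝ)⁻¹ ≠ 0 := by positivity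
  have swap : ∀ ε : ℝ, ε * ε = 1 →
      polarVal m (v 0) (ε • (v 1 * w) + v 3 * D) + polarVal m (v 0) (v 2 * w + v 4 * D) =
      polarVal m (v 0) (ε • (v 1 * w) + v 4 * D) + polarVal m (v 0) (v 2 * w + v 3 * D) := by
    intro ε hε
    have e1 := hm.polarVal_add (Y := v 0) (V := ε • (v 1 * w) + v 3 * D) (W := v 2 * w + v 4 * D)
      (by simp [hv _ _]) (by simp [mul_add, add_mul, mul_assoc, hv', hD, smul_smul, hε, hwD])
      (by simp [mul_add, add_mul, mul_assoc, hv', hD, hwD]) (by simp [mul_add, hv'])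
      (by simp [mul_add, hv']) (by simp [mul_add, add_mul, mul_assoc, hv'])
    have e2 := hm.polarVal_add (Y := v 0) (V := ε • (v 1 * w) + v 4 * D) (W := v 2 * w + v 3 * D)
      (by simp [hv _ _]) (by simp [mul_add, add_mul, mul_assoc, hv', hD, smul_smul, hε, hwD])
      (by simp [mul_add, add_mul, mul_assoc, hv', hD, hwD]) (by simp [mul_add, hv'])
      (by simp [mul_add, hv']) (by simp [mul_add, add_mul, mul_assoc, hv'])
    have e3 : ε • (v 1 * w) + v 3 * D + (v 2 * w + v 4 * D) =
        ε • (v 1 * w) + v 4 * D + (v 2 * w + v 3 * D) := by abel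
    rw [e3, e2] at e1
    exact (mul_left_cancel₀ hc e1).symm
  have s1 := swap 1 (by norm_num)
  have s2 := swap (-1) (by norm_num)
  simp only [one_smul, neg_smul, polarVal_neg_add] at s1 s2
  unfold avgVal
  linarith

theorem IsProjMeasure.avgVal_add_left {m : A → ℝ} {M : ℝ} (hm : IsProjMeasure m M) {v : Fin 6 → A}
    (hv : OrthIsos v) {w D : A} (hD : star D = D) (hwD : star w * w + D * D = 1) :
    avgVal m (v 0) ((√2)⁻¹ • (v 1 + v 2)) (v 5) w D =
      (√2)⁻¹ * (avgVal m (v 0) (v 1) (v 5) w D + avgVal m (v 0) (v 2) (v 5) w D) := by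
  have hv' := hv.mul_left
  have hc2 := inv_sqrt_two_mul_self
  have i1 := hm.avgVal_indep (hv.comp (e := ![0, 1, 2, 5, 3]) (by decide)) hD hwD
  have i2 := hm.avgVal_indep (hv.comp (e := ![0, 2, 1, 5, 4]) (by decide)) hD hwD
  have i3 := hm.avgVal_indep (v := ![v 0, (√2)⁻¹ • (v 1 + v 2), (√2)⁻¹ • (v 1 - v 2), v 5,
      (√2)⁻¹ • (v 3 + v 4)]) (by
    have h12 : (2⁻¹ : ℝ) • (1 : A) + (2⁻¹ : ℝ) • (1 : A) = 1 := by module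
    intro i j
    fin_cases i <;> fin_cases j <;>
      simp [hv _ _, mul_add, add_mul, mul_sub, sub_mul, smul_smul, hc2, -mul_inv_rev] <;> exact h12)
      hD hwD
  simp only [Function.comp_apply, Matrix.cons_val] at i1 i2 i3
  rw [i1, i2, i3]
  have e1 := hm.polarVal_add (Y := v 0) (V := v 1 * w + v 3 * D) (W := v 2 * w + v 4 * D)
      (by simp [hv _ _]) (by simp [mul_add, add_mul, mul_assoc, hv', hD, hwD])
      (by simp [mul_add, add_mul, mul_assoc, hv', hD, hwD]) (by simp [mul_add, hv'])
      (by simp [mul_add, hv']) (by simp [mul_add, add_mul, mul_assoc, hv'])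
  have e2 := hm.polarVal_add (Y := v 0) (V := v 1 * w - v 3 * D) (W := v 2 * w - v 4 * D)
      (by simp [hv _ _]) (by simp [mul_sub, sub_mul, mul_assoc, hv', hD, hwD])
      (by simp [mul_sub, sub_mul, mul_assoc, hv', hD, hwD]) (by simp [mul_sub, hv'])
      (by simp [mul_sub, hv']) (by simp [mul_sub, sub_mul, mul_assoc, hv'])
  have r1 : (√2)⁻¹ • (v 1 + v 2) * w + (√2)⁻¹ • (v 3 + v 4) * D =
      (√2)⁻¹ • (v 1 * w + v 3 * D + (v 2 * w + v 4 * D)) := by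
    simp only [smul_mul_assoc, add_mul]; module
  have r2 : (√2)⁻¹ • (v 1 + v 2) * w - (√2)⁻¹ • (v 3 + v 4) * D =
      (√2)⁻¹ • (v 1 * w - v 3 * D + (v 2 * w - v 4 * D)) := by
    simp only [smul_mul_assoc, add_mul]; module
  unfold avgVal
  rw [r1, r2, e1, e2]
  ring

end Polar

theorem exists_clm_of_midpoint_affine {E : Type*} [NormedAddCommGroup E] [NormedSpace ℝ E]
    {Λ : E → ℝ} {C : ℝ} (h0 : Λ 0 = 0)
    (hmid : ∀ x y : E, ‖x‖ < 1 → ‖y‖ < 1 → Λ x + Λ y = 2 * Λ ((1 / 2 : ℝ) • (x + y)))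
    (hC : ∀ x : E, ‖x‖ < 1 → |Λ x| ≤ C) :
    ∃ L : E →L[ℝ] ℝ, (∀ x, ‖x‖ < 1 → L x = Λ x) ∧ ∀ x, |L x| ≤ 2 * C * ‖x‖ := by
  have hhalf : ∀ x : E, ‖x‖ < 1 → Λ ((1 / 2 : ℝ) • x) = Λ x / 2 := fun x hx => by
    have := hmid x 0 hx (by simp)
    rw [h0, add_zero, add_zero] at this
    linarith
  let a : ℕ → E → ℝ := fun n x => 2 ^ n * Λ ((1 / 2 : ℝ) ^ n • x)
  have hsmall : ∀ (n : ℕ) (x : E), ‖x‖ < 2 ^ n → ‖(1 / 2 : ℝ) ^ n • x‖ < 1 := fun n x hx => by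
    rw [norm_smul, norm_pow, one_div, norm_inv, Real.norm_ofNat, inv_pow, inv_mul_lt_iff₀ (by positivity)]
    simpa using hx
  have hstep : ∀ (n k : ℕ) (x : E), ‖x‖ < 2 ^ n → a (n + k) x = a n x := by
    intro n k x hx
    induction k with
    | zero => rfl
    | succ k ih =>
      rw [← ih]
      have hx' : ‖x‖ < 2 ^ (n + k) := hx.trans_le (pow_le_pow_right₀ (by norm_num) (by omega))
      change 2 ^ (n + k + 1) * Λ ((1 / 2 : ℝ) ^ (n + k + 1) • x) =
        2 ^ (n + k) * Λ ((1 / 2 : ℝ) ^ (n + k) • x)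
      rw [pow_succ' (1 / 2 : ℝ), mul_smul, hhalf _ (hsmall _ _ hx')]
      ring
  have hN : ∀ x : E, ∃ n : ℕ, ‖x‖ < 2 ^ n := fun x => pow_unbounded_of_one_lt _ (by norm_num)
  choose N hN using hN
  have hA : ∀ (n : ℕ) (x : E), ‖x‖ < 2 ^ n → a (N x) x = a n x := by
    intro n x hx
    have h1 := hstep n (N x) x hx
    have h2 := hstep (N x) n x (hN x)
    rw [add_comm] at h1
    rw [← h1, h2]
  let b : E →+ ℝ :=
    { toFun := fun x => a (N x) x
      map_zero' := by simp [a, h0]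
      map_add' := fun x y => by
        obtain ⟨n, hn⟩ : ∃ n : ℕ, ‖x‖ + ‖y‖ < 2 ^ n := pow_unbounded_of_one_lt _ (by norm_num)
        have hx : ‖x‖ < 2 ^ n := by linarith [norm_nonneg y]
        have hy : ‖y‖ < 2 ^ n := by linarith [norm_nonneg x]
        have hxy : ‖x + y‖ < 2 ^ (n + 1) := by
          rw [pow_succ]
          linarith [norm_add_le x y, norm_nonneg x, norm_nonneg y]
        rw [hA _ _ hx, hA _ _ hy, hA _ _ hxy]
        have := hmid _ _ (hsmall n x hx) (hsmall n y hy)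
        rw [← smul_add, smul_smul, ← pow_succ'] at this
        change 2 ^ (n + 1) * Λ ((1 / 2 : ℝ) ^ (n + 1) • (x + y)) =
          2 ^ n * Λ ((1 / 2 : ℝ) ^ n • x) + 2 ^ n * Λ ((1 / 2 : ℝ) ^ n • y)
        rw [pow_succ]
        linear_combination (- 2 ^ n) * this }
  have hb : ∀ x, ‖x‖ < 1 → b x = Λ x := fun x hx => by
    change a (N x) x = _
    rw [hA 0 x (by simpa using hx)]
    simp [a]
  have hc : Continuous b := by
    refine b.continuous_of_isBounded_nhds_zero (Metric.ball_mem_nhds 0 one_pos) ?_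
    refine (Metric.isBounded_closedBall (x := (0 : ℝ)) (r := C)).subset ?_
    rintro _ ⟨x, hx, rfl⟩
    rw [mem_ball_zero_iff] at hx
    rw [mem_closedBall_zero_iff, Real.norm_eq_abs, hb x hx]
    exact hC x hx
  refine ⟨b.toRealLinearMap hc, hb, fun x => ?_⟩
  by_cases hx : ‖x‖ = 0
  · simp [norm_eq_zero.1 hx]
  have h1 : ‖(2 * ‖x‖)⁻¹ • x‖ < 1 := by
    rw [norm_smul, norm_inv, norm_mul, norm_norm, Real.norm_ofNat]
    field_simp
    norm_num
  have h2 : (b.toRealLinearMap hc) x = (2 * ‖x‖) * Λ ((2 * ‖x‖)⁻¹ • x) := by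
    rw [← hb _ h1]
    change _ = (2 * ‖x‖) * (b.toRealLinearMap hc) ((2 * ‖x‖)⁻¹ • x)
    rw [map_smul, smul_eq_mul]
    field_simp
  rw [h2, abs_mul, abs_of_nonneg (by positivity)]
  nlinarith [hC _ h1, norm_nonneg x]

section Defect

variable {A : Type*} [CStarAlgebra A] [PartialOrder A] [StarOrderedRing A]

/-- The defect operator of a contraction. -/
noncomputable def defect (w : A) : A := CFC.sqrt (1 - star w * w)

theorem star_defect (w : A) : star (defect w) = defect w :=
  (CFC.sqrt_nonneg _).isSelfAdjoint

theorem defect_sq {w : A} (hw : ‖w‖ ≤ 1) : star w * w + defect w * defect w = 1 := by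
  have h : ‖star w * w‖ ≤ 1 := by
    rw [CStarRing.norm_star_mul_self]; nlinarith [norm_nonneg w]
  rw [CStarAlgebra.norm_le_one_iff_of_nonneg _ (star_mul_self_nonneg w)] at h
  rw [defect, CFC.sqrt_mul_sqrt_self _ (sub_nonneg.2 h)]
  abel

theorem isUnit_defect {w : A} (hw : ‖w‖ < 1) : IsUnit (defect w) := by
  have h : ‖star w * w‖ < 1 := by
    rw [CStarRing.norm_star_mul_self]; nlinarith [norm_nonneg w]
  have h1 := isUnit_one_sub_of_norm_lt_one h
  rw [← defect_sq hw.le, add_sub_cancel_left] at h1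
  exact ((Commute.refl _).isUnit_mul_iff.1 h1).1

set_option maxHeartbeats 1000000 in
theorem IsProjMeasure.exists_clm_avgVal {m : A → ℝ} {M : ℝ} (hm : IsProjMeasure m M)
    {v : Fin 7 → A} (hv : OrthIsos v) :
    ∃ L : A →L[ℝ] ℝ, (∀ w, ‖w‖ < 1 →
      L w = avgVal m (v 0) ((√2)⁻¹ • (v 1 + v 2)) (v 5) w (defect w)) ∧
      ∀ w, |L w| ≤ 2 * (4 * M) * ‖w‖ := by
  have hv' := hv.mul_left
  have hc2 := inv_sqrt_two_mul_self
  have hc : (√2 : ℝ)⁻¹ ≠ 0 := by positivity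
  have h12 : (2⁻¹ : ℝ) • (1 : A) + (2⁻¹ : ℝ) • (1 : A) = 1 := by module
  have h12' : ∀ x : A, (2⁻¹ : ℝ) • x + (2⁻¹ : ℝ) • x = x := fun x => by module
  have bound : ∀ w : A, ‖w‖ < 1 →
      |avgVal m (v 0) ((√2)⁻¹ • (v 1 + v 2)) (v 5) w (defect w)| ≤ 4 * M := by
    intro w hw
    have hD := star_defect w
    have hwD := defect_sq hw.le
    have e1 := hm.abs_polarVal_le (Y := v 0)
      (W := (√2)⁻¹ • (v 1 + v 2) * w + v 5 * defect w) (by simp [hv _ _])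
      (by simp [mul_add, add_mul, mul_assoc, hv', hD, hwD, smul_smul, hc2, -mul_inv_rev, h12'])
      (by simp [mul_add, hv', add_mul, mul_assoc])
    have e2 := hm.abs_polarVal_le (Y := v 0)
      (W := (√2)⁻¹ • (v 1 + v 2) * w - v 5 * defect w) (by simp [hv _ _])
      (by simp [mul_add, add_mul, mul_sub, sub_mul, mul_assoc, hv', hD, hwD, smul_smul, hc2,
        -mul_inv_rev, h12'])
      (by simp [mul_add, mul_sub, hv', add_mul, mul_assoc])
    rw [avgVal]
    exact (abs_add_le _ _).trans (by linarith)
  refine exists_clm_of_midpoint_affine (C := 4 * M) ?_ ?_ bound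
  · rw [avgVal]
    simp [polarVal_neg]
  intro w w' hw hw'
  set D := defect w with hDdef
  set D' := defect w' with hDdef'
  have hD : star D = D := star_defect w
  have hwD : star w * w + D * D = 1 := defect_sq hw.le
  have hD' : star D' = D' := star_defect w'
  have hwD' : star w' * w' + D' * D' = 1 := defect_sq hw'.le
  set u := (1 / 2 : ℝ) • (w + w') with hu
  set δ := (1 / 2 : ℝ) • (w - w') with hδ
  have hun : ‖u‖ < 1 := by
    rw [hu, norm_smul]
    norm_num
    linarith [norm_add_le w w']
  obtain ⟨T, hT⟩ := isUnit_defect hun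
  have hTu := star_defect u
  have hsu := defect_sq hun.le
  rw [← hT] at hTu hsu ⊢
  have hTi : star (↑T⁻¹ : A) = ↑T⁻¹ := by
    have h1 : star (↑T⁻¹ : A) * (T : A) = 1 := by
      have := congrArg star (T.mul_inv)
      rwa [star_mul, hTu, star_one] at this
    exact (Units.eq_inv_of_mul_eq_one_right h1)
  have hrho : ∀ ε : ℝ, ε * ε = 1 →
      avgVal m (v 0) ((√2)⁻¹ • (v 1 + v 2)) (v 5) u T =
      polarVal m (v 0) ((√2)⁻¹ • (v 1 + v 2) * u +
        (√2)⁻¹ • ((v 1 - v 2) * δ + ε • (v 3 * D + v 4 * D'))) +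
      polarVal m (v 0) ((√2)⁻¹ • (v 1 + v 2) * u -
        (√2)⁻¹ • ((v 1 - v 2) * δ + ε • (v 3 * D + v 4 * D'))) := by
    intro ε hε
    set ρ := (√2)⁻¹ • ((v 1 - v 2) * δ + ε • (v 3 * D + v 4 * D')) with hρ
    have hρρ : star ρ * ρ = T * T := by
      have e1 : star ρ * ρ = (1 / 2 : ℝ) • (star δ * δ + star δ * δ + (D * D + D' * D')) := by
        rw [hρ]
        simp [mul_add, add_mul, mul_sub, sub_mul, mul_assoc, hv', hD, hD', smul_smul, hc2,
          -mul_inv_rev, hε]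
        rw [show ((√2)⁻¹ * (ε * ((√2)⁻¹ * ε)) : ℝ) = 2⁻¹ by
          linear_combination ε ^ 2 * hc2 + 1 / 2 * hε]
      have e2 : (T : A) * T = 1 - star u * u := by rw [← hsu]; abel
      have e3 : D * D = 1 - star w * w := by rw [← hwD]; abel
      have e4 : D' * D' = 1 - star w' * w' := by rw [← hwD']; abel
      rw [e1, e2, e3, e4, hu, hδ]
      simp only [star_smul, star_trivial, smul_mul_smul_comm, star_add, star_sub, mul_add, add_mul,
        mul_sub, sub_mul]
      module
    have hY : star (v 0) * ρ = 0 := by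
      rw [hρ]; simp [mul_add, mul_sub, sub_mul, mul_assoc, hv']
    have hF : star (v 1) * ρ + star (v 2) * ρ = 0 := by
      rw [hρ]; simp [mul_add, mul_sub, sub_mul, mul_assoc, hv']
    have h5 : star (v 5) * ρ = 0 := by
      rw [hρ]; simp [mul_add, mul_sub, sub_mul, mul_assoc, hv']
    have h6 : star (v 6) * ρ = 0 := by
      rw [hρ]; simp [mul_add, mul_sub, sub_mul, mul_assoc, hv']
    have hY' : star ρ * v 0 = 0 := by simpa using congrArg star hY
    have hF' : star ρ * v 1 + star ρ * v 2 = 0 := by simpa using congrArg star hF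
    have h5' : star ρ * v 5 = 0 := by simpa using congrArg star h5
    have h6' : star ρ * v 6 = 0 := by simpa using congrArg star h6
    have := hm.avgVal_indep (v := ![v 0, (√2)⁻¹ • (v 1 + v 2), v 6, v 5, ρ * ↑T⁻¹]) (by
      intro i j
      fin_cases i <;> fin_cases j <;>
        simp [hv _ _, mul_add, add_mul, mul_assoc, hTi, smul_smul, hc2, -mul_inv_rev]
      · simp [← mul_assoc, hY]
      · exact h12
      · rw [← mul_assoc, ← mul_assoc, ← smul_add, ← add_mul, hF]; simp
      · simp [← mul_assoc, h6]
      · simp [← mul_assoc, h5]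
      · simp [hY']
      · rw [← smul_add, ← mul_add, hF']; simp
      · simp [h6']
      · simp [h5']
      · rw [← mul_assoc (star ρ), hρρ]; simp [mul_assoc]) hTu hsu
    simp only [Matrix.cons_val] at this
    rw [this, avgVal, mul_assoc, Units.inv_mul, mul_one]
  have indep : ∀ (x E : A), star E = E → star x * x + E * E = 1 → ∀ i j : Fin 7,
      (i, j) = (1, 3) ∨ (i, j) = (1, 4) ∨ (i, j) = (2, 3) ∨ (i, j) = (2, 4) →
      avgVal m (v 0) (v i) (v j) x E = avgVal m (v 0) (v i) (v 5) x E := by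
    intro x E hE hxE i j hij
    have := hm.avgVal_indep (hv.comp (e := ![0, i, 6, j, 5]) (by
      simp only [Prod.mk.injEq] at hij
      rcases hij with ⟨rfl, rfl⟩ | ⟨rfl, rfl⟩ | ⟨rfl, rfl⟩ | ⟨rfl, rfl⟩ <;> decide)) hE hxE
    simpa only [Function.comp_apply, Matrix.cons_val] using this
  have addl : ∀ (x E : A), star E = E → star x * x + E * E = 1 →
      avgVal m (v 0) ((√2)⁻¹ • (v 1 + v 2)) (v 5) x E =
      (√2)⁻¹ * (avgVal m (v 0) (v 1) (v 5) x E + avgVal m (v 0) (v 2) (v 5) x E) := by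
    intro x E hE hxE
    have := hm.avgVal_add_left (hv.comp (e := ![0, 1, 2, 3, 4, 5]) (by decide)) hE hxE
    simpa only [Function.comp_apply, Matrix.cons_val] using this
  have sums : ∀ ε : ℝ, ε * ε = 1 →
      polarVal m (v 0) ((√2)⁻¹ • (v 1 + v 2) * u +
        (√2)⁻¹ • ((v 1 - v 2) * δ + ε • (v 3 * D + v 4 * D'))) =
      (√2)⁻¹ * (polarVal m (v 0) (v 1 * w + ε • (v 3 * D)) +
        polarVal m (v 0) (v 2 * w' + ε • (v 4 * D'))) ∧
      polarVal m (v 0) ((√2)⁻¹ • (v 1 + v 2) * u -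
        (√2)⁻¹ • ((v 1 - v 2) * δ + ε • (v 3 * D + v 4 * D'))) =
      (√2)⁻¹ * (polarVal m (v 0) (v 2 * w + (-ε) • (v 3 * D)) +
        polarVal m (v 0) (v 1 * w' + (-ε) • (v 4 * D'))) := by
    intro ε hε
    have e1 := hm.polarVal_add (Y := v 0) (V := v 1 * w + ε • (v 3 * D))
      (W := v 2 * w' + ε • (v 4 * D')) (by simp [hv _ _])
      (by simp [mul_add, add_mul, mul_assoc, hv', hD, smul_smul, hε, hwD])
      (by simp [mul_add, add_mul, mul_assoc, hv', hD', smul_smul, hε, hwD'])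
      (by simp [mul_add, hv']) (by simp [mul_add, hv'])
      (by simp [mul_add, add_mul, mul_assoc, hv'])
    have e2 := hm.polarVal_add (Y := v 0) (V := v 2 * w + (-ε) • (v 3 * D))
      (W := v 1 * w' + (-ε) • (v 4 * D')) (by simp [hv _ _])
      (by simp [mul_add, add_mul, mul_assoc, hv', hD, smul_smul, hε, hwD])
      (by simp [mul_add, add_mul, mul_assoc, hv', hD', smul_smul, hε, hwD'])
      (by simp [mul_add, hv']) (by simp [mul_add, hv'])
      (by simp [mul_add, add_mul, mul_assoc, hv'])
    rw [← e1, ← e2]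
    constructor
    · congr 1
      simp only [hu, hδ, mul_smul_comm, smul_mul_assoc, mul_add, mul_sub, add_mul, sub_mul]
      module
    · congr 1
      simp only [hu, hδ, mul_smul_comm, smul_mul_assoc, mul_add, mul_sub, add_mul, sub_mul]
      module
  have p1 := hrho 1 (by norm_num)
  have p2 := hrho (-1) (by norm_num)
  rw [(sums 1 (by norm_num)).1, (sums 1 (by norm_num)).2] at p1
  rw [(sums (-1) (by norm_num)).1, (sums (-1) (by norm_num)).2] at p2
  simp only [neg_neg, one_smul, neg_smul, ← sub_eq_add_neg] at p1 p2
  have q1 := indep w D hD hwD 1 3 (by simp)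
  have q2 := indep w D hD hwD 2 3 (by simp)
  have q3 := indep w' D' hD' hwD' 1 4 (by simp)
  have q4 := indep w' D' hD' hwD' 2 4 (by simp)
  rw [addl w D hD hwD, addl w' D' hD' hwD', ← q1, ← q2, ← q3, ← q4]
  rw [two_mul]
  nth_rewrite 1 [p1]
  rw [p2]
  unfold avgVal
  ring

end Defect

theorem exists_ultralimit {E : Type*} [AddCommGroup E] [Module ℝ E] (f : ℕ → E →ₗ[ℝ] ℝ)
    (C : E → ℝ) (hC : ∀ n x, |f n x| ≤ C x) :
    ∃ g : E →ₗ[ℝ] ℝ, ∀ x, Tendsto (fun n => f n x) (hyperfilter ℕ : Filter ℕ) (𝓝 (g x)) := by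
  have h : ∀ x, ∃ y, Tendsto (fun n => f n x) (hyperfilter ℕ : Filter ℕ) (𝓝 y) := by
    intro x
    have hc : IsCompact (Set.Icc (-C x) (C x)) := isCompact_Icc
    have := hc.ultrafilter_le_nhds ((hyperfilter ℕ).map fun n => f n x) (by
      rw [le_principal_iff]
      exact Eventually.of_forall (f := (hyperfilter ℕ : Filter ℕ)) fun n => abs_le.1 (hC n x))
    obtain ⟨y, -, hy⟩ := this
    exact ⟨y, hy⟩
  choose g hg using h
  refine ⟨{ toFun := g, map_add' := fun x y => ?_, map_smul' := fun c x => ?_ }, hg⟩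
  · refine tendsto_nhds_unique (hg (x + y)) ?_
    simpa using (hg x).add (hg y)
  · refine tendsto_nhds_unique (hg (c • x)) ?_
    simpa using (hg x).const_mul c

section Swindle

variable {A : Type*} [CStarAlgebra A] [PartialOrder A] [StarOrderedRing A]

theorem norm_le_one_of_star_mul_self {r : A} (hr : star r * r = 1) : ‖r‖ ≤ 1 := by
  have h1 : ‖(1 : A)‖ ≤ 1 :=
    (CStarAlgebra.norm_le_one_iff_of_nonneg _ zero_le_one).2 le_rfl
  have := CStarRing.norm_star_mul_self (x := r)
  rw [hr] at this
  nlinarith [norm_nonneg r]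

theorem IsProjMeasure.exists_clm_polarVal {m : A → ℝ} {M : ℝ} (hm : IsProjMeasure m M)
    {v : Fin 7 → A} (hv : OrthIsos v) :
    ∃ L : A →L[ℝ] ℝ, (∀ r, star r * r = 1 →
      2 * polarVal m (v 0) ((√2)⁻¹ • (v 1 + v 2) * r) = L r) ∧
      ∀ w, |L w| ≤ 2 * (4 * M) * ‖w‖ := by
  obtain ⟨L, hL, hb⟩ := hm.exists_clm_avgVal hv
  refine ⟨L, fun r hr => ?_, hb⟩
  have hv' := hv.mul_left
  have hc2 := inv_sqrt_two_mul_self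
  have h12' : ∀ x : A, (2⁻¹ : ℝ) • x + (2⁻¹ : ℝ) • x = x := fun x => by module
  have hr1 := norm_le_one_of_star_mul_self hr
  have hd : defect ((3 / 5 : ℝ) • r) = (4 / 5 : ℝ) • 1 := by
    refine CFC.sqrt_unique ?_ (smul_nonneg (by norm_num) zero_le_one)
    simp only [star_smul, star_trivial, smul_mul_smul_comm, hr, mul_one]
    module
  have h := hL ((3 / 5 : ℝ) • r) (by
    rw [norm_smul]; norm_num; linarith)
  rw [hd, map_smul, smul_eq_mul, avgVal] at h
  have ho : OrthIsos ![v 0, (√2)⁻¹ • (v 1 + v 2) * r, v 5] := orthIsos_three (by simp [hv _ _])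
    (by simp [mul_add, add_mul, mul_assoc, hv', smul_smul, hc2, -mul_inv_rev, h12', hr])
    (by simp [hv _ _]) (by simp [mul_add, add_mul, hv']) (by simp [hv _ _])
    (by simp [add_mul, hv _ _, mul_assoc])
  have e1 := hm.polarVal_linear ho (c := 3 / 5) (s := 4 / 5) (by norm_num)
  have e2 := hm.polarVal_linear ho (c := 3 / 5) (s := -(4 / 5)) (by norm_num)
  simp only [Matrix.cons_val, neg_smul, ← sub_eq_add_neg] at e1 e2
  rw [mul_smul_comm, mul_smul_comm, mul_one, e1, e2] at h
  linarith

theorem OrthIsos.rotate {ι : Type*} [DecidableEq ι] {w : ι → A} (hw : OrthIsos w) {a b : ι}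
    (hab : a ≠ b) :
    OrthIsos fun k => if k = a then (√2)⁻¹ • (w a + w b) else
      if k = b then (√2)⁻¹ • (w a - w b) else w k := by
  have hc2 := inv_sqrt_two_mul_self
  have h12 : (2⁻¹ : ℝ) • (1 : A) + (2⁻¹ : ℝ) • (1 : A) = 1 := by module
  intro i j
  by_cases hia : i = a
  · subst hia
    by_cases hji : j = i
    · subst hji
      simp [hab, hab.symm, mul_add, add_mul, hw _ _, smul_smul, hc2, -mul_inv_rev, h12]
    · by_cases hjb : j = b
      · subst hjb
        simp [hab, hab.symm, mul_sub, add_mul, hw _ _]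
      · simp [hji, hjb, Ne.symm hji, Ne.symm hjb, add_mul, hw _ _]
  · by_cases hib : i = b
    · subst hib
      by_cases hji : j = i
      · subst hji
        simp [hab, hab.symm, mul_sub, sub_mul, hw _ _, smul_smul, hc2, -mul_inv_rev, h12]
      · by_cases hja : j = a
        · subst hja
          simp [hab, hab.symm, mul_add, sub_mul, hw _ _]
        · simp [hia, hji, hja, Ne.symm hji, Ne.symm hja, sub_mul, hw _ _]
    · by_cases hja : j = a
      · subst hja
        simp [hia, hib, mul_add, hw _ _]
      · by_cases hjb : j = b
        · subst hjb
          simp [hia, hib, hja, mul_sub, hw _ _]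
        · simp [hia, hib, hja, hjb, hw _ _]

theorem IsProjMeasure.exists_clm_sub {m : A → ℝ} {M : ℝ} (hm : IsProjMeasure m M)
    {v : Fin 7 → A} (hv : OrthIsos v) :
    ∃ L : A →L[ℝ] ℝ, (∀ p, IsStarProjection p →
      m (v 0 * p * star (v 0)) - m (v 1 * p * star (v 1)) = L p) ∧
      ∀ w, |L w| ≤ 4 * M * ‖w‖ := by
  have hc2 := inv_sqrt_two_mul_self
  have hv' := hv.mul_left
  set Y := (√2)⁻¹ • (v 0 + v 1) with hY
  set Z := (√2)⁻¹ • (v 0 - v 1) with hZ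
  have hu := (hv.rotate (a := 0) (b := 1) (by decide)).rotate (a := 1) (b := 2) (by decide)
  obtain ⟨L, hL, hb⟩ := hm.exists_clm_polarVal hu
  simp only [← hY, ← hZ, if_true, one_ne_zero, zero_ne_one, if_false, (by decide : (2 : Fin 7) ≠ 0),
    (by decide : (2 : Fin 7) ≠ 1), (by decide : (0 : Fin 7) ≠ 2)] at hL
  have hF : (√2)⁻¹ • ((√2)⁻¹ • (Z + v 2) + (√2)⁻¹ • (Z - v 2)) = Z := by
    rw [← smul_add, smul_smul, hc2]; module
  rw [hF] at hL
  have hproj : ∀ (i : Fin 7) (p : A), IsStarProjection p →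
      IsStarProjection (v i * p * star (v i)) := by
    intro i p hp
    constructor
    · change _ * _ = _
      simp only [mul_assoc, hv', if_true]
      rw [← mul_assoc p p, hp.isIdempotentElem.eq]
    · simp [IsSelfAdjoint, mul_assoc, hp.isSelfAdjoint.star_eq]
  have horth : ∀ p q : A, (v 0 * p * star (v 0)) * (v 1 * q * star (v 1)) = 0 := by
    intro p q
    simp [mul_assoc, hv']
  have hcompl : ∀ (i : Fin 7) (p : A), IsStarProjection p →
      m (v i * (1 - p) * star (v i)) = m (v i * 1 * star (v i)) - m (v i * p * star (v i)) := by
    intro i p hp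
    have := hm.add _ _ (hproj i p hp) (hproj i (1 - p) hp.one_sub) (by
      simp only [mul_assoc, hv', if_true]
      rw [← mul_assoc p, hp.mul_one_sub_self]; simp)
    rw [← add_mul, ← mul_add, add_sub_cancel] at this
    linarith
  have key : ∀ p, IsStarProjection p →
      m (v 0 * p * star (v 0)) - m (v 1 * p * star (v 1)) = (1 / 4 : ℝ) * L ((2 : ℝ) • p - 1) +
      (1 / 2 : ℝ) * (m (v 0 * 1 * star (v 0)) - m (v 1 * 1 * star (v 1))) := by
    intro p hp
    have hpp := hp.isIdempotentElem.eq
    have hps := hp.isSelfAdjoint.star_eq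
    have h := hL ((2 : ℝ) • p - 1) (by
      simp only [star_sub, star_smul, star_trivial, hps, star_one, sub_mul, mul_sub,
        smul_mul_smul_comm, hpp, mul_one, one_mul]
      module)
    rw [← h, polarVal]
    have a1 : Y + Z * ((2 : ℝ) • p - 1) = (2 * (√2)⁻¹) • (v 0 * p + v 1 * (1 - p)) := by
      rw [hY, hZ]
      simp only [mul_sub, mul_one, smul_mul_assoc, mul_smul_comm, sub_mul]
      module
    have a2 : Y - Z * ((2 : ℝ) • p - 1) = (2 * (√2)⁻¹) • (v 0 * (1 - p) + v 1 * p) := by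
      rw [hY, hZ]
      simp only [mul_sub, mul_one, smul_mul_assoc, mul_smul_comm, sub_mul]
      module
    have hs : (1 / 2 : ℝ) * ((2 * (√2)⁻¹) * (2 * (√2)⁻¹)) = 1 := by
      linear_combination 2 * hc2
    have b1 : (v 0 * p + v 1 * (1 - p)) * star (v 0 * p + v 1 * (1 - p)) =
        v 0 * p * star (v 0) + v 1 * (1 - p) * star (v 1) := by
      have c1 : p * (p * star (v 0)) = p * star (v 0) := by rw [← mul_assoc, hpp]
      have c2 : p * (p * star (v 1)) = p * star (v 1) := by rw [← mul_assoc, hpp]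
      simp only [star_add, star_mul, star_sub, star_one, hps, mul_add, add_mul, mul_sub, sub_mul,
        mul_assoc, mul_one, one_mul, c1, c2]
      abel
    have b2 : (v 0 * (1 - p) + v 1 * p) * star (v 0 * (1 - p) + v 1 * p) =
        v 0 * (1 - p) * star (v 0) + v 1 * p * star (v 1) := by
      have c1 : p * (p * star (v 0)) = p * star (v 0) := by rw [← mul_assoc, hpp]
      have c2 : p * (p * star (v 1)) = p * star (v 1) := by rw [← mul_assoc, hpp]
      simp only [star_add, star_mul, star_sub, star_one, hps, mul_add, add_mul, mul_sub, sub_mul,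
        mul_assoc, mul_one, one_mul, c1, c2]
      abel
    rw [a1, a2, star_smul, star_smul, star_trivial (2 * (√2)⁻¹ : ℝ), smul_mul_smul_comm, smul_mul_smul_comm,
      smul_smul, smul_smul, hs, one_smul, one_smul, b1, b2,
      hm.add _ _ (hproj 0 p hp) (hproj 1 _ hp.one_sub) (horth _ _),
      hm.add _ _ (hproj 0 _ hp.one_sub) (hproj 1 p hp) (horth _ _), hcompl 0 p hp, hcompl 1 p hp]
    ring
  refine ⟨(1 / 2 : ℝ) • L, fun p hp => ?_, fun w => ?_⟩
  · have h0 := key 0 (.zero A)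
    have h1 := key p hp
    simp only [mul_zero, zero_mul, sub_self, smul_zero, zero_sub, map_neg] at h0
    rw [map_sub, map_smul, smul_eq_mul] at h1
    simp only [ContinuousLinearMap.smul_apply, smul_eq_mul]
    linarith
  · simp only [ContinuousLinearMap.smul_apply, smul_eq_mul, abs_mul]
    rw [abs_of_pos (by norm_num : (0 : ℝ) < 1 / 2)]
    linarith [hb w]

theorem IsProjMeasure.exists_clm_conj {m : A → ℝ} {M : ℝ} (hm : IsProjMeasure m M)
    {v : ℕ → A} (hv : OrthIsos v) :
    ∃ L : A →L[ℝ] ℝ, ∀ p, IsStarProjection p → m (v 0 * p * star (v 0)) = L p := by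
  have hv' := hv.mul_left
  have hk : ∀ k : ℕ, ∃ L : A →L[ℝ] ℝ, (∀ p, IsStarProjection p →
      m (v 0 * p * star (v 0)) - m (v (k + 1) * p * star (v (k + 1))) = L p) ∧
      ∀ w, |L w| ≤ 4 * M * ‖w‖ := by
    intro k
    exact hm.exists_clm_sub (hv.comp (e := ![0, k + 1, k + 2, k + 3, k + 4, k + 5, k + 6]) (by
      intro i j hij
      fin_cases i <;> fin_cases j <;> simp at hij ⊢))
  choose L hL hb using hk
  have hsum : ∀ (p : A), IsStarProjection p → ∀ n : ℕ,
      IsStarProjection (∑ k ∈ Finset.range n, v (k + 1) * p * star (v (k + 1))) ∧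
      m (∑ k ∈ Finset.range n, v (k + 1) * p * star (v (k + 1))) =
        ∑ k ∈ Finset.range n, m (v (k + 1) * p * star (v (k + 1))) := by
    intro p hp n
    have hproj : ∀ i, IsStarProjection (v i * p * star (v i)) := by
      intro i
      constructor
      · change _ * _ = _
        simp only [mul_assoc, hv', if_true]
        rw [← mul_assoc p p, hp.isIdempotentElem.eq]
      · simp [IsSelfAdjoint, mul_assoc, hp.isSelfAdjoint.star_eq]
    induction n with
    | zero => simp [hm.zero, IsStarProjection.zero]
    | succ n ih =>
      have h0 : (∑ k ∈ Finset.range n, v (k + 1) * p * star (v (k + 1))) *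
          (v (n + 1) * p * star (v (n + 1))) = 0 := by
        rw [Finset.sum_mul]
        refine Finset.sum_eq_zero fun k hk => ?_
        have : k ≠ n := (Finset.mem_range.1 hk).ne
        simp [mul_assoc, hv', this]
      rw [Finset.sum_range_succ, Finset.sum_range_succ, hm.add _ _ ih.1 (hproj _) h0, ih.2]
      exact ⟨ih.1.add (hproj _) h0, rfl⟩
  obtain ⟨g, hg⟩ := exists_ultralimit
    (fun n => ((n + 1 : ℝ)⁻¹) • ∑ k ∈ Finset.range (n + 1), (L k : A →ₗ[ℝ] ℝ))
    (fun x => 4 * M * ‖x‖) (fun n x => by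
      simp only [LinearMap.smul_apply, LinearMap.sum_apply, smul_eq_mul, abs_mul,
        ContinuousLinearMap.coe_coe]
      rw [abs_of_pos (by positivity), inv_mul_le_iff₀ (by positivity)]
      refine (Finset.abs_sum_le_sum_abs _ _).trans ?_
      refine (Finset.sum_le_sum fun k _ => hb k x).trans ?_
      simp)
  have hgb : ∀ x, ‖g x‖ ≤ 4 * M * ‖x‖ := by
    intro x
    refine le_of_tendsto (hg x).norm (Eventually.of_forall fun n => ?_)
    simp only [LinearMap.smul_apply, LinearMap.sum_apply, smul_eq_mul, norm_mul,
        ContinuousLinearMap.coe_coe]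
    rw [Real.norm_of_nonneg (by positivity), inv_mul_le_iff₀ (by positivity)]
    refine (norm_sum_le _ _).trans ?_
    refine (Finset.sum_le_sum fun k _ => hb k x).trans ?_
    simp
  refine ⟨g.mkContinuous _ hgb, fun p hp => ?_⟩
  refine tendsto_nhds_unique ?_ (hg p)
  have heq : ∀ n : ℕ, (((n + 1 : ℝ)⁻¹) • ∑ k ∈ Finset.range (n + 1), (L k : A →ₗ[ℝ] ℝ)) p =
      m (v 0 * p * star (v 0)) -
        (n + 1 : ℝ)⁻¹ * m (∑ k ∈ Finset.range (n + 1), v (k + 1) * p * star (v (k + 1))) := by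
    intro n
    simp only [LinearMap.smul_apply, LinearMap.sum_apply, smul_eq_mul, ContinuousLinearMap.coe_coe]
    rw [(hsum p hp _).2]
    simp only [← hL _ p hp, Finset.sum_sub_distrib, Finset.sum_const, Finset.card_range,
      nsmul_eq_mul]
    push_cast
    field_simp
  simp only [heq]
  have hlim : Tendsto (fun n : ℕ => (n + 1 : ℝ)⁻¹ *
      m (∑ k ∈ Finset.range (n + 1), v (k + 1) * p * star (v (k + 1)))) atTop (𝓝 0) := by
    have h1 : Tendsto (fun n : ℕ => (n + 1 : ℝ)⁻¹ * M) atTop (𝓝 0) := by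
      have := (tendsto_one_div_add_atTop_nhds_zero_nat (𝕜 := ℝ)).mul_const M
      simpa using this
    refine squeeze_zero_norm (fun n => ?_) h1
    rw [norm_mul, Real.norm_of_nonneg (by positivity)]
    exact mul_le_mul_of_nonneg_left (hm.bdd _ (hsum p hp _).1) (by positivity)
  have := (tendsto_const_nhds (x := m (v 0 * p * star (v 0)))).sub hlim
  rw [sub_zero] at this
  exact this.mono_left Nat.hyperfilter_le_atTop

/-- A bounded measure on projections is linear below a projection whose range misses the range of
an isometry. -/
theorem IsProjMeasure.exists_clm_below {m : A → ℝ} {M : ℝ} (hm : IsProjMeasure m M)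
    {R : ℕ → A} (hR : OrthIsos R) {E T : A} (hE : IsStarProjection E) (hT : star T * T = 1)
    (hTE : star T * E = 0) :
    ∃ L : A →L[ℝ] ℝ, ∀ p, IsStarProjection p → E * p = p → m p = L p := by
  have hR' := hR.mul_left
  have hEE := hE.isIdempotentElem.eq
  have hEs := hE.isSelfAdjoint.star_eq
  have hET : E * T = 0 := by simpa [hEs] using congrArg star hTE
  have hTT : ∀ x, star T * (T * x) = x := fun x => by rw [← mul_assoc, hT, one_mul]
  have hETx : ∀ x, E * (T * x) = 0 := fun x => by rw [← mul_assoc, hET, zero_mul]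
  obtain ⟨L, hL⟩ := hm.exists_clm_conj
    (v := fun k => if k = 0 then E + T * (R 0 * (1 - E)) else T * R k) (by
      intro i j
      by_cases hi : i = 0 <;> by_cases hj : j = 0
      · subst hi hj
        simp [mul_add, add_mul, hEs, mul_assoc, hEE, hTE, hTT, hETx, hR', hR _ _, sub_mul, mul_sub]
      · subst hi
        simp [add_mul, hEs, mul_assoc, hTT, hETx, hR _ _, hj, Ne.symm hj, sub_mul]
      · subst hj
        simp [mul_add, mul_assoc, hTE, hTT, hR', hi]
      · simp [mul_assoc, hTT, hR _ _, hi, hj])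
  refine ⟨L, fun p hp hpE => ?_⟩
  rw [← hL p hp]
  have hpE' : p * E = p := by
    simpa [hEs, hp.isSelfAdjoint.star_eq] using congrArg star hpE
  have h1 : (E + T * (R 0 * (1 - E))) * p = p := by
    simp [add_mul, hpE, mul_assoc, sub_mul]
  have h2 : p * star (E + T * (R 0 * (1 - E))) = p := by
    simpa [hp.isSelfAdjoint.star_eq] using congrArg star h1
  simp only [if_true]
  rw [h1, h2]

end Swindle

section Ray

variable {H : Type*} [NormedAddCommGroup H] [InnerProductSpace ℂ H] [CompleteSpace H]

open InnerProductSpace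

/-- The quadratic function attached to the values of `m` on rank one projections. -/
noncomputable def rayVal (m : (H →L[ℂ] H) → ℝ) (x : H) : ℝ :=
  ‖x‖ ^ 2 * m ((‖x‖ ^ 2)⁻¹ • rankOne ℂ x x)

theorem rayVal_smul (m : (H →L[ℂ] H) → ℝ) (c : ℂ) (x : H) :
    rayVal m (c • x) = ‖c‖ ^ 2 * rayVal m x := by
  by_cases hc : c = 0
  · simp [hc, rayVal]
  have hc' : ‖c‖ ≠ 0 := norm_ne_zero_iff.2 hc
  have h1 : rankOne ℂ (c • x) (c • x) = (‖c‖ ^ 2) • rankOne ℂ x x := by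
    ext z
    simp only [rankOne_apply, ContinuousLinearMap.smul_apply, inner_smul_left, smul_smul,
      ← Complex.coe_smul (‖c‖ ^ 2)]
    congr 1
    rw [mul_right_comm, mul_comm _ c, Complex.mul_conj']
    push_cast
    ring
  have h2 : (‖c • x‖ ^ 2)⁻¹ * ‖c‖ ^ 2 = (‖x‖ ^ 2)⁻¹ := by
    rw [norm_smul]
    by_cases h : ‖x‖ = 0
    · simp [h]
    · field_simp
  rw [rayVal, rayVal, h1, smul_smul, h2, norm_smul]
  ring

/-- Three pairwise orthogonal unit vectors. -/
structure Ortho3 (x y z : H) : Prop where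
  x1 : ‖x‖ = 1
  y1 : ‖y‖ = 1
  z1 : ‖z‖ = 1
  xy : ⟪x, y⟫_ℂ = 0
  xz : ⟪x, z⟫_ℂ = 0
  yz : ⟪y, z⟫_ℂ = 0

/-- The polarization of `rayVal`. -/
noncomputable def rayPol (m : (H →L[ℂ] H) → ℝ) (x y : H) : ℝ := rayVal m (x + y) - rayVal m (x - y)

theorem IsProjMeasure.rayVal_frame {m : (H →L[ℂ] H) → ℝ} {M : ℝ} (hm : IsProjMeasure m M)
    {x y z : H} (h : Ortho3 x y z) :
    (∀ u v : E3, rayVal m ((((u + v) 0 : ℝ) : ℂ) • x + (((u + v) 1 : ℝ) : ℂ) • y +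
          (((u + v) 2 : ℝ) : ℂ) • z) +
        rayVal m ((((u - v) 0 : ℝ) : ℂ) • x + (((u - v) 1 : ℝ) : ℂ) • y +
          (((u - v) 2 : ℝ) : ℂ) • z) =
      2 * rayVal m (((u 0 : ℝ) : ℂ) • x + ((u 1 : ℝ) : ℂ) • y + ((u 2 : ℝ) : ℂ) • z) +
      2 * rayVal m (((v 0 : ℝ) : ℂ) • x + ((v 1 : ℝ) : ℂ) • y + ((v 2 : ℝ) : ℂ) • z)) ∧
    (∀ (a b c s : ℝ), rayPol m ((a : ℂ) • x) (((c * b : ℝ) : ℂ) • y + (s : ℂ) • z) =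
      c * rayPol m ((a : ℂ) • x) ((b : ℂ) • y) + s * rayPol m ((a : ℂ) • x) z) := by
  set a : Fin 3 → (H →L[ℂ] H) := fun i => rankOne ℂ ((![x, y, z] : Fin 3 → H) i) x with ha
  have hon : ∀ i j, ⟪(![x, y, z] : Fin 3 → H) i, (![x, y, z] : Fin 3 → H) j⟫_ℂ =
      if i = j then 1 else 0 := by
    have e1 := inner_eq_zero_symm.1 h.xy
    have e2 := inner_eq_zero_symm.1 h.xz
    have e3 := inner_eq_zero_symm.1 h.yz
    intro i j
    fin_cases i <;> fin_cases j <;>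
      simp [h.xy, h.xz, h.yz, e1, e2, e3, inner_self_eq_norm_sq_to_K, h.x1, h.y1, h.z1]
  have haa : ∀ i j, star (a i) * a j = if i = j then rankOne ℂ x x else 0 := by
    intro i j
    rw [ha, ContinuousLinearMap.star_eq_adjoint]
    simp only [adjoint_rankOne, ContinuousLinearMap.mul_def, rankOne_comp_rankOne, hon]
    split_ifs <;> simp
  have haP : ∀ i, a i * rankOne ℂ x x = a i := by
    intro i
    simp only [ha, ContinuousLinearMap.mul_def, rankOne_comp_rankOne,
      inner_self_eq_norm_sq_to_K, h.x1]
    simp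
  have hf := hm.isFrameFn haa haP
  have hC := hm.abs_frameVal_le haa haP
  have key : ∀ v : E3, frameVal m a v =
      rayVal m (((v 0 : ℝ) : ℂ) • x + ((v 1 : ℝ) : ℂ) • y + ((v 2 : ℝ) : ℂ) • z) := by
    intro v
    set w := ((v 0 : ℝ) : ℂ) • x + ((v 1 : ℝ) : ℂ) • y + ((v 2 : ℝ) : ℂ) • z with hw
    have h1 : frameComb a v = rankOne ℂ w x := by
      ext t
      simp [frameComb, ha, hw]
    have h2 : frameComb a v * star (frameComb a v) = rankOne ℂ w w := by
      rw [h1, ContinuousLinearMap.star_eq_adjoint]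
      simp only [adjoint_rankOne, ContinuousLinearMap.mul_def, rankOne_comp_rankOne,
      inner_self_eq_norm_sq_to_K, h.x1]
      simp
    have h3 : ‖w‖ ^ 2 = ‖v‖ ^ 2 := by
      have e1 := hon 1 0
      have e2 := hon 2 0
      have e3 := hon 2 1
      have e4 := hon 0 0
      have e5 := hon 1 1
      have e6 := hon 2 2
      simp only [Matrix.cons_val, if_true, Fin.isValue, one_ne_zero, if_false,
        (by decide : (2 : Fin 3) ≠ 0), (by decide : (2 : Fin 3) ≠ 1)] at e1 e2 e3 e4 e5 e6
      rw [EuclideanSpace.norm_sq_eq, Fin.sum_univ_three]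
      have : (⟪w, w⟫_ℂ).re = ‖w‖ ^ 2 := by
        rw [inner_self_eq_norm_sq_to_K]; norm_cast
      rw [← this, hw]
      simp only [inner_add_left, inner_add_right, inner_smul_left, inner_smul_right, h.xy, h.xz, h.yz,
        e1, e2, e3, e4, e5, e6]
      simp [sq]
    rw [frameVal, h2, rayVal, h3]
  constructor
  · intro u v
    rw [← key, ← key, ← key, ← key]
    exact hf.parallelogram hC u v
  · intro r b c s
    have := hf.polar_linear hC !₂[r, 0, 0] !₂[0, b, 0] !₂[0, 0, 1] c s
    simp only [key] at this
    simpa [rayPol, sub_eq_add_neg, add_assoc, neg_add, -neg_add_rev] using this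

theorem exists_phase (α : ℂ) : ∃ ω : ℂ, ‖ω‖ = 1 ∧ α = (‖α‖ : ℂ) * ω :=
  ⟨Complex.exp (α.arg * Complex.I), Complex.norm_exp_ofReal_mul_I _,
    (Complex.norm_mul_exp_arg_mul_I α).symm⟩

theorem Ortho3.smul {x y z : H} (h : Ortho3 x y z) {ω ω' : ℂ} (hω : ‖ω‖ = 1) (hω' : ‖ω'‖ = 1) :
    Ortho3 x (ω • y) (ω' • z) := by
  constructor <;> simp [norm_smul, inner_smul_left, inner_smul_right, h.x1, h.y1, h.z1, h.xy, h.xz,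
    h.yz, hω, hω']

section Meas

variable {m : (H →L[ℂ] H) → ℝ} {M : ℝ}

theorem IsProjMeasure.rayPol_add (hm : IsProjMeasure m M) {x y z : H} (h : Ortho3 x y z) (α β : ℂ) :
    rayPol m x (α • y + β • z) = rayPol m x (α • y) + rayPol m x (β • z) := by
  obtain ⟨ω, hω, e⟩ := exists_phase α
  obtain ⟨ω', hω', e'⟩ := exists_phase β
  have key := (hm.rayVal_frame (h.smul hω hω')).2 1
  have k1 := key 1 ‖α‖ ‖β‖
  have k2 := key 1 ‖α‖ 0
  have k3 := key 1 0 ‖β‖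
  simp only [Complex.ofReal_one, one_smul, mul_one, one_mul, smul_smul, ← e, ← e',
    Complex.ofReal_zero, zero_smul, add_zero, zero_add, zero_mul] at k1 k2 k3
  linarith

theorem IsProjMeasure.rayPol_real_smul (hm : IsProjMeasure m M) {x y z : H} (h : Ortho3 x y z) (t : ℝ) (α : ℂ) :
    rayPol m x ((t : ℂ) • α • y) = t * rayPol m x (α • y) := by
  obtain ⟨ω, hω, e⟩ := exists_phase α
  have key := (hm.rayVal_frame (h.smul hω hω)).2 1 ‖α‖ t 0
  simp only [Complex.ofReal_one, one_smul, mul_one, one_mul, smul_smul, Complex.ofReal_mul, mul_assoc,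
    ← e, Complex.ofReal_zero, zero_smul, add_zero, zero_add, zero_mul] at key ⊢
  exact key

theorem rayVal_neg (m : (H →L[ℂ] H) → ℝ) (x : H) : rayVal m (-x) = rayVal m x := by
  simpa using rayVal_smul m (-1) x

theorem rayPol_neg (m : (H →L[ℂ] H) → ℝ) (x y : H) : rayPol m x (-y) = -rayPol m x y := by
  simp [rayPol, sub_eq_add_neg, add_comm]

theorem IsProjMeasure.rayPol_rot (hm : IsProjMeasure m M) {x y z : H} (h : Ortho3 x y z) (α β : ℂ) :
    rayPol m x (α • y) + rayPol m x (β • z) =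
      rayPol m x (((α + β) / 2) • y) + rayPol m x (((α + β) / 2) • z) +
      rayPol m x (((α - β) / 2) • y) - rayPol m x (((α - β) / 2) • z) := by
  set r : ℂ := (((√2)⁻¹ : ℝ) : ℂ) with hr
  have hrr : r * r = 1 / 2 := by
    rw [hr, ← Complex.ofReal_mul, inv_sqrt_two_mul_self]; simp
  have hrc : (starRingEnd ℂ) r = r := Complex.conj_ofReal _
  have hyy : ⟪y, y⟫_ℂ = 1 := by rw [inner_self_eq_norm_sq_to_K, h.y1]; simp
  have hzz : ⟪z, z⟫_ℂ = 1 := by rw [inner_self_eq_norm_sq_to_K, h.z1]; simp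
  have hzy := inner_eq_zero_symm.1 h.yz
  have hn : ∀ w : H, ⟪w, w⟫_ℂ = 1 → ‖w‖ = 1 := by
    intro w hw
    rw [inner_self_eq_norm_sq_to_K] at hw
    have : ‖w‖ ^ 2 = 1 := Complex.ofReal_injective (by simpa using hw)
    exact (pow_eq_one_iff_of_nonneg (norm_nonneg _) two_ne_zero).1 this
  have ho : Ortho3 x (r • (y + z)) (r • (y - z)) := by
    refine ⟨h.x1, hn _ ?_, hn _ ?_, ?_, ?_, ?_⟩ <;>
    simp only [inner_smul_left, inner_smul_right, inner_add_left, inner_add_right, inner_sub_left,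
      inner_sub_right, h.xy, h.xz, h.yz, hzy, hyy, hzz, hrc]
    · linear_combination 2 * hrr
    · linear_combination 2 * hrr
    · ring
    · ring
    · ring
  have e1 : α • y + β • z = ((α + β) * r) • (r • (y + z)) + ((α - β) * r) • (r • (y - z)) := by
    rw [smul_smul, smul_smul, mul_assoc, mul_assoc, hrr]
    module
  have e2 : ((α + β) * r) • (r • (y + z)) = ((α + β) / 2) • y + ((α + β) / 2) • z := by
    rw [smul_smul, mul_assoc, hrr]
    module
  have e3 : ((α - β) * r) • (r • (y - z)) = ((α - β) / 2) • y + (-((α - β) / 2)) • z := by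
    rw [smul_smul, mul_assoc, hrr]
    module
  rw [← hm.rayPol_add h, e1, hm.rayPol_add ho, e2, e3, hm.rayPol_add h, hm.rayPol_add h, neg_smul,
    rayPol_neg]
  ring

theorem IsProjMeasure.rayPol_coeff_add (hm : IsProjMeasure m M) {x y z : H} (h : Ortho3 x y z) (α β : ℂ) :
    rayPol m x ((α + β) • y) = rayPol m x (α • y) + rayPol m x (β • y) := by
  have k1 := hm.rayPol_rot h α β
  have k2 := hm.rayPol_rot h β α
  have k3 := hm.rayPol_rot h α (-β)
  have k4 := hm.rayPol_rot h (-β) α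
  have hh : ∀ γ : ℂ, rayPol m x (γ • y) = 2 * rayPol m x ((γ / 2) • y) := by
    intro γ
    have := hm.rayPol_real_smul h 2 (γ / 2)
    rw [← this, smul_smul]
    congr 2
    push_cast
    ring
  have hn : ∀ (γ : ℂ) (w : H), rayPol m x ((-γ) • w) = -rayPol m x (γ • w) := by
    intro γ w
    rw [neg_smul, rayPol_neg]
  have e1 : (β - α) / 2 = -((α - β) / 2) := by ring
  have e2 : (α - -β) / 2 = (α + β) / 2 := by ring
  have e3 : (α + -β) / 2 = (α - β) / 2 := by ring
  have e4 : (-β - α) / 2 = -((α + β) / 2) := by ring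
  have e5 : (-β + α) / 2 = (α - β) / 2 := by ring
  have e6 : (β + α) / 2 = (α + β) / 2 := by ring
  simp only [e1, e2, e3, e4, e5, e6, hn] at k1 k2 k3 k4
  have h1 := hh (α + β)
  linarith

theorem IsProjMeasure.rayVal_comb (hm : IsProjMeasure m M) {x y z : H} (h : Ortho3 x y z) (α β : ℂ) :
    rayVal m (α • x + β • y) = ‖α‖ ^ 2 * rayVal m x + ‖β‖ ^ 2 * rayVal m y +
      1 / 2 * rayPol m x (((starRingEnd ℂ) α * β) • y) := by
  have real : ∀ (a : ℝ) (β : ℂ), rayVal m ((a : ℂ) • x + β • y) =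
      a ^ 2 * rayVal m x + ‖β‖ ^ 2 * rayVal m y + 1 / 2 * (a * rayPol m x (β • y)) := by
    intro a β
    obtain ⟨ω, hω, e⟩ := exists_phase β
    have ho := h.smul hω hω
    have k := (hm.rayVal_frame ho).1 !₂[a, 0, 0] !₂[0, ‖β‖, 0]
    have ho' : Ortho3 (ω • y) x z := by
      refine ⟨ho.y1, h.x1, h.z1, inner_eq_zero_symm.1 ho.xy, ?_, h.xz⟩
      rw [inner_smul_left, h.yz, mul_zero]
    have k2 := (hm.rayVal_frame ho').2 ‖β‖ 1 a 0
    simp only [smul_smul, ← e, rayPol, Complex.ofReal_one, one_smul, mul_one, Complex.ofReal_zero,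
      zero_smul, add_zero, zero_mul] at k2
    simp [smul_smul, ← e, rayVal_smul, -Complex.coe_smul, sub_eq_add_neg] at k
    have n1 := rayVal_neg m (β • y + -((a : ℂ) • x))
    have n2 := rayVal_neg m (β • y + -x)
    rw [neg_add, neg_neg, add_comm] at n1 n2
    have c1 := add_comm (β • y) ((a : ℂ) • x)
    have c2 := add_comm (β • y) x
    simp only [rayPol, sub_eq_add_neg, ← n1, ← n2, c1, c2] at k2 ⊢
    linarith
  obtain ⟨ω, hω, e⟩ := exists_phase α
  have hww : ω * (starRingEnd ℂ) ω = 1 := by rw [Complex.mul_conj']; simp [hω]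
  have k := real ‖α‖ ((starRingEnd ℂ) ω * β)
  have e1 : α • x + β • y = ω • ((‖α‖ : ℂ) • x + ((starRingEnd ℂ) ω * β) • y) := by
    rw [smul_add, smul_smul, smul_smul, mul_comm ω, ← e, ← mul_assoc, hww, one_mul]
  have e2 : ((starRingEnd ℂ) α * β) • y = (‖α‖ : ℂ) • ((starRingEnd ℂ) ω * β) • y := by
    rw [smul_smul, ← mul_assoc]
    conv_lhs => rw [e, map_mul, Complex.conj_ofReal]
  rw [e1, rayVal_smul, hω, k, e2, hm.rayPol_real_smul h, norm_mul, Complex.norm_conj, hω]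
  ring

end Meas

end Ray

section Ray

variable {H : Type*} [NormedAddCommGroup H] [InnerProductSpace ℂ H] [CompleteSpace H]

open InnerProductSpace

theorem exists_unit_orthogonal (hd : 2 < Module.finrank ℂ H) (x y : H) :
    ∃ u : H, ‖u‖ = 1 ∧ ⟪x, u⟫_ℂ = 0 ∧ ⟪y, u⟫_ℂ = 0 := by
  have : FiniteDimensional ℂ H := Module.finite_of_finrank_pos (by omega)
  have h1 : Module.finrank ℂ (Submodule.span ℂ ({x, y} : Set H)) ≤ 2 := by
    classical
    have := finrank_span_finset_le_card (R := ℂ) ({x, y} : Finset H)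
    have h2 := Finset.card_le_two (a := x) (b := y)
    simp only [Finset.coe_pair] at this
    exact this.trans h2
  have h2 := Submodule.finrank_add_finrank_orthogonal (Submodule.span ℂ ({x, y} : Set H))
  have h3 : (Submodule.span ℂ ({x, y} : Set H))ᗮ ≠ ⊥ := by
    intro h
    rw [h, finrank_bot] at h2
    omega
  obtain ⟨u, hu, hu0⟩ := Submodule.exists_mem_ne_zero_of_ne_bot h3
  rw [Submodule.mem_orthogonal] at hu
  have hx := hu x (Submodule.subset_span (by simp))
  have hy := hu y (Submodule.subset_span (by simp))
  exact ⟨((‖u‖ : ℂ)⁻¹) • u, norm_smul_inv_norm hu0, by simp [inner_smul_right, hx],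
    by simp [inner_smul_right, hy]⟩

theorem exists_ortho3 (hd : 2 < Module.finrank ℂ H) (x y : H) :
    ∃ (e f g : H) (s : ℝ) (α β : ℂ), Ortho3 e f g ∧ x = (s : ℂ) • e ∧ y = α • e + β • f := by
  obtain ⟨e, he, s, hs⟩ : ∃ e : H, ‖e‖ = 1 ∧ ∃ s : ℝ, x = (s : ℂ) • e := by
    by_cases hx : x = 0
    · obtain ⟨u, hu, -⟩ := exists_unit_orthogonal hd (0 : H) 0
      exact ⟨u, hu, 0, by simp [hx]⟩
    · have : (‖x‖ : ℂ) ≠ 0 := by simpa using hx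
      exact ⟨((‖x‖ : ℂ)⁻¹) • x, norm_smul_inv_norm hx, ‖x‖, by
        rw [smul_smul, mul_inv_cancel₀ this, one_smul]⟩
  have hee : ⟪e, e⟫_ℂ = 1 := by rw [inner_self_eq_norm_sq_to_K, he]; simp
  set w := y - ⟪e, y⟫_ℂ • e with hw
  have hew : ⟪e, w⟫_ℂ = 0 := by
    rw [hw, inner_sub_right, inner_smul_right, hee, mul_one, sub_self]
  obtain ⟨f, hf, hef, t, ht⟩ : ∃ f : H, ‖f‖ = 1 ∧ ⟪e, f⟫_ℂ = 0 ∧ ∃ t : ℂ, w = t • f := by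
    by_cases hx : w = 0
    · obtain ⟨u, hu, hu', -⟩ := exists_unit_orthogonal hd e 0
      exact ⟨u, hu, hu', 0, by simp [hx]⟩
    · have : (‖w‖ : ℂ) ≠ 0 := by simpa using hx
      exact ⟨((‖w‖ : ℂ)⁻¹) • w, norm_smul_inv_norm hx, by rw [inner_smul_right, hew, mul_zero],
        ‖w‖, by rw [smul_smul, mul_inv_cancel₀ this, one_smul]⟩
  obtain ⟨g, hg, heg, hfg⟩ := exists_unit_orthogonal hd e f
  exact ⟨e, f, g, s, ⟪e, y⟫_ℂ, t, ⟨he, hf, hg, hef, heg, hfg⟩, hs, by rw [← ht, hw]; abel⟩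

section Meas

variable {m : (H →L[ℂ] H) → ℝ} {M : ℝ}

theorem IsProjMeasure.rayVal_combs (hm : IsProjMeasure m M) {e f g : H} (h : Ortho3 e f g) (s : ℝ)
    (α β : ℂ) :
    rayVal m ((s : ℂ) • e + (α • e + β • f)) =
      ‖(s : ℂ) + α‖ ^ 2 * rayVal m e + ‖β‖ ^ 2 * rayVal m f +
      1 / 2 * (s * rayPol m e (β • f) + rayPol m e (((starRingEnd ℂ) α * β) • f)) ∧
    rayVal m ((s : ℂ) • e - (α • e + β • f)) =
      ‖(s : ℂ) - α‖ ^ 2 * rayVal m e + ‖β‖ ^ 2 * rayVal m f +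
      1 / 2 * (-(s * rayPol m e (β • f)) + rayPol m e (((starRingEnd ℂ) α * β) • f)) := by
  have e1 : (s : ℂ) • e + (α • e + β • f) = ((s : ℂ) + α) • e + β • f := by module
  have e2 : (s : ℂ) • e - (α • e + β • f) = ((s : ℂ) - α) • e + (-β) • f := by module
  have e3 : (starRingEnd ℂ) ((s : ℂ) + α) * β = s * β + (starRingEnd ℂ) α * β := by
    rw [map_add, Complex.conj_ofReal]; ring
  have e4 : (starRingEnd ℂ) ((s : ℂ) - α) * -β = -(s * β) + (starRingEnd ℂ) α * β := by
    rw [map_sub, Complex.conj_ofReal]; ring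
  rw [e1, e2, hm.rayVal_comb h, hm.rayVal_comb h, e3, e4, hm.rayPol_coeff_add h,
    hm.rayPol_coeff_add h, neg_smul, rayPol_neg, mul_smul, hm.rayPol_real_smul h, norm_neg]
  exact ⟨rfl, rfl⟩

theorem IsProjMeasure.rayVal_parallelogram (hm : IsProjMeasure m M)
    (hd : 2 < Module.finrank ℂ H) (x y : H) :
    rayVal m (x + y) + rayVal m (x - y) = 2 * rayVal m x + 2 * rayVal m y := by
  obtain ⟨e, f, g, s, α, β, h, rfl, rfl⟩ := exists_ortho3 hd x y
  obtain ⟨k1, k2⟩ := hm.rayVal_combs h s α β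
  rw [k1, k2, hm.rayVal_comb h, rayVal_smul]
  have h2 : ‖(s : ℂ) + α‖ ^ 2 + ‖(s : ℂ) - α‖ ^ 2 = 2 * ‖(s : ℂ)‖ ^ 2 + 2 * ‖α‖ ^ 2 := by
    simp only [← Complex.normSq_eq_norm_sq, Complex.normSq_apply]
    simp
    ring
  linear_combination rayVal m e * h2

theorem IsProjMeasure.rayPol_smul (hm : IsProjMeasure m M)
    (hd : 2 < Module.finrank ℂ H) (x y : H) (t : ℝ) :
    rayPol m x ((t : ℂ) • y) = t * rayPol m x y := by
  obtain ⟨e, f, g, s, α, β, h, rfl, rfl⟩ := exists_ortho3 hd x y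
  obtain ⟨k1, k2⟩ := hm.rayVal_combs h s α β
  obtain ⟨k3, k4⟩ := hm.rayVal_combs h s (t * α) (t * β)
  have e1 : (t : ℂ) • (α • e + β • f) = ((t : ℂ) * α) • e + ((t : ℂ) * β) • f := by module
  rw [rayPol, rayPol, k1, k2, e1, k3, k4, mul_smul (t : ℂ), hm.rayPol_real_smul h]
  have h2 : ‖(s : ℂ) + t * α‖ ^ 2 - ‖(s : ℂ) - t * α‖ ^ 2 =
      t * (‖(s : ℂ) + α‖ ^ 2 - ‖(s : ℂ) - α‖ ^ 2) := by
    simp only [← Complex.normSq_eq_norm_sq, Complex.normSq_apply]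
    simp
    ring
  linear_combination rayVal m e * h2

theorem rayPol_comm (m : (H →L[ℂ] H) → ℝ) (x y : H) : rayPol m x y = rayPol m y x := by
  rw [rayPol, rayPol, add_comm, ← neg_sub x y, rayVal_neg]

theorem IsProjMeasure.rayPol_add_right (hm : IsProjMeasure m M)
    (hd : 2 < Module.finrank ℂ H) (u x y : H) :
    rayPol m u (x + y) = rayPol m u x + rayPol m u y := by
  have hp := hm.rayVal_parallelogram hd
  have e1 := hp (u + x) y
  have e2 := hp (u - x) y
  have e3 := hp (u + y) x
  have e4 := hp (u - y) x
  have r1 : u + x + y = u + (x + y) := by abel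
  have r2 : u - x - y = u - (x + y) := by abel
  have r3 : u + y + x = u + (x + y) := by abel
  have r4 : u - y - x = u - (x + y) := by abel
  have r5 : u - x + y = u + y - x := by abel
  have r6 : u - y + x = u + x - y := by abel
  rw [r1] at e1
  rw [r2, r5] at e2
  rw [r3] at e3
  rw [r4, r6] at e4
  simp only [rayPol]
  linarith

theorem IsProjMeasure.rayPol_complex_smul (hm : IsProjMeasure m M)
    (hd : 2 < Module.finrank ℂ H) (x y : H) (c : ℂ) :
    rayPol m x (c • y) = rayPol m ((starRingEnd ℂ) c • x) y := by
  obtain ⟨ω, hω, e⟩ := exists_phase c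
  have hww : ω * (starRingEnd ℂ) ω = 1 := by rw [Complex.mul_conj']; simp [hω]
  have k : ∀ y, rayPol m x (ω • y) = rayPol m ((starRingEnd ℂ) ω • x) y := by
    intro y
    have e1 : x + ω • y = ω • ((starRingEnd ℂ) ω • x + y) := by
      rw [smul_add, smul_smul, hww, one_smul]
    have e2 : x - ω • y = ω • ((starRingEnd ℂ) ω • x - y) := by
      rw [smul_sub, smul_smul, hww, one_smul]
    rw [rayPol, rayPol, e1, e2, rayVal_smul, rayVal_smul, hω]
    ring
  rw [e, mul_smul, hm.rayPol_smul hd, k, map_mul, Complex.conj_ofReal, mul_smul, rayPol_comm m _ y,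
    rayPol_comm m _ y, hm.rayPol_smul hd]

theorem isStarProjection_sum {A ι : Type*} [NonUnitalRing A] [StarRing A] {m : A → ℝ}
    (hm : ∀ p q, IsStarProjection p → IsStarProjection q → p * q = 0 → m (p + q) = m p + m q)
    (q : ι → A) (hq : ∀ i, IsStarProjection (q i)) (ho : ∀ i j, i ≠ j → q i * q j = 0)
    (s : Finset ι) :
    IsStarProjection (∑ i ∈ s, q i) ∧ m (∑ i ∈ s, q i) = ∑ i ∈ s, m (q i) := by
  classical
  induction s using Finset.induction_on with
  | empty =>
    have := hm 0 0 (.zero A) (.zero A) (by simp)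
    simp only [add_zero] at this
    simp [IsStarProjection.zero]
    linarith
  | insert a s ha ih =>
    have h0 : q a * ∑ i ∈ s, q i = 0 := by
      rw [Finset.mul_sum]
      exact Finset.sum_eq_zero fun i hi => ho _ _ fun h => ha (h ▸ hi)
    rw [Finset.sum_insert ha, Finset.sum_insert ha, hm _ _ (hq a) ih.1 h0, ih.2]
    exact ⟨(hq a).add ih.1 h0, rfl⟩

/-- Gleason's theorem for bounded real measures in finite dimension. -/
theorem IsProjMeasure.exists_clm_of_finrank (hm : IsProjMeasure m M)
    (hd : 2 < Module.finrank ℂ H) :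
    ∃ L : (H →L[ℂ] H) →L[ℝ] ℝ, ∀ p, IsStarProjection p → m p = L p := by
  have : FiniteDimensional ℂ H := Module.finite_of_finrank_pos (by omega)
  let b := stdOrthonormalBasis ℂ H
  have hlin : ∀ (x : H) (t : ℝ) (y : H), rayPol m x (t • y) = t * rayPol m x y := by
    intro x t y
    rw [← Complex.coe_smul, hm.rayPol_smul hd]
  let ℓ : (H →L[ℂ] H) →ₗ[ℝ] ℝ :=
    { toFun := fun T => ∑ i, rayPol m (b i) (T (b i)) / 4
      map_add' := fun S T => by
        rw [← Finset.sum_add_distrib]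
        refine Finset.sum_congr rfl fun i _ => ?_
        rw [add_apply, hm.rayPol_add_right hd, add_div]
      map_smul' := fun c T => by
        simp only [RingHom.id_apply, smul_eq_mul]
        rw [Finset.mul_sum]
        refine Finset.sum_congr rfl fun i _ => ?_
        rw [smul_apply, hlin, mul_div_assoc] }
  have hℓ : ∀ f : H, ℓ (rankOne ℂ f f) = rayVal m f := by
    intro f
    change ∑ i, rayPol m (b i) (rankOne ℂ f f (b i)) / 4 = _
    have h1 : ∀ i, rayPol m (b i) (rankOne ℂ f f (b i)) = rayPol m f (⟪b i, f⟫_ℂ • b i) := by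
      intro i
      rw [rankOne_apply, hm.rayPol_complex_smul hd, inner_conj_symm, rayPol_comm]
    simp only [h1]
    rw [← Finset.sum_div]
    let g : H →+ ℝ := AddMonoidHom.mk' (rayPol m f) (hm.rayPol_add_right hd f)
    have h2 : ∑ i, rayPol m f (⟪b i, f⟫_ℂ • b i) = rayPol m f f := by
      change ∑ i, g (⟪b i, f⟫_ℂ • b i) = g f
      rw [← map_sum, b.sum_repr']
    have h0 : rayVal m (0 : H) = 0 := by simp [rayVal]
    have h3 := rayVal_smul m 2 f
    rw [h2, rayPol, sub_self, h0, ← two_smul ℂ f, h3]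
    norm_num
  have : FiniteDimensional ℂ (H →L[ℂ] H) := inferInstance
  have : FiniteDimensional ℝ (H →L[ℂ] H) := FiniteDimensional.complexToReal _
  refine ⟨LinearMap.toContinuousLinearMap ℓ, fun p hp => ?_⟩
  change m p = ℓ p
  obtain ⟨U, _, rfl⟩ := isStarProjection_iff_eq_starProjection.1 hp
  let c := stdOrthonormalBasis ℂ U
  have hc : ∀ i, ‖(c i : H)‖ = 1 := fun i => by
    rw [← Submodule.coe_norm]; exact c.orthonormal.1 i
  rw [c.starProjection_eq_sum_rankOne, map_sum,
    (isStarProjection_sum hm.add _ (fun i => isStarProjection_rankOne_self (hc i)) (fun i j hij => ?_) _).2]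
  · refine Finset.sum_congr rfl fun i _ => ?_
    rw [hℓ, rayVal, hc]
    simp
  · rw [ContinuousLinearMap.mul_def, rankOne_comp_rankOne, ← Submodule.coe_inner,
      c.orthonormal.2 hij, zero_smul]

end Meas

end Ray

section Hilbert

variable {H : Type*} [NormedAddCommGroup H] [InnerProductSpace ℂ H] [CompleteSpace H]

/-- The range projection of an operator. -/
theorem exists_rangeProj (X : H →L[ℂ] H) :
    ∃ r : H →L[ℂ] H, IsStarProjection r ∧ r * X = X ∧ ∀ Y : H →L[ℂ] H, Y * X = 0 → Y * r = 0 := by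
  set K := (LinearMap.range (X : H →ₗ[ℂ] H)).topologicalClosure with hK
  have : CompleteSpace K := (Submodule.isClosed_topologicalClosure _).completeSpace_coe
  refine ⟨K.starProjection, isStarProjection_starProjection, ?_, fun Y hY => ?_⟩
  · ext x
    exact Submodule.starProjection_eq_self_iff.2
      (Submodule.le_topologicalClosure _ (LinearMap.mem_range_self _ x))
  · have h1 : K ≤ LinearMap.ker (Y : H →ₗ[ℂ] H) := by
      refine Submodule.topologicalClosure_minimal _ ?_ Y.isClosed_ker
      rintro _ ⟨x, rfl⟩
      exact congrArg (fun T : H →L[ℂ] H => T x) hY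
    ext x
    exact h1 (K.starProjection_apply_mem x)

variable {ι : Type*} (b : HilbertBasis ι ℂ H)

theorem HilbertBasis.eq_zero_of_inner (b : HilbertBasis ι ℂ H) {x : H} (h : ∀ i, ⟪b i, x⟫_ℂ = 0) :
    x = 0 := by
  apply b.repr.injective
  ext i
  rw [b.repr_apply_apply, h]
  simp

theorem HilbertBasis.ext_inner (b : HilbertBasis ι ℂ H) {X Y : H →L[ℂ] H}
    (h : ∀ i j, ⟪b i, X (b j)⟫_ℂ = ⟪b i, Y (b j)⟫_ℂ) : X = Y := by
  refine ContinuousLinearMap.ext_on (s := Set.range b) ?_ ?_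
  · have := b.dense_span
    rw [← Submodule.dense_iff_topologicalClosure_eq_top] at this
    exact this
  · rintro _ ⟨j, rfl⟩
    rw [← sub_eq_zero]
    refine b.eq_zero_of_inner fun i => ?_
    rw [inner_sub_right, h, sub_self]

theorem HilbertBasis.exists_isometry (b : HilbertBasis ι ℂ H) {v : ι → H} (hv : Orthonormal ℂ v) :
    ∃ V : H →L[ℂ] H, star V * V = 1 ∧ ∀ i, V (b i) = v i := by
  classical
  refine ⟨(hv.orthogonalFamily.linearIsometry.comp b.repr.toLinearIsometry).toContinuousLinearMap,
    ?_, fun i => ?_⟩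
  · exact (ContinuousLinearMap.norm_map_iff_adjoint_comp_self _).1 fun x =>
      LinearIsometry.norm_map _ x
  · simp [b.repr_self, OrthogonalFamily.linearIsometry_apply_single]

/-- Orthogonal copies of the whole space indexed by a set absorbed by the index of the basis. -/
theorem HilbertBasis.exists_orthIsos (b : HilbertBasis ι ℂ H) {κ : Type*} [DecidableEq κ]
    (e : ι × κ ≃ ι) : ∃ S : κ → H →L[ℂ] H, OrthIsos S ∧ ∀ k i, S k (b i) = b (e (i, k)) := by
  have hS : ∀ k, ∃ V : H →L[ℂ] H, star V * V = 1 ∧ ∀ i, V (b i) = b (e (i, k)) := fun k =>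
    b.exists_isometry (b.orthonormal.comp _ fun i j hij => by simpa using hij)
  choose S hS1 hS2 using hS
  refine ⟨S, fun k l => ?_, hS2⟩
  classical
  split_ifs with hkl
  · subst hkl; exact hS1 k
  · refine b.ext_inner fun i j => ?_
    rw [ContinuousLinearMap.star_eq_adjoint, mul_apply_eq_comp,
      ContinuousLinearMap.adjoint_inner_right, hS2, hS2, orthonormal_iff_ite.1 b.orthonormal]
    simp [hkl]

theorem HilbertBasis.sum_orthIsos (b : HilbertBasis ι ℂ H) {κ : Type*} [DecidableEq κ] [Fintype κ]
    (e : ι × κ ≃ ι) {S : κ → H →L[ℂ] H} (hS : ∀ k i, S k (b i) = b (e (i, k))) :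
    ∑ k, S k * star (S k) = 1 := by
  classical
  have hadj : ∀ k l i, star (S k) (b (e (i, l))) = if k = l then b i else 0 := by
    intro k l i
    rw [← sub_eq_zero]
    refine b.eq_zero_of_inner fun j => ?_
    rw [inner_sub_right, ContinuousLinearMap.star_eq_adjoint,
      ContinuousLinearMap.adjoint_inner_right, hS, orthonormal_iff_ite.1 b.orthonormal]
    by_cases hkl : k = l
    · simp [hkl, orthonormal_iff_ite.1 b.orthonormal]
    · simp [hkl]
  refine b.ext_inner fun i j => ?_
  congr 1
  obtain ⟨⟨j, l⟩, rfl⟩ := e.surjective j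
  rw [sum_apply, Finset.sum_eq_single l]
  · rw [mul_apply_eq_comp, hadj, if_pos rfl, hS]; simp
  · intro k _ hk
    rw [mul_apply_eq_comp, hadj, if_neg hk, map_zero]
  · simp

theorem exists_unit_orthogonal_family (b : HilbertBasis ι ℂ H) (hinf : ¬ FiniteDimensional ℂ H)
    {J : Type*} (g : J → H) (hJ : Finite J ∨ ¬ ∃ f : ι → J × ℕ, Function.Injective f) :
    ∃ x : H, ‖x‖ = 1 ∧ ∀ j, ⟪g j, x⟫_ℂ = 0 := by
  suffices h : ∃ x : H, x ≠ 0 ∧ ∀ j, ⟪g j, x⟫_ℂ = 0 by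
    obtain ⟨x, hx, h⟩ := h
    exact ⟨((‖x‖ : ℂ)⁻¹) • x, norm_smul_inv_norm hx, fun j => by simp [inner_smul_right, h]⟩
  by_contra hcon
  push Not at hcon
  rcases hJ with hJ | hJ
  · apply hinf
    have h1 : FiniteDimensional ℂ (Submodule.span ℂ (Set.range g)) :=
      FiniteDimensional.span_of_finite ℂ (Set.finite_range g)
    have h2 : Submodule.span ℂ (Set.range g) = ⊤ := by
      rw [← Submodule.orthogonal_eq_bot_iff, Submodule.eq_bot_iff]
      intro x hx
      by_contra hx0
      obtain ⟨j, hj⟩ := hcon x hx0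
      exact hj ((Submodule.mem_orthogonal _ _).1 hx _ (Submodule.subset_span ⟨j, rfl⟩))
    rw [h2] at h1
    exact Module.Finite.equiv (Submodule.topEquiv (R := ℂ) (M := H))
  · apply hJ
    have h1 : ∀ i, ∃ j, ⟪g j, b i⟫_ℂ ≠ 0 := fun i => hcon _ (b.orthonormal.ne_zero i)
    choose φ hφ using h1
    have h2 : ∀ j, ∃ f : {i // ⟪g j, b i⟫_ℂ ≠ 0} → ℕ, Function.Injective f := by
      intro j
      have hs := (b.summable_inner_mul_inner (g j) (g j)).norm.countable_support
      have : Countable {i // ⟪g j, b i⟫_ℂ ≠ 0} := by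
        refine Set.Countable.to_subtype (hs.mono ?_)
        intro i hi
        have hi' : ⟪g j, b i⟫_ℂ ≠ 0 := hi
        simp only [Function.mem_support, norm_mul]
        rw [norm_inner_symm (b i)]
        exact mul_self_ne_zero.2 (norm_ne_zero_iff.2 hi')
      exact Countable.exists_injective_nat _
    choose f hf using h2
    refine ⟨fun i => (φ i, f (φ i) ⟨i, hφ i⟩), fun i k hik => ?_⟩
    simp only [Prod.mk.injEq] at hik
    obtain ⟨e1, e2⟩ := hik
    have : ∀ j (h : j = φ k) (hj : ⟪g j, b i⟫_ℂ ≠ 0), f j ⟨i, hj⟩ = f (φ k) ⟨k, hφ k⟩ → i = k := by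
      intro j h hj hh
      subst h
      exact congrArg Subtype.val (hf _ hh)
    exact this _ e1 _ e2

theorem nonempty_embedding_prod_nat (T : Type*) [Infinite T] : Nonempty (T × ℕ ↪ T) := by
  have h : Cardinal.mk (T × ℕ) ≤ Cardinal.mk T := by
    simp only [Cardinal.mk_prod, Cardinal.mk_nat, Cardinal.lift_aleph0, Cardinal.lift_uzero]
    rw [Cardinal.mul_aleph0_eq (Cardinal.aleph0_le_mk T)]
  exact h

/-- Finitely many operators on an infinite-dimensional space vanish between suitable copies of the
space. -/
theorem exists_isometries_annihilating (b : HilbertBasis ι ℂ H) (hinf : ¬ FiniteDimensional ℂ H)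
    {n : ℕ} (c : Fin n → H →L[ℂ] H) :
    ∃ V V' : H →L[ℂ] H, star V * V = 1 ∧ star V' * V' = 1 ∧ ∀ j, star V' * c j * V = 0 := by
  classical
  let P : Set (Set (H × H)) := {T | (∀ s ∈ T, ∀ t ∈ T, ⟪s.1, t.1⟫_ℂ = if s = t then 1 else 0) ∧
    (∀ s ∈ T, ∀ t ∈ T, ⟪s.2, t.2⟫_ℂ = if s = t then 1 else 0) ∧
    ∀ s ∈ T, ∀ t ∈ T, ∀ j, ⟪s.2, c j t.1⟫_ℂ = 0}
  obtain ⟨T, hT⟩ : ∃ T, Maximal (· ∈ P) T := by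
    refine zorn_subset P fun C hC hchain => ⟨⋃₀ C, ?_, fun s hs => Set.subset_sUnion_of_mem hs⟩
    have key : ∀ s ∈ ⋃₀ C, ∀ t ∈ ⋃₀ C, ∃ D ∈ C, s ∈ D ∧ t ∈ D := by
      rintro s ⟨D, hD, hs⟩ t ⟨D', hD', ht⟩
      rcases hchain.total hD hD' with h | h
      · exact ⟨D', hD', h hs, ht⟩
      · exact ⟨D, hD, hs, h ht⟩
    refine ⟨fun s hs t ht => ?_, fun s hs t ht => ?_, fun s hs t ht => ?_⟩ <;>
      obtain ⟨D, hD, h1, h2⟩ := key s hs t ht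
    · exact (hC hD).1 s h1 t h2
    · exact (hC hD).2.1 s h1 t h2
    · exact (hC hD).2.2 s h1 t h2
  have hTP : T ∈ P := hT.1
  obtain ⟨f, hf⟩ : ∃ f : ι → T, Function.Injective f := by
    by_contra hcon
    let K := Option (Fin n) ⊕ Fin n
    have hJ : Finite ((T × K) ⊕ K) ∨ ¬ ∃ f : ι → ((T × K) ⊕ K) × ℕ, Function.Injective f := by
      rcases finite_or_infinite T with hfin | hin
      · left; infer_instance
      · right
        rintro ⟨f, hf⟩
        obtain ⟨g⟩ := nonempty_embedding_prod_nat T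
        obtain ⟨code, hcode⟩ := Countable.exists_injective_nat K
        obtain ⟨t0⟩ : Nonempty T := inferInstance
        refine hcon ⟨fun i => g (match f i with
          | (Sum.inl (t, k), m) => (t, Nat.pair (2 * code k) m)
          | (Sum.inr k, m) => (t0, Nat.pair (2 * code k + 1) m)), fun i i' h => hf ?_⟩
        have h' := g.injective h
        rcases hfi : f i with ⟨⟨t, k⟩ | k, m⟩ <;> rcases hfi' : f i' with ⟨⟨t', k'⟩ | k', m'⟩ <;>
          simp only [hfi, hfi', Prod.mk.injEq, Nat.pair_eq_pair] at h'
        · obtain ⟨rfl, h1, rfl⟩ := h'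
          rw [hcode (show code k = code k' by omega)]
        · omega
        · omega
        · obtain ⟨-, h1, rfl⟩ := h'
          rw [hcode (show code k = code k' by omega)]
    obtain ⟨x, hx1, hx⟩ := exists_unit_orthogonal_family b hinf (J := (T × K) ⊕ K) (fun
      | Sum.inl (t, Sum.inl none) => t.1.1
      | Sum.inl (t, Sum.inl (some j)) => star (c j) t.1.2
      | _ => 0) hJ
    obtain ⟨y, hy1, hy⟩ := exists_unit_orthogonal_family b hinf (J := (T × K) ⊕ K) (fun
      | Sum.inl (t, Sum.inl none) => t.1.2
      | Sum.inl (t, Sum.inl (some j)) => c j t.1.1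
      | Sum.inr (Sum.inr j) => c j x
      | _ => 0) hJ
    have hx2 : ∀ t ∈ T, ⟪t.1, x⟫_ℂ = 0 := fun t ht => hx (Sum.inl (⟨t, ht⟩, Sum.inl none))
    have hx3 : ∀ t ∈ T, ∀ j, ⟪t.2, c j x⟫_ℂ = 0 := fun t ht j => by
      have := hx (Sum.inl (⟨t, ht⟩, Sum.inl (some j)))
      simpa [ContinuousLinearMap.star_eq_adjoint, ContinuousLinearMap.adjoint_inner_left] using this
    have hy2 : ∀ t ∈ T, ⟪t.2, y⟫_ℂ = 0 := fun t ht => hy (Sum.inl (⟨t, ht⟩, Sum.inl none))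
    have hy3 : ∀ t ∈ T, ∀ j, ⟪y, c j t.1⟫_ℂ = 0 := fun t ht j => by
      rw [← inner_conj_symm, hy (Sum.inl (⟨t, ht⟩, Sum.inl (some j))), map_zero]
    have hy4 : ∀ j, ⟪y, c j x⟫_ℂ = 0 := fun j => by
      rw [← inner_conj_symm, hy (Sum.inr (Sum.inr j)), map_zero]
    have hxx : ⟪x, x⟫_ℂ = 1 := by simp [inner_self_eq_norm_sq_to_K, hx1]
    have hyy : ⟪y, y⟫_ℂ = 1 := by simp [inner_self_eq_norm_sq_to_K, hy1]
    have hnot : (x, y) ∉ T := fun h => one_ne_zero (hxx.symm.trans (hx2 _ h))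
    have hnot' : ∀ t ∈ T, (x, y) ≠ t := fun t ht h => hnot (h ▸ ht)
    have hmem : insert (x, y) T ∈ P := by
      refine ⟨fun s hs t ht => ?_, fun s hs t ht => ?_, fun s hs t ht j => ?_⟩ <;>
        rcases hs with rfl | hs <;> rcases ht with rfl | ht
      · rw [if_pos rfl]; exact hxx
      · rw [if_neg (hnot' _ ht), ← inner_conj_symm, hx2 _ ht, map_zero]
      · rw [if_neg (hnot' _ hs).symm, hx2 _ hs]
      · exact hTP.1 _ hs _ ht
      · rw [if_pos rfl]; exact hyy
      · rw [if_neg (hnot' _ ht), ← inner_conj_symm, hy2 _ ht, map_zero]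
      · rw [if_neg (hnot' _ hs).symm, hy2 _ hs]
      · exact hTP.2.1 _ hs _ ht
      · exact hy4 j
      · exact hy3 _ ht j
      · exact hx3 _ hs j
      · exact hTP.2.2 _ hs _ ht j
    exact hnot (hT.2 hmem (Set.subset_insert _ _) (Set.mem_insert _ _))
  have hne : ∀ i k, f i = f k ↔ i = k := fun i k => hf.eq_iff
  have hne' : ∀ i k, (f i : H × H) = f k ↔ i = k := fun i k => by rw [Subtype.coe_inj, hne]
  obtain ⟨V, hV, hVb⟩ := b.exists_isometry (v := fun i => (f i : H × H).1) (by
    rw [orthonormal_iff_ite]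
    intro i k
    rw [hTP.1 _ (f i).2 _ (f k).2]
    simp only [hne'])
  obtain ⟨V', hV', hVb'⟩ := b.exists_isometry (v := fun i => (f i : H × H).2) (by
    rw [orthonormal_iff_ite]
    intro i k
    rw [hTP.2.1 _ (f i).2 _ (f k).2]
    simp only [hne'])
  refine ⟨V, V', hV, hV', fun j => b.ext_inner fun i k => ?_⟩
  rw [mul_assoc, ContinuousLinearMap.star_eq_adjoint, mul_apply_eq_comp,
    ContinuousLinearMap.adjoint_inner_right, mul_apply_eq_comp, hVb, hVb',
    hTP.2.2 _ (f i).2 _ (f k).2]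
  simp

end Hilbert

section Density

variable {A : Type*} [CStarAlgebra A] [PartialOrder A] [StarOrderedRing A]

/-- Every element has a smallest projection fixing it on the left. -/
def HasRangeProj (A : Type*) [CStarAlgebra A] : Prop :=
  ∀ X : A, ∃ r : A, IsStarProjection r ∧ r * X = X ∧ ∀ Y : A, Y * X = 0 → Y * r = 0

theorem IsSelfAdjoint.eq_mul_of_eq_mul {q x : A} (hq : IsStarProjection q) (hx : IsSelfAdjoint x)
    (h : q * x = x) : x * q = x := by
  have := congrArg star h
  rwa [star_mul, hx.star_eq, hq.isSelfAdjoint.star_eq] at this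

theorem IsSelfAdjoint.le_one_of_norm_le_one {x : A} (hx : IsSelfAdjoint x) (h : ‖x‖ ≤ 1) :
    x ≤ 1 := by
  refine (IsSelfAdjoint.le_algebraMap_norm_self hx).trans ?_
  rw [← map_one (algebraMap ℝ A), ← sub_nonneg, ← map_sub, Algebra.algebraMap_eq_smul_one]
  exact smul_nonneg (sub_nonneg.2 h) zero_le_one

theorem conj_mul_nonneg {a e : A} (ha : 0 ≤ a) (he : IsSelfAdjoint e) : 0 ≤ e * a * e := by
  have := star_right_conjugate_nonneg ha e
  rwa [he.star_eq] at this

theorem HasRangeProj.exists_halving (hRP : HasRangeProj A) {q a : A} (hq : IsStarProjection q)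
    (ha0 : 0 ≤ a) (ha1 : a ≤ 1) (hqa : q * a = a) :
    ∃ e : A, IsStarProjection e ∧ q * e = e ∧ 0 ≤ (2 : ℝ) • a - e ∧ (2 : ℝ) • a - e ≤ 1 := by
  have hasa : IsSelfAdjoint a := .of_nonneg ha0
  have haq : a * q = a := hasa.eq_mul_of_eq_mul hq hqa
  set X : A := a - (1 / 2 : ℝ) • q with hX
  have hXsa : IsSelfAdjoint X := hasa.sub ((IsSelfAdjoint.all (1 / 2 : ℝ)).smul hq.isSelfAdjoint)
  have hqX : q * X = X := by
    rw [hX, mul_sub, hqa, mul_smul_comm, hq.isIdempotentElem.eq]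
  obtain ⟨P, N, hP, hN, hPN, hXPN⟩ : ∃ P N : A, 0 ≤ P ∧ 0 ≤ N ∧ P * N = 0 ∧ P - N = X :=
    ⟨X⁺, X⁻, CFC.posPart_nonneg X, CFC.negPart_nonneg X, CFC.posPart_mul_negPart X,
      CFC.posPart_sub_negPart X hXsa⟩
  have hPsa : IsSelfAdjoint P := .of_nonneg hP
  have hNsa : IsSelfAdjoint N := .of_nonneg hN
  have hNP : N * P = 0 := by
    have := congrArg star hPN
    rwa [star_mul, hPsa.star_eq, hNsa.star_eq, star_zero] at this
  obtain ⟨e, he, heP, hker⟩ := hRP P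
  have hesa := he.isSelfAdjoint
  have hee : e * e = e := he.isIdempotentElem
  have hqq : q * q = q := hq.isIdempotentElem
  have hqP : (1 - q) * P = 0 := by
    have h1 : P * P = X * P := by rw [← hXPN, sub_mul, hNP, sub_zero]
    have h2 : ((1 - q) * P) * star ((1 - q) * P) = 0 := by
      rw [star_mul, hPsa.star_eq, mul_assoc, ← mul_assoc P, h1, ← mul_assoc, ← mul_assoc,
        sub_mul, one_mul, hqX]
      simp
    exact CStarRing.mul_star_self_eq_zero_iff _ |>.1 h2
  have hqe : q * e = e := by
    have := hker _ hqP
    rw [sub_mul, one_mul, sub_eq_zero] at this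
    exact this.symm
  have heq : e * q = e := hesa.eq_mul_of_eq_mul hq hqe
  have hNe : N * e = 0 := hker _ hNP
  have heN : e * N = 0 := by
    have := congrArg star hNe
    rwa [star_mul, hesa.star_eq, hNsa.star_eq, star_zero] at this
  have hPe : P * e = P := hPsa.eq_mul_of_eq_mul he heP
  have haX : a = P - N + (1 / 2 : ℝ) • q := by rw [hXPN, hX]; abel
  refine ⟨e, he, hqe, ?_, ?_⟩
  · have h1 : (1 - e) * a * (1 - e) = (1 / 2 : ℝ) • (q - e) - N := by
      rw [haX]
      simp only [sub_mul, mul_sub, add_mul, mul_add, one_mul, mul_one, smul_mul_assoc,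
        mul_smul_comm, heP, hPe, hNe, heN, hqe, heq, hee,
        zero_mul, mul_zero, smul_zero]
      module
    have h2 : (2 : ℝ) • a - e = (2 : ℝ) • P + (2 : ℝ) • ((1 - e) * a * (1 - e)) := by
      rw [h1, haX]; module
    rw [h2]
    exact add_nonneg (smul_nonneg zero_le_two hP) (smul_nonneg zero_le_two
      (conj_mul_nonneg ha0 ((IsSelfAdjoint.one A).sub hesa)))
  · have h1 : e * (1 - a) * e = (1 / 2 : ℝ) • e - P := by
      rw [haX]
      simp only [sub_mul, mul_sub, add_mul, mul_add, one_mul, mul_one, smul_mul_assoc,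
        mul_smul_comm, heP, hPe, hNe, heN, hqe, heq, hee,
        zero_mul, mul_zero, smul_zero]
      module
    have h2 : 1 - ((2 : ℝ) • a - e) = (2 : ℝ) • N + (1 - q) + (2 : ℝ) • (e * (1 - a) * e) := by
      rw [h1, haX]; module
    rw [← sub_nonneg, h2]
    exact add_nonneg (add_nonneg (smul_nonneg zero_le_two hN) hq.one_sub.nonneg)
      (smul_nonneg zero_le_two (conj_mul_nonneg (sub_nonneg.2 ha1) hesa))

theorem HasRangeProj.abs_le_of_effect (hRP : HasRangeProj A) {q : A} (hq : IsStarProjection q)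
    (L : A →L[ℝ] ℝ) {M : ℝ} (hL : ∀ p, IsStarProjection p → q * p = p → |L p| ≤ M)
    {a : A} (ha0 : 0 ≤ a) (ha1 : a ≤ 1) (hqa : q * a = a) : |L a| ≤ M := by
  have key : ∀ n : ℕ, ∀ a : A, 0 ≤ a → a ≤ 1 → q * a = a → |L a| ≤ M + ‖L‖ * (1 / 2) ^ n := by
    intro n
    induction n with
    | zero =>
      intro a ha0 ha1 _
      have h1 : ‖a‖ ≤ 1 := (CStarAlgebra.norm_le_one_iff_of_nonneg a ha0).2 ha1
      have hM : 0 ≤ M := by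
        have := hL 0 (.zero A) (by simp)
        simpa using this
      have h2 := L.le_opNorm a
      rw [Real.norm_eq_abs] at h2
      have := mul_le_mul_of_nonneg_left h1 (norm_nonneg L)
      simp only [pow_zero]; linarith
    | succ n ih =>
      intro a ha0 ha1 hqa
      obtain ⟨e, he, hqe, h0, h1⟩ := hRP.exists_halving hq ha0 ha1 hqa
      have h2 := ih _ h0 h1 (by rw [mul_sub, mul_smul_comm, hqa, hqe])
      have h3 := hL e he hqe
      have h4 : L a = (L ((2 : ℝ) • a - e) + L e) / 2 := by
        rw [map_sub, map_smul, smul_eq_mul]; ring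
      rw [h4, abs_div, abs_two, div_le_iff₀ two_pos, pow_succ]
      refine (abs_add_le _ _).trans ?_
      linarith
  have hlim : Tendsto (fun n : ℕ => M + ‖L‖ * (1 / 2 : ℝ) ^ n) atTop (𝓝 (M + ‖L‖ * 0)) :=
    tendsto_const_nhds.add (tendsto_const_nhds.mul
      (tendsto_pow_atTop_nhds_zero_of_lt_one (by norm_num) (by norm_num)))
  rw [mul_zero, add_zero] at hlim
  exact ge_of_tendsto' hlim fun n => key n a ha0 ha1 hqa

theorem HasRangeProj.abs_le_of_isSelfAdjoint (hRP : HasRangeProj A) {q : A}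
    (hq : IsStarProjection q) (L : A →L[ℝ] ℝ) {M : ℝ}
    (hL : ∀ p, IsStarProjection p → q * p = p → |L p| ≤ M)
    {x : A} (hx : IsSelfAdjoint x) (hqx : q * x = x) : |L x| ≤ 2 * M * ‖x‖ := by
  have key : ∀ x : A, IsSelfAdjoint x → q * x = x → ‖x‖ ≤ 1 → |L x| ≤ 2 * M := by
    intro x hx hqx hx1
    have hxq := hx.eq_mul_of_eq_mul hq hqx
    have hqq : q * q = q := hq.isIdempotentElem
    have h1 : x ≤ 1 := hx.le_one_of_norm_le_one hx1
    have h2 : -1 ≤ x := by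
      have := hx.neg.le_one_of_norm_le_one (by rwa [norm_neg])
      rwa [neg_le] at this
    have h3 : 0 ≤ q - x := by
      have := conj_mul_nonneg (sub_nonneg.2 h1) hq.isSelfAdjoint
      rwa [mul_sub, mul_one, sub_mul, hqq, hqx, hxq] at this
    have h4 : 0 ≤ q + x := by
      have := conj_mul_nonneg (sub_nonneg.2 h2) hq.isSelfAdjoint
      rwa [mul_sub, mul_neg, mul_one, sub_mul, neg_mul, hqq, hqx, hxq, sub_neg_eq_add,
        add_comm] at this
    have hq1 : q ≤ 1 := hq.le_one
    have half : ∀ y : A, 0 ≤ q - y → 0 ≤ q + y → q * y = y → |L ((1 / 2 : ℝ) • (q + y))| ≤ M := by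
      intro y h5 h6 h7
      refine hRP.abs_le_of_effect hq L hL (smul_nonneg (by norm_num) h6) ?_ ?_
      · have : (1 / 2 : ℝ) • (q + y) = q - (1 / 2 : ℝ) • (q - y) := by module
        rw [this]
        exact (sub_le_self _ (smul_nonneg (by norm_num) h5)).trans hq1
      · rw [mul_smul_comm, mul_add, hqq, h7]
    have h5 := half x h3 h4 hqx
    have h6 := half (-x) (by rwa [sub_neg_eq_add]) (by rwa [← sub_eq_add_neg])
      (by rw [mul_neg, hqx])
    have h7 : L x = L ((1 / 2 : ℝ) • (q + x)) - L ((1 / 2 : ℝ) • (q + -x)) := by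
      rw [← map_sub]; congr 1; module
    rw [h7]
    refine (abs_sub _ _).trans ?_
    linarith
  rcases eq_or_ne x 0 with rfl | hx0
  · simp
  have hn : 0 < ‖x‖ := norm_pos_iff.2 hx0
  have := key (‖x‖⁻¹ • x) ((IsSelfAdjoint.all _).smul hx) (by rw [mul_smul_comm, hqx])
    (by rw [norm_smul, norm_inv, norm_norm, inv_mul_cancel₀ hn.ne'])
  rw [map_smul, smul_eq_mul, abs_mul, abs_inv, abs_norm, inv_mul_le_iff₀ hn] at this
  linarith

theorem HasRangeProj.eq_of_isSelfAdjoint (hRP : HasRangeProj A) {q : A}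
    (hq : IsStarProjection q) (L L' : A →L[ℝ] ℝ)
    (hL : ∀ p, IsStarProjection p → q * p = p → L p = L' p)
    {x : A} (hx : IsSelfAdjoint x) (hqx : q * x = x) : L x = L' x := by
  have := hRP.abs_le_of_isSelfAdjoint hq (L - L') (M := 0)
    (fun p hp hqp => by simp [hL p hp hqp]) hx hqx
  rw [mul_zero, zero_mul] at this
  have := abs_nonpos_iff.1 this
  simpa [sub_eq_zero] using this

end Density

section Infinite

variable {A : Type*} [CStarAlgebra A] [PartialOrder A] [StarOrderedRing A]

/-- Finitely many elements vanish between suitable isometries. -/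
def HasAnnihilatingIsometries (A : Type*) [CStarAlgebra A] : Prop :=
  ∀ (n : ℕ) (c : Fin n → A), ∃ V V' : A, star V * V = 1 ∧ star V' * V' = 1 ∧
    ∀ j, star V' * c j * V = 0

theorem IsProjMeasure.exists_clm_of_infinite {m : A → ℝ} {M : ℝ} (hm : IsProjMeasure m M)
    (hRP : HasRangeProj A) (hAnn : HasAnnihilatingIsometries A) {R : ℕ → A} (hR : OrthIsos R)
    {S : Fin 3 → A} (hS : OrthIsos S) (hsum : ∑ i, S i * star (S i) = 1) :
    ∃ L : A →L[ℝ] ℝ, ∀ p, IsStarProjection p → m p = L p := by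
  set E : Fin 3 → A := fun i => S i * star (S i) with hEdef
  have hSS : ∀ i, star (S i) * S i = 1 := fun i => by simp [hS i i]
  have hSS' : ∀ i j, i ≠ j → star (S i) * S j = 0 := fun i j h => by simp [hS i j, h]
  have hE : ∀ i, IsStarProjection (E i) := fun i => by
    refine ⟨?_, IsSelfAdjoint.mul_star_self _⟩
    change S i * star (S i) * (S i * star (S i)) = S i * star (S i)
    rw [mul_assoc, ← mul_assoc (star (S i)), hSS, one_mul]
  have hEE : ∀ i, E i * E i = E i := fun i => (hE i).isIdempotentElem
  have hEE' : ∀ i j, i ≠ j → E i * E j = 0 := fun i j h => by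
    change S i * star (S i) * (S j * star (S j)) = 0
    rw [mul_assoc, ← mul_assoc (star (S i)), hSS' i j h, zero_mul, mul_zero]
  have hsumE : E 0 + E 1 + E 2 = 1 := by rw [← hsum, Fin.sum_univ_three]
  have hi1 : ∀ i : Fin 3, i ≠ i + 1 := by decide
  have hF : ∀ i, IsStarProjection (E i + E (i + 1)) := fun i =>
    (hE i).add (hE _) (hEE' _ _ (hi1 i))
  have hν : ∀ i, ∃ L : A →L[ℝ] ℝ, ∀ p, IsStarProjection p → (E i + E (i + 1)) * p = p →
      m p = L p := fun i => by
    refine hm.exists_clm_below hR (hF i) (hSS (i + 2)) ?_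
    have h1 : i + 2 ≠ i := by revert i; decide
    have h2 : i + 2 ≠ i + 1 := by revert i; decide
    rw [mul_add, hEdef]
    simp only
    rw [← mul_assoc, ← mul_assoc, hSS' _ _ h1, hSS' _ _ h2, zero_mul, zero_mul, add_zero]
  choose ν hν using hν
  set C : A → A →L[ℝ] A := fun e => ContinuousLinearMap.mulLeftRight ℝ A e e with hC
  have hCa : ∀ e x, C e x = e * x * e := fun e x => by
    simp [hC, ContinuousLinearMap.mulLeftRight_apply]
  refine ⟨∑ i, ((ν i).comp (C (E i + E (i + 1))) - (ν i).comp (C (E i))), ?_⟩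
  set L : A →L[ℝ] ℝ := ∑ i, ((ν i).comp (C (E i + E (i + 1))) - (ν i).comp (C (E i))) with hL
  have hLa : ∀ x, L x = ∑ i, (ν i ((E i + E (i + 1)) * x * (E i + E (i + 1))) -
      ν i (E i * x * E i)) := fun x => by
    simp only [hL, sum_apply, ContinuousLinearMap.sub_apply, ContinuousLinearMap.comp_apply, hCa]
  have core : ∀ p T : A, IsStarProjection p → star T * T = 1 → (∀ i, star T * (E i * p) = 0) →
      m p = L p := by
    intro p T hp hT hTp
    have hqex : ∀ i, ∃ q : A, IsStarProjection q ∧ E i * q = q ∧ star T * q = 0 ∧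
        q * (E i * p) = E i * p := fun i => by
      obtain ⟨q, h1, h2, h3⟩ := hRP (E i * p)
      refine ⟨q, h1, ?_, h3 _ (hTp i), h2⟩
      have := h3 (1 - E i) (by rw [← mul_assoc, sub_mul, one_mul, hEE, sub_self, zero_mul])
      rw [sub_mul, one_mul, sub_eq_zero] at this
      exact this.symm
    choose q hq hEq hTq hqE using hqex
    have hqEi : ∀ i, q i * E i = q i := fun i =>
      (hq i).isSelfAdjoint.eq_mul_of_eq_mul (hE i) (hEq i)
    have hqEj : ∀ i j, i ≠ j → q i * E j = 0 := fun i j h => by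
      rw [← hqEi i, mul_assoc, hEE' i j h, mul_zero]
    have hqq : ∀ i, q i * q i = q i := fun i => (hq i).isIdempotentElem
    have hqq' : ∀ i j, i ≠ j → q i * q j = 0 := fun i j h => by
      rw [← hEq j, ← mul_assoc, hqEj i j h, zero_mul]
    have hqp : ∀ i, q i * p = E i * p := fun i => by
      have h1 : q i = q i * E i := (hqEi i).symm
      rw [← hqE i, ← mul_assoc, hqEi]
    have hE' : IsStarProjection (q 0 + q 1 + q 2) := by
      refine ((hq 0).add (hq 1) (hqq' 0 1 (by decide))).add (hq 2) ?_
      rw [add_mul, hqq' 0 2 (by decide), hqq' 1 2 (by decide), add_zero]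
    have hE'p : (q 0 + q 1 + q 2) * p = p := by
      rw [add_mul, add_mul, hqp, hqp, hqp, ← add_mul, ← add_mul, hsumE, one_mul]
    obtain ⟨N, hN⟩ := hm.exists_clm_below hR hE' hT
      (by rw [mul_add, mul_add, hTq, hTq, hTq, add_zero, add_zero])
    have hG : ∀ i, IsStarProjection (q i + q (i + 1)) := fun i =>
      (hq i).add (hq _) (hqq' _ _ (hi1 i))
    have hE'G : ∀ i, (q 0 + q 1 + q 2) * (q i + q (i + 1)) = q i + q (i + 1) := by
      have h : ∀ i, (q 0 + q 1 + q 2) * q i = q i := by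
        intro i
        have := Finset.sum_eq_single (s := Finset.univ) (f := fun j => q j * q i) i
          (fun j _ hj => hqq' j i hj) (by simp)
        rw [Fin.sum_univ_three, hqq] at this
        rw [add_mul, add_mul, this]
      intro i
      rw [mul_add, h, h]
    have hFG : ∀ i, (E i + E (i + 1)) * (q i + q (i + 1)) = q i + q (i + 1) := by
      intro i
      have h1 : E i * q (i + 1) = 0 := by rw [← hEq, ← mul_assoc, hEE' _ _ (hi1 i), zero_mul]
      have h2 : E (i + 1) * q i = 0 := by rw [← hEq, ← mul_assoc, hEE' _ _ (hi1 i).symm, zero_mul]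
      rw [add_mul, mul_add, mul_add, h1, h2, hEq, hEq]
      abel
    have hagree : ∀ i x, IsSelfAdjoint x → (q i + q (i + 1)) * x = x → N x = ν i x := by
      intro i x hx hGx
      refine hRP.eq_of_isSelfAdjoint (hG i) N (ν i) (fun r hr hGr => ?_) hx hGx
      rw [← hN r hr, hν i r hr]
      · rw [← hGr, ← mul_assoc, hFG]
      · rw [← hGr, ← mul_assoc, hE'G]
    have hGF : ∀ i, (q i + q (i + 1)) * (E i + E (i + 1)) = q i + q (i + 1) := fun i =>
      (hG i).isSelfAdjoint.eq_mul_of_eq_mul (hF i) (hFG i)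
    have h1 : ∀ i, N ((E i + E (i + 1)) * p * (E i + E (i + 1))) =
        ν i ((E i + E (i + 1)) * p * (E i + E (i + 1))) := by
      intro i
      refine hagree i _ ?_ ?_
      · have := hp.isSelfAdjoint.conjugate (E i + E (i + 1))
        rwa [(hF i).isSelfAdjoint.star_eq] at this
      · rw [← mul_assoc, ← mul_assoc, hGF, add_mul (q i), hqp, hqp, ← add_mul]
    have h2 : ∀ i, N (E i * p * E i) = ν i (E i * p * E i) := by
      intro i
      refine hagree i _ ?_ ?_
      · have := hp.isSelfAdjoint.conjugate (E i)
        rwa [(hE i).isSelfAdjoint.star_eq] at this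
      · rw [← mul_assoc _ _ (E i), ← mul_assoc _ (E i) p, add_mul (q i), hqEi, hqEj _ _ (hi1 i).symm, add_zero, hqp]
    rw [hLa, hN p hp hE'p]
    have h3 : p = ∑ i, ((E i + E (i + 1)) * p * (E i + E (i + 1)) - E i * p * E i) := by
      rw [Fin.sum_univ_three]
      have h01 : (0 : Fin 3) + 1 = 1 := rfl
      have h12 : (1 : Fin 3) + 1 = 2 := rfl
      have h20 : (2 : Fin 3) + 1 = 0 := rfl
      rw [h01, h12, h20]
      calc p = (E 0 + E 1 + E 2) * p * (E 0 + E 1 + E 2) := by rw [hsumE, one_mul, mul_one]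
        _ = _ := by noncomm_ring
    conv_lhs => rw [h3]
    rw [map_sum]
    exact Finset.sum_congr rfl fun i _ => by rw [map_sub, h1, h2]
  intro p hp
  have hpp : p * p = p := hp.isIdempotentElem
  obtain ⟨V, V', hV, hV', hVV⟩ := hAnn (3 * 3) (fun n =>
    E (finProdFinEquiv.symm n).1 * p * E (finProdFinEquiv.symm n).2)
  have hVV : ∀ j k, star V' * (E j * p * E k) * V = 0 := fun j k => by
    have := hVV (finProdFinEquiv (j, k))
    rwa [Equiv.symm_apply_apply] at this
  obtain ⟨e', he', heX, hker⟩ := hRP (∑ k, p * E k * V * star (S k))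
  have hXS : ∀ k, (∑ i, p * E i * V * star (S i)) * S k = p * E k * V := by
    intro k
    rw [Finset.sum_mul, Finset.sum_eq_single k]
    · rw [mul_assoc, hSS, mul_one]
    · intro i _ hi
      rw [mul_assoc, hSS' _ _ hi, mul_zero]
    · simp
  have hpe' : p * e' = e' := by
    have := hker (1 - p) (by
      rw [Finset.mul_sum]
      refine Finset.sum_eq_zero fun k _ => ?_
      have : (1 - p) * (p * E k * V * star (S k)) = (p - p * p) * E k * V * star (S k) := by
        noncomm_ring
      rw [this, hpp, sub_self, zero_mul, zero_mul, zero_mul])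
    rw [sub_mul, one_mul, sub_eq_zero] at this
    exact this.symm
  have he'p : e' * p = e' := he'.isSelfAdjoint.eq_mul_of_eq_mul hp hpe'
  have he'e' : e' * e' = e' := he'.isIdempotentElem
  have hdiff : IsStarProjection (p - e') := by
    refine ⟨?_, hp.isSelfAdjoint.sub he'.isSelfAdjoint⟩
    change (p - e') * (p - e') = p - e'
    rw [sub_mul, mul_sub, mul_sub, hpp, hpe', he'p, he'e']
    abel
  have hm1 : m p = m (p - e') + m e' := by
    rw [← hm.add _ _ hdiff he' (by rw [sub_mul, hpe', he'e', sub_self]), sub_add_cancel]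
  have hL1 : L p = L (p - e') + L e' := by rw [← map_add, sub_add_cancel]
  rw [hm1, hL1, core (p - e') V hdiff hV, core e' V' he' hV']
  · intro j
    rw [← mul_assoc]
    refine hker _ ?_
    rw [Finset.mul_sum]
    refine Finset.sum_eq_zero fun k _ => ?_
    have := hVV j k
    simp only [← mul_assoc] at this ⊢
    rw [this, zero_mul]
  · intro k
    have h1 : (p - e') * E k * V = 0 := by
      have h2 : e' * (p * E k * V) = p * E k * V := by
        rw [← hXS k, ← mul_assoc, heX]
      simp only [← mul_assoc, he'p] at h2
      rw [sub_mul, sub_mul, h2, sub_self]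
    have := congrArg star h1
    rw [star_mul, star_mul, (hE k).isSelfAdjoint.star_eq, hdiff.isSelfAdjoint.star_eq,
      star_zero] at this
    exact this

end Infinite

section Gleason

variable {H : Type*} [NormedAddCommGroup H] [InnerProductSpace ℂ H] [CompleteSpace H]

/-- Bounded finitely additive measures on projections are restrictions of bounded functionals. -/
def HasGleason (A : Type*) [CStarAlgebra A] : Prop :=
  ∀ (m : A → ℝ) (M : ℝ), IsProjMeasure m M →
    ∃ L : A →L[ℝ] ℝ, ∀ p, IsStarProjection p → m p = L p

theorem nonempty_prod_equiv (w : Type*) [Infinite w] (κ : Type) [Nonempty κ] [Countable κ] :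
    Nonempty (w × κ ≃ w) := by
  have h : Cardinal.mk (w × κ) = Cardinal.mk w := by
    simp only [Cardinal.mk_prod, Cardinal.lift_uzero]
    exact Cardinal.mul_eq_left (Cardinal.aleph0_le_mk w)
      ((Cardinal.lift_le_aleph0.2 Cardinal.mk_le_aleph0).trans (Cardinal.aleph0_le_mk w))
      (by simp)
  exact Cardinal.eq.1 h

theorem hasGleason (hdim : ¬ FiniteDimensional ℂ H ∨ 2 < Module.finrank ℂ H) :
    HasGleason (H →L[ℂ] H) := by
  intro m M hm
  rcases hdim with hinf | hfin
  · obtain ⟨w, b, -⟩ := exists_hilbertBasis ℂ H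
    have : Infinite w := by
      by_contra hw
      rw [not_infinite_iff_finite] at hw
      apply hinf
      have := Fintype.ofFinite w
      exact b.toOrthonormalBasis.toBasis.finiteDimensional_of_finite
    obtain ⟨e1⟩ := nonempty_prod_equiv w ℕ
    obtain ⟨e2⟩ := nonempty_prod_equiv w (Fin 3)
    obtain ⟨R, hR, -⟩ := b.exists_orthIsos e1
    obtain ⟨S, hS, hSb⟩ := b.exists_orthIsos e2
    exact hm.exists_clm_of_infinite exists_rangeProj
      (fun n c => exists_isometries_annihilating b hinf c) hR hS (b.sum_orthIsos e2 hSb)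
  · exact hm.exists_clm_of_finrank hfin

end Gleason

section Complexify

variable {A : Type*} [CStarAlgebra A]

theorem exists_clm_of_selfAdjoint (lam : A →ₗ[ℝ] ℂ) {K : ℝ}
    (hK : ∀ x, IsSelfAdjoint x → ‖lam x‖ ≤ K * ‖x‖) :
    ∃ φ : A →ₗ[ℂ] ℂ, (∀ x, IsSelfAdjoint x → φ x = lam x) ∧ ∀ x, ‖φ x‖ ≤ 2 * K * ‖x‖ := by
  have hI : ∀ x : A, lam (realPart (Complex.I • x)) + Complex.I * lam (imaginaryPart (Complex.I • x))
      = Complex.I * (lam (realPart x) + Complex.I * lam (imaginaryPart x)) := by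
    intro x
    rw [realPart_I_smul, imaginaryPart_I_smul]
    simp only [AddSubgroup.coe_neg, map_neg]
    linear_combination (-lam (imaginaryPart x : A)) * Complex.I_mul_I
  have hr : ∀ (c : ℝ) (x : A), lam (realPart ((c : ℂ) • x)) +
      Complex.I * lam (imaginaryPart ((c : ℂ) • x))
      = c * (lam (realPart x) + Complex.I * lam (imaginaryPart x)) := by
    intro c x
    rw [Complex.coe_smul, map_smul, map_smul]
    simp only [selfAdjoint.val_smul, map_smul, Complex.real_smul]
    ring
  have hadd : ∀ x y : A, lam (realPart (x + y)) + Complex.I * lam (imaginaryPart (x + y)) =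
      lam (realPart x) + Complex.I * lam (imaginaryPart x) +
        (lam (realPart y) + Complex.I * lam (imaginaryPart y)) := by
    intro x y
    simp only [map_add, AddSubgroup.coe_add]
    ring
  refine ⟨{ toFun := fun x => lam (realPart x) + Complex.I * lam (imaginaryPart x)
            map_add' := hadd
            map_smul' := fun c x => ?_ }, fun x hx => ?_, fun x => ?_⟩
  · have h1 : c • x = (c.re : ℂ) • x + (c.im : ℂ) • (Complex.I • x) := by
      rw [smul_smul, ← add_smul, Complex.re_add_im]
    rw [h1, hadd, hr, hr, hI, RingHom.id_apply, smul_eq_mul]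
    conv_rhs => rw [← Complex.re_add_im c]
    ring
  · change lam (realPart x) + Complex.I * lam (imaginaryPart x) = lam x
    rw [hx.coe_realPart, hx.imaginaryPart]
    simp
  · change ‖lam (realPart x) + Complex.I * lam (imaginaryPart x)‖ ≤ _
    have h1 := hK _ (realPart x).2
    have h2 := hK _ (imaginaryPart x).2
    have h3 : ‖(realPart x : A)‖ ≤ ‖x‖ := realPart.norm_le x
    have h4 : ‖(imaginaryPart x : A)‖ ≤ ‖x‖ := imaginaryPart.norm_le x
    by_cases hK0 : 0 ≤ K
    · have h5 := mul_le_mul_of_nonneg_left h3 hK0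
      have h6 := mul_le_mul_of_nonneg_left h4 hK0
      refine (norm_add_le _ _).trans ?_
      rw [norm_mul, Complex.norm_I, one_mul]
      linarith
    · have hz : ∀ y : A, IsSelfAdjoint y → y = 0 := by
        intro y hy
        have h5 := (norm_nonneg _).trans (hK y hy)
        by_contra hy0
        have := norm_pos_iff.2 hy0
        nlinarith
      have hx : x = 0 := by
        rw [← realPart_add_I_smul_imaginaryPart x, hz _ (realPart x).2, hz _ (imaginaryPart x).2]
        simp
      subst hx
      simp

theorem LinearMap.ext_selfAdjoint {φ ψ : A →ₗ[ℂ] ℂ} (h : ∀ x, IsSelfAdjoint x → φ x = ψ x) :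
    φ = ψ := by
  ext x
  rw [← realPart_add_I_smul_imaginaryPart x, map_add, map_add, map_smul, map_smul,
    h _ (realPart x).2, h _ (imaginaryPart x).2]

variable [PartialOrder A] [StarOrderedRing A]

theorem HasRangeProj.ext_projection (hRP : HasRangeProj A) {φ ψ : A →ₗ[ℂ] ℂ} {K K' : ℝ}
    (hφ : ∀ x, ‖φ x‖ ≤ K * ‖x‖) (hψ : ∀ x, ‖ψ x‖ ≤ K' * ‖x‖)
    (h : ∀ p, IsStarProjection p → φ p = ψ p) : φ = ψ := by
  refine LinearMap.ext_selfAdjoint fun x hx => ?_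
  let Φ : A →L[ℝ] ℂ := (φ.mkContinuous K hφ).restrictScalars ℝ
  let Ψ : A →L[ℝ] ℂ := (ψ.mkContinuous K' hψ).restrictScalars ℝ
  refine Complex.ext ?_ ?_
  · exact hRP.eq_of_isSelfAdjoint (.one A) (Complex.reCLM.comp Φ) (Complex.reCLM.comp Ψ)
      (fun p hp _ => congrArg Complex.re (h p hp)) hx (one_mul x)
  · exact hRP.eq_of_isSelfAdjoint (.one A) (Complex.imCLM.comp Φ) (Complex.imCLM.comp Ψ)
      (fun p hp _ => congrArg Complex.im (h p hp)) hx (one_mul x)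

theorem HasGleason.exists_linear (hG : HasGleason A) (hRP : HasRangeProj A) {μ : A → ℂ} {M : ℝ}
    (hadd : ∀ p q, IsStarProjection p → IsStarProjection q → p * q = 0 →
      μ (p + q) = μ p + μ q)
    (hbdd : ∀ p, IsStarProjection p → ‖μ p‖ ≤ M) :
    ∃ φ : A →ₗ[ℂ] ℂ, (∀ p, IsStarProjection p → φ p = μ p) ∧ ∀ x, ‖φ x‖ ≤ 8 * M * ‖x‖ := by
  have h1 : IsProjMeasure (fun p => (μ p).re) M :=
    ⟨fun p q hp hq h => by rw [hadd p q hp hq h, Complex.add_re],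
      fun p hp => (Complex.abs_re_le_norm _).trans (hbdd p hp)⟩
  have h2 : IsProjMeasure (fun p => (μ p).im) M :=
    ⟨fun p q hp hq h => by rw [hadd p q hp hq h, Complex.add_im],
      fun p hp => (Complex.abs_im_le_norm _).trans (hbdd p hp)⟩
  obtain ⟨L1, hL1⟩ := hG _ _ h1
  obtain ⟨L2, hL2⟩ := hG _ _ h2
  have hs : ∀ (L : A →L[ℝ] ℝ) (f : A → ℝ), IsProjMeasure f M →
      (∀ p, IsStarProjection p → f p = L p) → ∀ x, IsSelfAdjoint x → |L x| ≤ 2 * M * ‖x‖ :=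
    fun L f hf hL x hx => hRP.abs_le_of_isSelfAdjoint (.one A) L
      (fun p hp _ => by rw [← hL p hp]; exact hf.bdd p hp) hx (one_mul x)
  let lam : A →ₗ[ℝ] ℂ := Complex.ofRealCLM.toLinearMap ∘ₗ L1.toLinearMap +
    LinearMap.lsmul ℝ ℂ 1 ∘ₗ (Complex.I • (Complex.ofRealCLM.toLinearMap ∘ₗ L2.toLinearMap))
  have hlam : ∀ x, lam x = L1 x + Complex.I * L2 x := fun x => by simp [lam]
  obtain ⟨φ, hφ1, hφ2⟩ := exists_clm_of_selfAdjoint lam (K := 4 * M) (fun x hx => by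
    rw [hlam]
    refine (norm_add_le _ _).trans ?_
    rw [norm_mul, Complex.norm_I, one_mul, Complex.norm_real, Complex.norm_real]
    have h3 := hs L1 _ h1 hL1 x hx
    have h4 := hs L2 _ h2 hL2 x hx
    rw [Real.norm_eq_abs, Real.norm_eq_abs]
    linarith)
  refine ⟨φ, fun p hp => ?_, fun x => (hφ2 x).trans_eq (by ring)⟩
  rw [hφ1 p hp.isSelfAdjoint, hlam, ← hL1 p hp, ← hL2 p hp, mul_comm, Complex.re_add_im]

theorem HasGleason.exists_bilinear (hG : HasGleason A) (hRP : HasRangeProj A) {d : A → A → ℂ}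
    {M : ℝ}
    (hl : ∀ p q r, IsStarProjection p → IsStarProjection q → IsStarProjection r → p * q = 0 →
      d (p + q) r = d p r + d q r)
    (hr : ∀ p q r, IsStarProjection p → IsStarProjection q → IsStarProjection r → p * q = 0 →
      d r (p + q) = d r p + d r q)
    (hbdd : ∀ p q, IsStarProjection p → IsStarProjection q → ‖d p q‖ ≤ M) :
    ∃ V : A →ₗ[ℂ] A →ₗ[ℂ] ℂ, (∀ p q, IsStarProjection p → IsStarProjection q → V p q = d p q) ∧
      ∀ x y, ‖V x y‖ ≤ 64 * M * ‖x‖ * ‖y‖ := by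
  have h1 : ∀ q, ∃ φ : A →ₗ[ℂ] ℂ, IsStarProjection q →
      (∀ p, IsStarProjection p → φ p = d p q) ∧ ∀ x, ‖φ x‖ ≤ 8 * M * ‖x‖ := by
    intro q
    by_cases hq : IsStarProjection q
    · obtain ⟨φ, hφ⟩ := hG.exists_linear hRP (μ := fun p => d p q)
        (fun p p' hp hp' h => hl p p' q hp hp' hq h) (fun p hp => hbdd p q hp hq)
      exact ⟨φ, fun _ => hφ⟩
    · exact ⟨0, fun h => absurd h hq⟩
  choose φ hφ using h1
  have hφadd : ∀ p q, IsStarProjection p → IsStarProjection q → p * q = 0 →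
      φ (p + q) = φ p + φ q := by
    intro p q hp hq hpq
    have hpq' := hp.add hq hpq
    refine hRP.ext_projection (hφ _ hpq').2 (K' := 8 * M + 8 * M) (fun x => ?_) fun r hr' => ?_
    · rw [add_mul]
      exact (norm_add_le _ _).trans (add_le_add ((hφ p hp).2 x) ((hφ q hq).2 x))
    · rw [LinearMap.add_apply, (hφ _ hpq').1 r hr', (hφ p hp).1 r hr', (hφ q hq).1 r hr',
        hr p q r hp hq hr' hpq]
  have h2 : ∀ x, ∃ Ψ : A →ₗ[ℂ] ℂ, (∀ q, IsStarProjection q → Ψ q = φ q x) ∧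
      ∀ y, ‖Ψ y‖ ≤ 8 * (8 * M * ‖x‖) * ‖y‖ := fun x =>
    hG.exists_linear hRP (μ := fun q => φ q x)
      (fun p q hp hq h => by rw [hφadd p q hp hq h, LinearMap.add_apply])
      (fun q hq => (hφ q hq).2 x)
  choose Ψ hΨ1 hΨ2 using h2
  have hΨadd : ∀ x x', Ψ (x + x') = Ψ x + Ψ x' := by
    intro x x'
    refine hRP.ext_projection (hΨ2 _) (K' := 8 * (8 * M * ‖x‖) + 8 * (8 * M * ‖x'‖))
      (fun y => ?_) fun q hq => ?_
    · rw [add_mul]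
      exact (norm_add_le _ _).trans (add_le_add (hΨ2 x y) (hΨ2 x' y))
    · rw [LinearMap.add_apply, hΨ1 _ q hq, hΨ1 _ q hq, hΨ1 _ q hq, map_add]
  have hΨsmul : ∀ (c : ℂ) x, Ψ (c • x) = c • Ψ x := by
    intro c x
    refine hRP.ext_projection (hΨ2 _) (K' := ‖c‖ * (8 * (8 * M * ‖x‖)))
      (fun y => ?_) fun q hq => ?_
    · rw [LinearMap.smul_apply, norm_smul, mul_assoc ‖c‖]
      exact mul_le_mul_of_nonneg_left (hΨ2 x y) (norm_nonneg c)
    · rw [LinearMap.smul_apply, hΨ1 _ q hq, hΨ1 _ q hq, map_smul]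
  refine ⟨{ toFun := Ψ, map_add' := hΨadd, map_smul' := hΨsmul }, fun p q hp hq => ?_,
    fun x y => ?_⟩
  · change Ψ p q = d p q
    rw [hΨ1 p q hq, (hφ q hq).1 p hp]
  · exact (hΨ2 x y).trans_eq (by ring)

end Complexify

section PairForm

variable {A : Type*} [CStarAlgebra A] [PartialOrder A] [StarOrderedRing A]

theorem mul_self_le_of_le_one {e : A} (h0 : 0 ≤ e) (h1 : e ≤ 1) : e * e ≤ e := by
  have h : 0 ≤ e * (1 - e) := Commute.mul_nonneg h0 (sub_nonneg.2 h1)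
    ((Commute.one_right e).sub_right (Commute.refl e))
  rwa [mul_sub, mul_one, sub_nonneg] at h

/-- Self-adjoint elements forming the real and imaginary parts of a unitary. -/
structure IsCosSin (c a : A) : Prop where
  left : IsSelfAdjoint c
  right : IsSelfAdjoint a
  comm : c * a = a * c
  sq : c * c + a * a = 1

theorem IsCosSin.neg {c a : A} (h : IsCosSin c a) : IsCosSin c (-a) :=
  ⟨h.left, h.right.neg, by rw [mul_neg, neg_mul, h.comm], by rw [neg_mul_neg, h.sq]⟩

theorem IsCosSin.swap {c a : A} (h : IsCosSin c a) : IsCosSin a c :=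
  ⟨h.right, h.left, h.comm.symm, by rw [add_comm, h.sq]⟩

theorem IsCosSin.mem_unitary {c a : A} (h : IsCosSin c a) : c + Complex.I • a ∈ unitary A := by
  have h1 : star (c + Complex.I • a) = c - Complex.I • a := by
    rw [star_add, star_smul, h.left.star_eq, h.right.star_eq, RCLike.star_def, Complex.conj_I,
      neg_smul, sub_eq_add_neg]
  have hI : ∀ x : A, Complex.I • Complex.I • x = -x := fun x => by
    rw [smul_smul, Complex.I_mul_I, neg_one_smul]
  rw [Unitary.mem_iff, h1, ← h.sq]
  constructor
  · simp only [sub_mul, mul_add, smul_mul_assoc, mul_smul_comm, smul_add, smul_sub, hI, h.comm]; abel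
  · simp only [add_mul, mul_sub, smul_mul_assoc, mul_smul_comm, smul_add, smul_sub, hI, h.comm]; abel

theorem IsSelfAdjoint.mul_self_nonneg' {a : A} (ha : IsSelfAdjoint a) : 0 ≤ a * a := by
  have := star_mul_self_nonneg a
  rwa [ha.star_eq] at this

theorem IsSelfAdjoint.mul_self_le_one {a : A} (ha : IsSelfAdjoint a) (h1 : ‖a‖ ≤ 1) :
    a * a ≤ 1 := by
  rw [← CStarAlgebra.norm_le_one_iff_of_nonneg _ ha.mul_self_nonneg']
  exact (norm_mul_le _ _).trans (mul_le_one₀ h1 (norm_nonneg _) h1)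

theorem IsSelfAdjoint.exists_isCosSin {a : A} (ha : IsSelfAdjoint a) (h1 : ‖a‖ ≤ 1) :
    ∃ c, IsCosSin c a ∧ 0 ≤ c ∧ c ≤ 1 := by
  have h : 0 ≤ 1 - a * a := sub_nonneg.2 (ha.mul_self_le_one h1)
  have hs : CFC.sqrt (1 - a * a) * CFC.sqrt (1 - a * a) = 1 - a * a := CFC.sqrt_mul_sqrt_self _ h
  have h0 := CFC.sqrt_nonneg (1 - a * a)
  refine ⟨CFC.sqrt (1 - a * a), ⟨.of_nonneg h0, ha, ?_, ?_⟩, h0, ?_⟩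
  · have hc : Commute (1 - a * a) a :=
      (Commute.one_left a).sub_left ((Commute.refl a).mul_left (Commute.refl a))
    exact hc.cfcₙ_nnreal NNReal.sqrt
  · rw [hs, sub_add_cancel]
  · rw [← CStarAlgebra.norm_le_one_iff_of_nonneg _ h0, ← sq_le_one_iff₀ (norm_nonneg _)]
    have : IsSelfAdjoint (CFC.sqrt (1 - a * a)) := .of_nonneg h0
    rw [← this.norm_mul_self, hs]
    refine (CStarAlgebra.norm_le_one_iff_of_nonneg _ h).2 (sub_le_self _ ha.mul_self_nonneg')

theorem IsCosSin.one_sub_le {c a : A} (h : IsCosSin c a) (h0 : 0 ≤ c) (h1 : c ≤ 1) :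
    1 - c ≤ a * a := by
  rw [← sub_nonneg]
  have h2 : a * a - (1 - c) = c - c * c := by rw [← h.sq]; abel
  rw [h2]
  exact sub_nonneg.2 (mul_self_le_of_le_one h0 h1)

theorem norm_le_one_of_mem {k : A} (h0 : 0 ≤ k) (h1 : k ≤ 1) : ‖k‖ ≤ 1 :=
  (CStarAlgebra.norm_le_one_iff_of_nonneg k h0).2 h1

/-- A bounded bilinear form almost attaining its maximum over pairs of unitaries at `(1, 1)`. -/
structure IsNearMax (V : A →ₗ[ℂ] A →ₗ[ℂ] ℂ) (N η : ℝ) : Prop where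
  le : ∀ u v, u ∈ unitary A → v ∈ unitary A → ‖V u v‖ ≤ N
  max : N - η ≤ (V 1 1).re
  pos : 0 ≤ η

namespace IsNearMax

variable {V : A →ₗ[ℂ] A →ₗ[ℂ] ℂ} {N η : ℝ}

theorem nonneg (hV : IsNearMax V N η) : 0 ≤ N :=
  (norm_nonneg _).trans (hV.le 1 1 (one_mem _) (one_mem _))

theorem re_le (hV : IsNearMax V N η) {c a c' b : A} (h : IsCosSin c a) (h' : IsCosSin c' b) :
    |(V c c').re - (V a b).re - (V a c').im - (V c b).im| ≤ N := by
  have := (Complex.abs_re_le_norm _).trans (hV.le _ _ h.mem_unitary h'.mem_unitary)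
  simp only [map_add, map_smul, LinearMap.add_apply, LinearMap.smul_apply, smul_eq_mul,
    Complex.add_re, Complex.mul_re, Complex.I_re, Complex.I_im, Complex.add_im, Complex.mul_im] at this
  refine le_of_eq_of_le ?_ this
  congr 1; ring

theorem abs_re_le_sub (hV : IsNearMax V N η) {c a c' b : A} (h : IsCosSin c a)
    (h' : IsCosSin c' b) : |(V a b).re| ≤ N - (V c c').re := by
  have h1 := hV.re_le h h'
  have h2 := hV.re_le h.neg h'.neg
  have h3 := hV.re_le h.neg h'
  have h4 := hV.re_le h h'.neg
  simp only [map_neg, LinearMap.neg_apply, Complex.neg_re, Complex.neg_im] at h2 h3 h4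
  rw [abs_le] at *
  constructor <;> linarith

theorem abs_im_le_sub (hV : IsNearMax V N η) {c a c' b : A} (h : IsCosSin c a)
    (h' : IsCosSin c' b) : |(V a c').im| ≤ N - (V c c').re := by
  have h1 := hV.re_le h h'
  have h2 := hV.re_le h.neg h'.neg
  have h3 := hV.re_le h.neg h'
  have h4 := hV.re_le h h'.neg
  simp only [map_neg, LinearMap.neg_apply, Complex.neg_re, Complex.neg_im] at h2 h3 h4
  rw [abs_le] at *
  constructor <;> linarith

theorem abs_re_le (hV : IsNearMax V N η) {a b : A} (ha : IsSelfAdjoint a) (ha1 : ‖a‖ ≤ 1)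
    (hb : IsSelfAdjoint b) (hb1 : ‖b‖ ≤ 1) : |(V a b).re| ≤ N := by
  obtain ⟨c, hc, -, -⟩ := ha.exists_isCosSin ha1
  obtain ⟨c', hc', -, -⟩ := hb.exists_isCosSin hb1
  have h1 := hV.abs_re_le_sub hc hc'
  have h2 := hV.abs_re_le_sub hc hc'.swap.neg.swap
  rw [map_neg, Complex.neg_re] at h2
  linarith

theorem neg_le_left (hV : IsNearMax V N η) {k : A} (h0 : 0 ≤ k) (h1 : k ≤ 1) :
    -η ≤ (V k 1).re := by
  have h := hV.abs_re_le ((IsSelfAdjoint.one A).sub (.of_nonneg h0))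
    (norm_le_one_of_mem (sub_nonneg.2 h1) (sub_le_self _ h0)) (IsSelfAdjoint.one A)
    (norm_le_one_of_mem zero_le_one le_rfl)
  have := hV.max
  simp only [map_sub, LinearMap.sub_apply, Complex.sub_re] at h
  linarith [le_abs_self ((V 1 1).re - (V k 1).re)]

theorem neg_le_right (hV : IsNearMax V N η) {k : A} (h0 : 0 ≤ k) (h1 : k ≤ 1) :
    -η ≤ (V 1 k).re := by
  have h := hV.abs_re_le (IsSelfAdjoint.one A) (norm_le_one_of_mem zero_le_one le_rfl)
    ((IsSelfAdjoint.one A).sub (.of_nonneg h0))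
    (norm_le_one_of_mem (sub_nonneg.2 h1) (sub_le_self _ h0))
  have := hV.max
  simp only [map_sub, Complex.sub_re] at h
  linarith [le_abs_self ((V 1 1).re - (V 1 k).re)]

theorem left_mono (hV : IsNearMax V N η) {e k : A} (h0 : 0 ≤ e) (h : e ≤ k) (h1 : k ≤ 1) :
    (V e 1).re ≤ (V k 1).re + η := by
  have := hV.neg_le_left (sub_nonneg.2 h) ((sub_le_self _ h0).trans h1)
  rw [map_sub, LinearMap.sub_apply, Complex.sub_re] at this
  linarith

theorem right_mono (hV : IsNearMax V N η) {e k : A} (h0 : 0 ≤ e) (h : e ≤ k) (h1 : k ≤ 1) :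
    (V 1 e).re ≤ (V 1 k).re + η := by
  have := hV.neg_le_right (sub_nonneg.2 h) ((sub_le_self _ h0).trans h1)
  rw [map_sub, Complex.sub_re] at this
  linarith

theorem sub_re_le (hV : IsNearMax V N η) (e e' : A) :
    N - (V (1 - e) (1 - e')).re ≤ η + (V e 1).re + (V 1 e').re - (V e e').re := by
  have := hV.max
  simp only [map_sub, LinearMap.sub_apply, Complex.sub_re]
  linarith

theorem abs_re_le_add (hV : IsNearMax V N η) {ε r : ℝ} (hε : 0 < ε) (hε1 : ε ≤ 1)
    (hr : 3 * η / ε ^ 2 + N * ε ^ 2 ≤ r) {a b : A} (ha : IsSelfAdjoint a) (ha1 : ‖a‖ ≤ 1)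
    (hb : IsSelfAdjoint b) (hb1 : ‖b‖ ≤ 1) :
    |(V a b).re| ≤ (V (a * a) 1).re + (V 1 (b * b)).re + r := by
  have hsc : ∀ a : A, IsSelfAdjoint a → ‖a‖ ≤ 1 → ∃ c f, IsCosSin c (ε • a) ∧
      c = 1 - ε ^ 2 • f ∧ 0 ≤ f ∧ f ≤ a * a := by
    intro a ha ha1
    have hsa : IsSelfAdjoint (ε • a) := (IsSelfAdjoint.all ε).smul ha
    obtain ⟨c, hc, h0, h1⟩ := hsa.exists_isCosSin (by
      rw [norm_smul, Real.norm_of_nonneg hε.le]; exact mul_le_one₀ hε1 (norm_nonneg _) ha1)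
    have h2 := hc.one_sub_le h0 h1
    refine ⟨c, (ε ^ 2)⁻¹ • (1 - c), hc, ?_, ?_, ?_⟩
    · rw [smul_smul, mul_inv_cancel₀ (by positivity), one_smul, sub_sub_cancel]
    · exact smul_nonneg (by positivity) (sub_nonneg.2 h1)
    · have h3 := smul_le_smul_of_nonneg_left h2 (show 0 ≤ (ε ^ 2)⁻¹ by positivity)
      rwa [smul_mul_smul_comm, ← sq, smul_smul, inv_mul_cancel₀ (by positivity), one_smul] at h3
  obtain ⟨c, f, hc, rfl, hf0, hf1⟩ := hsc a ha ha1
  obtain ⟨c', f', hc', rfl, hf0', hf1'⟩ := hsc b hb hb1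
  have h1 := hV.abs_re_le_sub hc hc'
  have h2 := hV.sub_re_le (ε ^ 2 • f) (ε ^ 2 • f')
  have haa := ha.mul_self_le_one ha1
  have hbb := hb.mul_self_le_one hb1
  have h3 := hV.left_mono hf0 hf1 haa
  have h4 := hV.right_mono hf0' hf1' hbb
  have h5 := hV.abs_re_le (.of_nonneg hf0) (norm_le_one_of_mem hf0 (hf1.trans haa))
    (.of_nonneg hf0') (norm_le_one_of_mem hf0' (hf1'.trans hbb))
  have hre : ∀ (t : ℝ) (x : A), t • x = (t : ℂ) • x := fun t x => (Complex.coe_smul t x).symm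
  have h6 : ∀ (s t : ℝ) (x y : A), (V (s • x) (t • y)).re = s * t * (V x y).re := fun s t x y => by
    rw [hre, hre, map_smul, map_smul, LinearMap.smul_apply, smul_eq_mul, smul_eq_mul,
      Complex.re_ofReal_mul, Complex.re_ofReal_mul]
    ring
  have h7 : (V (ε ^ 2 • f) 1).re = ε ^ 2 * (V f 1).re := by
    have := h6 (ε ^ 2) 1 f 1; rwa [one_smul, mul_one] at this
  have h8 : (V 1 (ε ^ 2 • f')).re = ε ^ 2 * (V 1 f').re := by
    have := h6 1 (ε ^ 2) 1 f'; rwa [one_smul, one_mul] at this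
  rw [h6, abs_mul, abs_of_pos (mul_pos hε hε), ← sq] at h1
  rw [h6, h7, h8] at h2
  have hε2 : 0 < ε ^ 2 := by positivity
  have hη := hV.pos
  have h9 : ε ^ 2 * |(V a b).re| ≤ ε ^ 2 * ((V (a * a) 1).re + (V 1 (b * b)).re + r) := by
    have e1 : ε ^ 2 * (3 * η / ε ^ 2 + N * ε ^ 2) ≤ ε ^ 2 * r :=
      mul_le_mul_of_nonneg_left hr hε2.le
    have e2 : ε ^ 2 * (3 * η / ε ^ 2 + N * ε ^ 2) = 3 * η + ε ^ 2 * ε ^ 2 * N := by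
      field_simp
    have e3 := mul_le_mul_of_nonneg_left (neg_abs_le (V f f').re)
      (mul_nonneg hε2.le hε2.le)
    have e4 := mul_le_mul_of_nonneg_left h5 (mul_nonneg hε2.le hε2.le)
    have e5 := mul_le_mul_of_nonneg_left h3 hε2.le
    have e6 := mul_le_mul_of_nonneg_left h4 hε2.le
    have e7 : ε ^ 2 ≤ 1 := pow_le_one₀ hε.le hε1
    have e8 := mul_le_mul_of_nonneg_right e7 hη
    linarith
  exact le_of_mul_le_mul_left h9 hε2

/-- The basic estimate at an almost maximal pair. -/
theorem norm_le (hV : IsNearMax V N η) {r : ℝ} (hηr : η ≤ r)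
    (hre : ∀ a b : A, IsSelfAdjoint a → ‖a‖ ≤ 1 → IsSelfAdjoint b → ‖b‖ ≤ 1 →
      |(V a b).re| ≤ (V (a * a) 1).re + (V 1 (b * b)).re + r)
    {a k : A} (ha : IsSelfAdjoint a) (ha1 : ‖a‖ ≤ 1) (hk0 : 0 ≤ k) (hk1 : k ≤ 1) :
    ‖V a k‖ ≤ 5 * ((V (a * a) 1).re + (V 1 k).re) + 20 * r := by
  obtain ⟨c, hc, hc0, hc1⟩ := ha.exists_isCosSin ha1
  have haa := ha.mul_self_le_one ha1
  have haa0 := ha.mul_self_nonneg'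
  have hek := hc.one_sub_le hc0 hc1
  have he0 : 0 ≤ 1 - c := sub_nonneg.2 hc1
  have hη := hV.pos
  have him : ∀ k : A, 0 ≤ k → k ≤ 1 → |(V a (1 - k)).im| ≤
      2 * (V (a * a) 1).re + 2 * (V 1 k).re + 5 * r := by
    intro k hk0 hk1
    have hksa : IsSelfAdjoint (1 - k) := .of_nonneg (sub_nonneg.2 hk1)
    obtain ⟨b, hb, -, -⟩ := hksa.exists_isCosSin
      (norm_le_one_of_mem (sub_nonneg.2 hk1) (sub_le_self _ hk0))
    have h1 := hV.abs_im_le_sub hc hb.swap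
    have h2 := hV.sub_re_le (1 - c) k
    rw [sub_sub_cancel] at h2
    have h3 := hre (1 - c) k (.of_nonneg he0)
      (norm_le_one_of_mem he0 (hek.trans haa)) (.of_nonneg hk0) (norm_le_one_of_mem hk0 hk1)
    have hese : (1 - c) * (1 - c) ≤ 1 - c := mul_self_le_of_le_one he0 (hek.trans haa)
    have h4 := hV.left_mono (IsSelfAdjoint.of_nonneg he0).mul_self_nonneg' (hese.trans hek) haa
    have h5 := hV.left_mono he0 hek haa
    have h6 := hV.right_mono (IsSelfAdjoint.of_nonneg hk0).mul_self_nonneg'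
      (mul_self_le_of_le_one hk0 hk1) hk1
    have h7 := neg_abs_le (V (1 - c) k).re
    linarith
  have h0 := him 0 le_rfl zero_le_one
  have h1 := him k hk0 hk1
  rw [sub_zero, map_zero, Complex.zero_re] at h0
  rw [map_sub, Complex.sub_im] at h1
  have h2 := hre a k ha ha1 (.of_nonneg hk0) (norm_le_one_of_mem hk0 hk1)
  have h6 := hV.right_mono (IsSelfAdjoint.of_nonneg hk0).mul_self_nonneg'
      (mul_self_le_of_le_one hk0 hk1) hk1
  have h7 := hV.neg_le_right hk0 hk1
  have h8 := hV.neg_le_left haa0 haa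
  have h9 := Complex.norm_le_abs_re_add_abs_im (V a k)
  have h10 : |(V a k).im| ≤ |(V a 1).im| + |(V a 1).im - (V a k).im| := by
    have := abs_sub (V a 1).im ((V a 1).im - (V a k).im)
    rwa [sub_sub_cancel] at this
  linarith

end IsNearMax

end PairForm

section Untwist

variable {A : Type*} [CStarAlgebra A]

/-- The real part of `star u * x`, rotated by the phase `l`. -/
noncomputable def rotPart (l : ℂ) (u x : A) : A :=
  (1 / 2 : ℂ) • (star l • (star u * x) + l • (x * u))

/-- The average of an element with its conjugate by `u`. -/
noncomputable def conjAvg (u : A) : A →ₗ[ℝ] A where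
  toFun t := (1 / 2 : ℝ) • (t + star u * t * u)
  map_add' s t := by rw [mul_add, add_mul, ← smul_add]; congr 1; abel
  map_smul' c t := by
    rw [mul_smul_comm, smul_mul_assoc, ← smul_add, smul_comm, RingHom.id_apply]

theorem conjAvg_apply (u t : A) : conjAvg u t = (1 / 2 : ℝ) • (t + star u * t * u) := rfl

theorem rotPart_isSelfAdjoint (l : ℂ) (u : A) {x : A} (hx : IsSelfAdjoint x) :
    IsSelfAdjoint (rotPart l u x) := by
  rw [IsSelfAdjoint, rotPart]
  simp only [star_smul, star_add, star_mul, star_star, hx.star_eq]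
  rw [add_comm]
  congr 1
  simp

theorem norm_le_one_of_mem_unitary {u : A} (hu : u ∈ unitary A) : ‖u‖ ≤ 1 := by
  rcases subsingleton_or_nontrivial A with h | h
  · rw [Subsingleton.elim u 0, norm_zero]; exact zero_le_one
  · exact (CStarRing.norm_of_mem_unitary hu).le

theorem norm_rotPart_le {l : ℂ} (hl : ‖l‖ = 1) {u x : A} (hu : u ∈ unitary A) :
    ‖rotPart l u x‖ ≤ ‖x‖ := by
  have h1 := norm_le_one_of_mem_unitary hu
  have h2 : ‖star u * x‖ ≤ ‖x‖ := by
    refine (norm_mul_le _ _).trans ?_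
    rw [norm_star]
    exact mul_le_of_le_one_left (norm_nonneg _) h1
  have h3 : ‖x * u‖ ≤ ‖x‖ :=
    (norm_mul_le _ _).trans (mul_le_of_le_one_right (norm_nonneg _) h1)
  rw [rotPart, norm_smul]
  have h4 := norm_add_le (star l • (star u * x)) (l • (x * u))
  rw [norm_smul, norm_smul, norm_star, hl, one_mul, one_mul] at h4
  have : ‖(1 / 2 : ℂ)‖ = 1 / 2 := by norm_num
  rw [this]
  linarith

theorem rotPart_add_rotPart (u x : A) :
    rotPart 1 u x + Complex.I • rotPart Complex.I u x = star u * x := by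
  simp only [rotPart, star_one, one_smul, RCLike.star_def, Complex.conj_I]
  match_scalars
  · linear_combination (-1 / 2 : ℂ) * Complex.I_mul_I
  · linear_combination (1 / 2 : ℂ) * Complex.I_mul_I

theorem rotPart_sq_add_sq {u : A} (hu : u ∈ unitary A) (x : A) :
    rotPart 1 u x * rotPart 1 u x + rotPart Complex.I u x * rotPart Complex.I u x
      = conjAvg u (x * x) := by
  have h1 : (star u * x) * (x * u) = star u * (x * x) * u := by simp only [mul_assoc]
  have h2 : (x * u) * (star u * x) = x * x := by
    rw [mul_assoc, ← mul_assoc u, (Unitary.mem_iff.1 hu).2, one_mul]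
  rw [conjAvg_apply, ← h1, ← h2]
  have h3 : ∀ y : A, (1 / 2 : ℝ) • y = (1 / 2 : ℂ) • y := fun y => by
    rw [← Complex.coe_smul]; norm_num
  rw [h3]
  simp only [rotPart, star_one, one_smul, RCLike.star_def, Complex.conj_I]
  generalize star u * x = w
  generalize x * u = w'
  simp only [mul_add, add_mul, smul_mul_assoc, mul_smul_comm, smul_add]
  match_scalars
  · linear_combination (1 / 4 : ℂ) * Complex.I_mul_I
  · linear_combination (-1 / 4 : ℂ) * Complex.I_mul_I
  · linear_combination (-1 / 4 : ℂ) * Complex.I_mul_I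
  · linear_combination (1 / 4 : ℂ) * Complex.I_mul_I

theorem rotPart_neg (l : ℂ) (u x : A) : rotPart (-l) u x = -rotPart l u x := by
  simp only [rotPart, star_neg, neg_smul, ← neg_add, smul_neg]

variable [PartialOrder A] [StarOrderedRing A]

theorem conjAvg_nonneg (u : A) {y : A} (h : 0 ≤ y) : 0 ≤ conjAvg u y :=
  smul_nonneg (by norm_num) (add_nonneg h (star_left_conjugate_nonneg h u))

theorem conjAvg_le_one {u : A} (hu : u ∈ unitary A) {y : A} (h : y ≤ 1) : conjAvg u y ≤ 1 := by
  have h1 := conjAvg_nonneg u (sub_nonneg.2 h)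
  have h2 : conjAvg u 1 = 1 := by
    rw [conjAvg_apply, mul_one, (Unitary.mem_iff.1 hu).1]; module
  rwa [map_sub, h2, sub_nonneg] at h1

theorem conjAvg_add_rotPart_nonneg {l : ℂ} (hl : star l * l = 1) (u : A) {y : A} (h : 0 ≤ y) :
    0 ≤ conjAvg u y + rotPart l u y := by
  have h1 := smul_nonneg (show (0 : ℝ) ≤ 1 / 2 by norm_num)
    (star_left_conjugate_nonneg h (1 + l • u))
  refine h1.trans_eq ?_
  have h3 : ∀ y : A, (1 / 2 : ℝ) • y = (1 / 2 : ℂ) • y := fun y => by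
    rw [← Complex.coe_smul]; norm_num
  rw [conjAvg_apply, rotPart, h3, h3, ← smul_add]
  congr 1
  rw [star_add, star_one, star_smul]
  simp only [mul_add, add_mul, smul_mul_assoc, mul_smul_comm, mul_one, one_mul]
  rw [smul_add, smul_smul l, mul_comm l, hl, one_smul]
  abel

theorem conjAvg_sub_rotPart_nonneg {l : ℂ} (hl : star l * l = 1) (u : A) {y : A} (h : 0 ≤ y) :
    0 ≤ conjAvg u y - rotPart l u y := by
  have := conjAvg_add_rotPart_nonneg (l := -l) (by rw [star_neg, neg_mul_neg, hl]) u h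
  rwa [rotPart_neg, ← sub_eq_add_neg] at this

namespace IsNearMax

variable {V : A →ₗ[ℂ] A →ₗ[ℂ] ℂ} {N η : ℝ}

theorem norm_rotPart_le (hV : IsNearMax V N η) {r : ℝ} (hηr : η ≤ r)
    (hre : ∀ a b : A, IsSelfAdjoint a → ‖a‖ ≤ 1 → IsSelfAdjoint b → ‖b‖ ≤ 1 →
      |(V a b).re| ≤ (V (a * a) 1).re + (V 1 (b * b)).re + r)
    {a y v : A} (ha : IsSelfAdjoint a) (ha1 : ‖a‖ ≤ 1) (hy0 : 0 ≤ y) (hy1 : y ≤ 1)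
    (hv : v ∈ unitary A) {l : ℂ} (hl : star l * l = 1) :
    ‖V a (rotPart l v y)‖ ≤ 10 * (V (a * a) 1).re + 5 * (V 1 (conjAvg v y)).re + 40 * r := by
  have hz1 := conjAvg_le_one hv hy1
  have hp := conjAvg_add_rotPart_nonneg hl v hy0
  have hq := conjAvg_sub_rotPart_nonneg hl v hy0
  set z := conjAvg v y
  set c := rotPart l v y
  have h3 : ∀ y : A, (1 / 2 : ℝ) • y = (1 / 2 : ℂ) • y := fun y => by
    rw [← Complex.coe_smul]; norm_num
  have hp0 := smul_nonneg (show (0 : ℝ) ≤ 1 / 2 by norm_num) hp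
  have hq0 := smul_nonneg (show (0 : ℝ) ≤ 1 / 2 by norm_num) hq
  have hpq : (1 / 2 : ℝ) • (z + c) + (1 / 2 : ℝ) • (z - c) = z := by module
  have hpq' : (1 / 2 : ℝ) • (z + c) - (1 / 2 : ℝ) • (z - c) = c := by module
  have h1 := hV.norm_le hηr hre ha ha1 hp0
    ((le_add_of_nonneg_right hq0).trans (hpq.le.trans hz1))
  have h2 := hV.norm_le hηr hre ha ha1 hq0
    ((le_add_of_nonneg_left hp0).trans (hpq.le.trans hz1))
  have h4 : (V 1 z).re = (V 1 ((1 / 2 : ℝ) • (z + c))).re + (V 1 ((1 / 2 : ℝ) • (z - c))).re := by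
    rw [← Complex.add_re, ← map_add, hpq]
  have h5 : ‖V a c‖ ≤ ‖V a ((1 / 2 : ℝ) • (z + c))‖ + ‖V a ((1 / 2 : ℝ) • (z - c))‖ := by
    rw [← hpq', map_sub, hpq']
    exact norm_sub_le _ _
  linarith

theorem norm_star_mul_le (hV : IsNearMax V N η) {r : ℝ} (hηr : η ≤ r)
    (hre : ∀ a b : A, IsSelfAdjoint a → ‖a‖ ≤ 1 → IsSelfAdjoint b → ‖b‖ ≤ 1 →
      |(V a b).re| ≤ (V (a * a) 1).re + (V 1 (b * b)).re + r)
    {x y u v : A} (hx : IsSelfAdjoint x) (hx1 : ‖x‖ ≤ 1) (hy0 : 0 ≤ y) (hy1 : y ≤ 1)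
    (hu : u ∈ unitary A) (hv : v ∈ unitary A) :
    ‖V (star u * x) (star v * y)‖ ≤
      20 * ((V (conjAvg u (x * x)) 1).re + (V 1 (conjAvg v y)).re) + 160 * r := by
  have e1 : star (1 : ℂ) * 1 = 1 := by simp
  have eI : star Complex.I * Complex.I = 1 := by simp
  have n1 : ‖(1 : ℂ)‖ = 1 := by simp
  have nI : ‖Complex.I‖ = 1 := by simp
  have s1 := rotPart_isSelfAdjoint 1 u hx
  have sI := rotPart_isSelfAdjoint Complex.I u hx
  have b1 := (_root_.norm_rotPart_le n1 hu (x := x)).trans hx1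
  have bI := (_root_.norm_rotPart_le nI hu (x := x)).trans hx1
  have t11 := hV.norm_rotPart_le hηr hre s1 b1 hy0 hy1 hv e1
  have t1I := hV.norm_rotPart_le hηr hre s1 b1 hy0 hy1 hv eI
  have tI1 := hV.norm_rotPart_le hηr hre sI bI hy0 hy1 hv e1
  have tII := hV.norm_rotPart_le hηr hre sI bI hy0 hy1 hv eI
  rw [← rotPart_sq_add_sq hu, ← rotPart_add_rotPart u x, ← rotPart_add_rotPart v y]
  simp only [map_add, map_smul, LinearMap.add_apply, LinearMap.smul_apply, Complex.add_re]
  refine (norm_add_le _ _).trans ?_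
  refine (add_le_add (norm_add_le _ _) ((norm_smul_le _ _).trans_eq
    (by rw [nI, one_mul]))).trans ?_
  have h6 := norm_add_le ((V (rotPart 1 u x)) (rotPart 1 v y))
    (Complex.I • (V (rotPart Complex.I u x)) (rotPart 1 v y))
  have h7 := norm_add_le ((V (rotPart 1 u x)) (rotPart Complex.I v y))
    (Complex.I • (V (rotPart Complex.I u x)) (rotPart Complex.I v y))
  rw [norm_smul, nI, one_mul] at h6 h7
  first
    | linarith
    | (rw [norm_smul, nI, one_mul]; linarith)

end IsNearMax

theorem exists_isNearMax (V : A →ₗ[ℂ] A →ₗ[ℂ] ℂ) {K : ℝ}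
    (hK : ∀ x y, ‖V x y‖ ≤ K * ‖x‖ * ‖y‖) :
    ∃ N, ∀ η, 0 < η → ∃ u ∈ unitary A, ∃ v ∈ unitary A,
      IsNearMax (V.compl₁₂ (LinearMap.mulLeft ℂ u) (LinearMap.mulLeft ℂ v)) N η := by
  set S : Set ℝ := {t | ∃ u ∈ unitary A, ∃ v ∈ unitary A, t = ‖V u v‖} with hS
  have hK0 : ∀ u v : A, u ∈ unitary A → v ∈ unitary A → ‖V u v‖ ≤ |K| := by
    intro u v hu hv
    refine (hK u v).trans ?_
    have h1 := norm_le_one_of_mem_unitary hu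
    have h2 := norm_le_one_of_mem_unitary hv
    rw [mul_assoc]
    refine (mul_le_mul_of_nonneg_right (le_abs_self K) (by positivity)).trans ?_
    exact mul_le_of_le_one_right (abs_nonneg _) (mul_le_one₀ h1 (norm_nonneg _) h2)
  have hbdd : BddAbove S := ⟨|K|, by rintro t ⟨u, hu, v, hv, rfl⟩; exact hK0 u v hu hv⟩
  have hne : S.Nonempty := ⟨_, 1, one_mem _, 1, one_mem _, rfl⟩
  refine ⟨sSup S, fun η hη => ?_⟩
  obtain ⟨t, ⟨u, hu, v, hv, rfl⟩, ht⟩ := exists_lt_of_lt_csSup hne (sub_lt_self (sSup S) hη)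
  obtain ⟨c, hc, hcV⟩ : ∃ c : ℂ, ‖c‖ = 1 ∧ c * V u v = ‖V u v‖ := by
    by_cases h0 : V u v = 0
    · exact ⟨1, by simp, by simp [h0]⟩
    · have hn : (‖V u v‖ : ℂ) ≠ 0 := by simpa using h0
      refine ⟨(‖V u v‖ : ℂ) / V u v, ?_, div_mul_cancel₀ _ h0⟩
      rw [norm_div, Complex.norm_real, norm_norm, div_self (by simpa using h0)]
  have hcu : c • u ∈ unitary A := by
    have : star c * c = 1 := by
      rw [RCLike.star_def, Complex.conj_mul', hc]; simp
    rw [Unitary.mem_iff, star_smul, smul_mul_smul_comm, smul_mul_smul_comm, mul_comm c, this,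
      (Unitary.mem_iff.1 hu).1, (Unitary.mem_iff.1 hu).2, one_smul]
    exact ⟨rfl, rfl⟩
  refine ⟨c • u, hcu, v, hv, ⟨fun u' v' hu' hv' => ?_, ?_, hη.le⟩⟩
  · exact le_csSup hbdd ⟨_, mul_mem hcu hu', _, mul_mem hv hv', rfl⟩
  · simp only [LinearMap.compl₁₂_apply, LinearMap.mulLeft_apply, mul_one, map_smul,
      LinearMap.smul_apply, smul_eq_mul, hcV, Complex.ofReal_re]
    exact ht.le

theorem norm_conjAvg_le {u : A} (hu : u ∈ unitary A) (t : A) : ‖conjAvg u t‖ ≤ ‖t‖ := by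
  have h1 := norm_le_one_of_mem_unitary hu
  have h2 : ‖star u * t * u‖ ≤ ‖t‖ := by
    refine (norm_mul_le _ _).trans ((mul_le_of_le_one_right (norm_nonneg _) h1).trans ?_)
    refine (norm_mul_le _ _).trans ?_
    rw [norm_star]
    exact mul_le_of_le_one_left (norm_nonneg _) h1
  rw [conjAvg_apply, norm_smul, Real.norm_of_nonneg (by norm_num)]
  linarith [norm_add_le t (star u * t * u)]

theorem exists_approx_functionals (V : A →ₗ[ℂ] A →ₗ[ℂ] ℂ) {K : ℝ} (hK0 : 0 ≤ K)
    (hK : ∀ x y, ‖V x y‖ ≤ K * ‖x‖ * ‖y‖) {r : ℝ} (hr : 0 < r) :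
    ∃ Φ Ψ : A →ₗ[ℝ] ℝ, (∀ t, |Φ t| ≤ K * ‖t‖) ∧ (∀ t, |Ψ t| ≤ K * ‖t‖) ∧
      (∀ t, 0 ≤ t → t ≤ 1 → -r ≤ Φ t) ∧ (∀ t, 0 ≤ t → t ≤ 1 → -r ≤ Ψ t) ∧
      ∀ x y, IsSelfAdjoint x → ‖x‖ ≤ 1 → 0 ≤ y → y ≤ 1 →
        ‖V x y‖ ≤ 20 * (Φ (x * x) + Ψ y) + 160 * r := by
  obtain ⟨N, hN⟩ := exists_isNearMax V hK
  have hN0 : 0 ≤ N := by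
    obtain ⟨u, -, v, -, h⟩ := hN 1 one_pos
    exact h.nonneg
  set δ : ℝ := r / (2 * (N + 1 + r)) with hδ
  have hδ0 : 0 < δ := by positivity
  have hδ1 : δ ≤ 1 := by rw [hδ, div_le_one (by positivity)]; linarith
  have hδN : N * δ ≤ r / 2 := by
    rw [hδ, ← mul_div_assoc, div_le_div_iff₀ (by positivity) (by positivity)]
    nlinarith [mul_nonneg hN0 hr.le, mul_pos hr hr]
  have hsq : Real.sqrt δ ^ 2 = δ := Real.sq_sqrt hδ0.le
  have hη0 : 0 < r * δ / 6 := by positivity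
  obtain ⟨u, hu, v, hv, hV⟩ := hN (r * δ / 6) hη0
  have hηr : r * δ / 6 ≤ r := by nlinarith
  have hre := fun (a b : A) (ha : IsSelfAdjoint a) (ha1 : ‖a‖ ≤ 1) (hb : IsSelfAdjoint b)
    (hb1 : ‖b‖ ≤ 1) => hV.abs_re_le_add (ε := Real.sqrt δ) (r := r) (Real.sqrt_pos.2 hδ0)
      (Real.sqrt_le_one.2 hδ1) (by
        rw [hsq]
        have : 3 * (r * δ / 6) / δ = r / 2 := by field_simp; norm_num
        rw [this]; linarith) ha ha1 hb hb1
  set V' := V.compl₁₂ (LinearMap.mulLeft ℂ u) (LinearMap.mulLeft ℂ v) with hV'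
  have hK' : ∀ x y, ‖V' x y‖ ≤ K * ‖x‖ * ‖y‖ := by
    intro x y
    refine (hK _ _).trans ?_
    have h1 : ∀ u x : A, u ∈ unitary A → ‖u * x‖ ≤ ‖x‖ := fun u x hu =>
      (norm_mul_le _ _).trans
        (mul_le_of_le_one_left (norm_nonneg _) (norm_le_one_of_mem_unitary hu))
    have h2 := h1 u x hu
    have h3 := h1 v y hv
    simp only [LinearMap.mulLeft_apply]
    gcongr
  have hone : ‖(1 : A)‖ ≤ 1 := norm_le_one_of_mem_unitary (one_mem _)
  refine ⟨Complex.reLm ∘ₗ ((V'.flip 1).restrictScalars ℝ) ∘ₗ conjAvg u,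
    Complex.reLm ∘ₗ ((V' 1).restrictScalars ℝ) ∘ₗ conjAvg v, fun t => ?_, fun t => ?_,
    fun t h0 h1 => ?_, fun t h0 h1 => ?_, fun x y hx hx1 hy0 hy1 => ?_⟩
  · refine (Complex.abs_re_le_norm _).trans ((hK' (conjAvg u t) 1).trans ?_)
    have h1 := norm_conjAvg_le hu t
    calc _ ≤ K * ‖t‖ * 1 := by gcongr
      _ = _ := mul_one _
  · refine (Complex.abs_re_le_norm _).trans ((hK' 1 (conjAvg v t)).trans ?_)
    have h1 := norm_conjAvg_le hv t
    calc _ ≤ K * 1 * ‖t‖ := by gcongr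
      _ = _ := by rw [mul_one]
  · have := hV.neg_le_left (conjAvg_nonneg u h0) (conjAvg_le_one hu h1)
    exact (neg_le_neg hηr).trans this
  · have := hV.neg_le_right (conjAvg_nonneg v h0) (conjAvg_le_one hv h1)
    exact (neg_le_neg hηr).trans this
  · have := hV.norm_star_mul_le hηr hre hx hx1 hy0 hy1 hu hv
    have h4 : ∀ u x : A, u ∈ unitary A → u * (star u * x) = x := fun u x hu => by
      rw [← mul_assoc, (Unitary.mem_iff.1 hu).2, one_mul]
    have h5 : V' (star u * x) (star v * y) = V x y := by
      simp only [hV', LinearMap.compl₁₂_apply, LinearMap.mulLeft_apply, h4 u x hu, h4 v y hv]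
    rw [h5] at this
    exact this

/-- Positive functionals dominating a bounded bilinear form. -/
theorem exists_functionals (V : A →ₗ[ℂ] A →ₗ[ℂ] ℂ) {K : ℝ} (hK0 : 0 ≤ K)
    (hK : ∀ x y, ‖V x y‖ ≤ K * ‖x‖ * ‖y‖) :
    ∃ Φ Ψ : A →ₗ[ℝ] ℝ, (∀ t, 0 ≤ t → 0 ≤ Φ t) ∧ (∀ t, 0 ≤ t → 0 ≤ Ψ t) ∧
      ∀ x y, IsSelfAdjoint x → ‖x‖ ≤ 1 → 0 ≤ y → y ≤ 1 →
        ‖V x y‖ ≤ 20 * (Φ (x * x) + Ψ y) := by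
  have hr : ∀ n : ℕ, (0 : ℝ) < 1 / ((n : ℝ) + 1) := fun n => Nat.one_div_pos_of_nat
  choose f g hf hg hf0 hg0 hfg using fun n => exists_approx_functionals V hK0 hK (hr n)
  obtain ⟨Φ, hΦ⟩ := exists_ultralimit f (fun t => K * ‖t‖) hf
  obtain ⟨Ψ, hΨ⟩ := exists_ultralimit g (fun t => K * ‖t‖) hg
  have hlim : Tendsto (fun n : ℕ => 1 / ((n : ℝ) + 1)) (hyperfilter ℕ : Filter ℕ) (𝓝 0) :=
    tendsto_one_div_add_atTop_nhds_zero_nat.mono_left Nat.hyperfilter_le_atTop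
  have hposit : ∀ {h : ℕ → A →ₗ[ℝ] ℝ} {Χ : A →ₗ[ℝ] ℝ},
      (∀ (n : ℕ) t, 0 ≤ t → t ≤ 1 → -(1 / ((n : ℝ) + 1)) ≤ h n t) →
      (∀ x, Tendsto (fun n => h n x) (hyperfilter ℕ : Filter ℕ) (𝓝 (Χ x))) →
      ∀ t, 0 ≤ t → 0 ≤ Χ t := by
    intro h Χ hh hlimh t ht
    set c : ℝ := (‖t‖ + 1)⁻¹ with hc
    have hc0 : 0 < c := by positivity
    have h1 : c • t ≤ 1 := by
      refine (IsSelfAdjoint.of_nonneg (smul_nonneg hc0.le ht)).le_one_of_norm_le_one ?_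
      rw [norm_smul, Real.norm_of_nonneg hc0.le, hc, inv_mul_le_one₀ (by positivity)]
      linarith
    have h2 : 0 ≤ Χ (c • t) := by
      have h3 := hlim.neg
      rw [neg_zero] at h3
      exact le_of_tendsto_of_tendsto' h3 (hlimh (c • t))
        fun n => hh n _ (smul_nonneg hc0.le ht) h1
    rw [map_smul, smul_eq_mul] at h2
    exact nonneg_of_mul_nonneg_right h2 hc0
  refine ⟨Φ, Ψ, hposit hf0 hΦ, hposit hg0 hΨ, fun x y hx hx1 hy0 hy1 => ?_⟩
  have h1 := (((hΦ (x * x)).add (hΨ y)).const_mul 20).add (hlim.const_mul 160)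
  rw [mul_zero, add_zero] at h1
  exact ge_of_tendsto' h1 fun n => hfg n x y hx hx1 hy0 hy1

/-- A single positive functional controlling a bounded bilinear form in both variables. -/
theorem exists_control (V : A →ₗ[ℂ] A →ₗ[ℂ] ℂ) {K : ℝ} (hK0 : 0 ≤ K)
    (hK : ∀ x y, ‖V x y‖ ≤ K * ‖x‖ * ‖y‖) :
    ∃ Θ : A →ₗ[ℝ] ℝ, (∀ t, 0 ≤ t → 0 ≤ Θ t) ∧
      (∀ x y, IsSelfAdjoint x → ‖x‖ ≤ 1 → 0 ≤ y → y ≤ 1 → ‖V x y‖ ≤ 20 * (Θ (x * x) + Θ y)) ∧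
      ∀ x y, 0 ≤ x → x ≤ 1 → IsSelfAdjoint y → ‖y‖ ≤ 1 →
        ‖V x y‖ ≤ 20 * (Θ x + Θ (y * y)) := by
  obtain ⟨Φ, Ψ, hΦ, hΨ, h⟩ := exists_functionals V hK0 hK
  obtain ⟨Φ', Ψ', hΦ', hΨ', h'⟩ := exists_functionals V.flip hK0 (fun x y => by
    rw [LinearMap.flip_apply]; exact (hK y x).trans_eq (by ring))
  refine ⟨Φ + Ψ + Φ' + Ψ', fun t ht => ?_, fun x y hx hx1 hy0 hy1 => ?_,
    fun x y hx0 hx1 hy hy1 => ?_⟩ <;> simp only [LinearMap.add_apply]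
  · linarith [hΦ t ht, hΨ t ht, hΦ' t ht, hΨ' t ht]
  · have hxx := hx.mul_self_nonneg'
    linarith [h x y hx hx1 hy0 hy1, hΨ _ hxx, hΦ' _ hxx, hΨ' _ hxx, hΦ y hy0, hΦ' y hy0,
      hΨ' y hy0]
  · have hyy := hy.mul_self_nonneg'
    have := h' y x hy hy1 hx0 hx1
    rw [LinearMap.flip_apply] at this
    linarith [hΨ _ hyy, hΦ _ hyy, hΨ' _ hyy, hΦ x hx0, hΦ' x hx0, hΨ x hx0]

end Untwist

section Layers

variable {A : Type*} [CStarAlgebra A] [PartialOrder A] [StarOrderedRing A]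

/-- The part of `t` between consecutive powers of two. -/
noncomputable def layer : ℕ → ℝ → ℝ
  | 0, t => min (max t 0) 1
  | n + 1, t => min (max t 0) (2 ^ (n + 1)) - min (max t 0) (2 ^ n)

theorem continuous_layer (n : ℕ) : Continuous (layer n) := by
  cases n <;> unfold layer <;> fun_prop

theorem sum_layer (n : ℕ) (t : ℝ) :
    ∑ j ∈ Finset.range (n + 1), layer j t = min (max t 0) (2 ^ n) := by
  induction n with
  | zero => simp [layer]
  | succ n ih => rw [Finset.sum_range_succ, ih]; simp only [layer]; ring

theorem layer_nonneg (n : ℕ) (t : ℝ) : 0 ≤ layer n t := by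
  cases n with
  | zero => exact le_min (le_max_right _ _) zero_le_one
  | succ n =>
    exact sub_nonneg.2 (min_le_min_left _ (pow_le_pow_right₀ one_le_two n.le_succ))

theorem layer_le_pow (n : ℕ) (t : ℝ) : layer n t ≤ 2 ^ n := by
  cases n with
  | zero => simp [layer]
  | succ n =>
    have h1 : min (max t 0) (2 ^ (n + 1)) ≤ (2 : ℝ) ^ (n + 1) := min_le_right _ _
    have h2 : 0 ≤ min (max t 0) ((2 : ℝ) ^ n) := le_min (le_max_right _ _) (by positivity)
    simp only [layer]; linarith

theorem layer_succ_le (n : ℕ) (t : ℝ) :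
    layer (n + 1) t = 0 ∨ ((2 : ℝ) ^ n ≤ t ∧ layer (n + 1) t ≤ t) := by
  by_cases h : (2 : ℝ) ^ n ≤ t
  · right
    refine ⟨h, ?_⟩
    have h2 : 0 ≤ min (max t 0) ((2 : ℝ) ^ n) := le_min (le_max_right _ _) (by positivity)
    have h1 : min (max t 0) (2 ^ (n + 1)) ≤ max t 0 := min_le_left _ _
    have h0 : max t 0 = t := max_eq_left (le_trans (by positivity) h)
    simp only [layer]; linarith
  · left
    have h1 : max t 0 ≤ 2 ^ n := max_le (not_le.1 h).le (by positivity)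
    have h2 : max t 0 ≤ 2 ^ (n + 1) := h1.trans (pow_le_pow_right₀ one_le_two n.le_succ)
    simp only [layer]
    rw [min_eq_left h1, min_eq_left h2, sub_self]

theorem layer_le (n : ℕ) (t : ℝ) : layer n t ≤ 8 / (2 ^ n) ^ 3 * (1 + t ^ 4) := by
  have ht : 0 ≤ t ^ 4 := by positivity
  cases n with
  | zero =>
    have := layer_le_pow 0 t
    norm_num at this ⊢; linarith
  | succ n =>
    rcases layer_succ_le n t with h | ⟨h, h1⟩
    · rw [h]; positivity
    · have hp : (0 : ℝ) < 2 ^ n := by positivity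
      rw [div_mul_eq_mul_div, le_div_iff₀ (by positivity), pow_succ 2 n]
      have h2 : ((2 : ℝ) ^ n) ^ 3 ≤ t ^ 3 := pow_le_pow_left₀ hp.le h 3
      have h3 : 0 ≤ t := hp.le.trans h
      have h4 : layer (n + 1) t * (2 ^ n) ^ 3 ≤ t * t ^ 3 := mul_le_mul h1 h2 (by positivity) h3
      nlinarith

theorem layer_sq_le (n : ℕ) (t : ℝ) :
    layer n t * layer n t ≤ 4 / (2 ^ n) ^ 2 * (1 + t ^ 4) := by
  have ht : 0 ≤ t ^ 4 := by positivity
  cases n with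
  | zero =>
    have := layer_le_pow 0 t
    have := layer_nonneg 0 t
    norm_num at *; nlinarith
  | succ n =>
    rcases layer_succ_le n t with h | ⟨h, h1⟩
    · rw [h, zero_mul]; positivity
    · have hp : (0 : ℝ) < 2 ^ n := by positivity
      rw [div_mul_eq_mul_div, le_div_iff₀ (by positivity), pow_succ 2 n]
      have h2 : ((2 : ℝ) ^ n) ^ 2 ≤ t ^ 2 := pow_le_pow_left₀ hp.le h 2
      have h3 : 0 ≤ t := hp.le.trans h
      have h0 := layer_nonneg (n + 1) t
      have h5 : layer (n + 1) t * layer (n + 1) t ≤ t * t := mul_le_mul h1 h1 h0 h3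
      have h4 : layer (n + 1) t * layer (n + 1) t * (2 ^ n) ^ 2 ≤ t * t * t ^ 2 :=
        mul_le_mul h5 h2 (by positivity) (by positivity)
      nlinarith

theorem cfc_le_smul_one_add_pow {X : A} (hX : IsSelfAdjoint X) {f : ℝ → ℝ} (hf : Continuous f)
    {c : ℝ} (h : ∀ t, f t ≤ c * (1 + t ^ 4)) : cfc f X ≤ c • (1 + X ^ 4) := by
  have h1 : c • (1 + X ^ 4) = cfc (fun t : ℝ => c * (1 + t ^ 4)) X := by
    rw [cfc_const_mul c (fun t : ℝ => 1 + t ^ 4) X, cfc_const_add 1 (fun t : ℝ => t ^ 4) X,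
      cfc_pow_id X 4, map_one]
  rw [h1]
  exact cfc_mono fun t _ => h t

theorem exists_layers {Θ : A →ₗ[ℝ] ℝ} (hΘ : ∀ t, 0 ≤ t → 0 ≤ Θ t) {X : A}
    (hX : IsSelfAdjoint X) :
    ∃ P : ℕ × Bool → A, (∀ i, 0 ≤ P i) ∧ (∀ i, ‖P i‖ ≤ 2 ^ i.1) ∧
      (∀ i, Θ (P i) ≤ 8 / (2 ^ i.1) ^ 3 * Θ (1 + X ^ 4)) ∧
      (∀ i, Θ (P i * P i) ≤ 4 / (2 ^ i.1) ^ 2 * Θ (1 + X ^ 4)) ∧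
      ∀ n, ‖X‖ ≤ 2 ^ n → X = ∑ j ∈ Finset.range (n + 1), (P (j, true) - P (j, false)) := by
  have hmono : ∀ a b, a ≤ b → Θ a ≤ Θ b := fun a b h => by
    have := hΘ _ (sub_nonneg.2 h); rw [map_sub] at this; linarith
  set F : ℕ × Bool → ℝ → ℝ := fun i t => layer i.1 (bif i.2 then t else -t) with hF
  have hFc : ∀ i, Continuous (F i) := by
    rintro ⟨j, b⟩
    cases b
    · exact (continuous_layer j).comp continuous_neg
    · exact continuous_layer j
  have ht4 : ∀ (b : Bool) (t : ℝ), (bif b then t else -t) ^ 4 = t ^ 4 := by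
    intro b t; cases b
    · simp only [cond_false]; ring
    · simp only [cond_true]
  refine ⟨fun i => cfc (F i) X, fun i => cfc_nonneg fun t _ => layer_nonneg _ _, fun i => ?_,
    fun i => ?_, fun i => ?_, fun n hn => ?_⟩
  · refine norm_cfc_le (by positivity) fun t _ => ?_
    rw [Real.norm_of_nonneg (layer_nonneg _ _)]
    exact layer_le_pow _ _
  · rw [← smul_eq_mul, ← map_smul]
    refine hmono _ _ (cfc_le_smul_one_add_pow hX (hFc i) fun t => ?_)
    have := layer_le i.1 (bif i.2 then t else -t)
    rwa [ht4] at this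
  · show Θ (cfc (F i) X * cfc (F i) X) ≤ _
    rw [← smul_eq_mul (_ / _), ← map_smul, ← cfc_mul (F i) (F i) X (hFc i).continuousOn (hFc i).continuousOn]
    refine hmono _ _ (cfc_le_smul_one_add_pow hX ((hFc i).mul (hFc i)) fun t => ?_)
    have := layer_sq_le i.1 (bif i.2 then t else -t)
    rwa [ht4] at this
  · have h1 : ∀ j, cfc (F (j, true)) X - cfc (F (j, false)) X
        = cfc (fun t => F (j, true) t - F (j, false) t) X := fun j =>
      (cfc_sub (F (j, true)) (F (j, false)) X (hFc _).continuousOn (hFc _).continuousOn).symm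
    simp only [h1]
    rw [← cfc_sum (fun j t => F (j, true) t - F (j, false) t) X (Finset.range (n + 1))
      fun j _ => ((hFc _).sub (hFc _)).continuousOn]
    conv_lhs => rw [← cfc_id ℝ X]
    refine cfc_congr fun t ht => ?_
    have htn : |t| ≤ 2 ^ n := by
      have := spectrum.norm_le_norm_mul_of_mem ht
      refine le_trans ?_ hn
      refine this.trans (mul_le_of_le_one_right (norm_nonneg _) ?_)
      exact norm_le_one_of_mem_unitary (one_mem _)
    rw [abs_le] at htn
    have h2 := sum_layer n t
    have h3 := sum_layer n (-t)
    simp only [Finset.sum_apply, Finset.sum_sub_distrib, hF, cond_true, cond_false, h2, h3, id]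
    rw [min_eq_left (max_le htn.2 (by positivity)),
      min_eq_left (max_le (by linarith) (by positivity))]
    exact (max_zero_sub_max_neg_zero_eq_self t).symm

variable {V : A →ₗ[ℂ] A →ₗ[ℂ] ℂ} {Θ : A →ₗ[ℝ] ℝ}

theorem norm_le_of_control_left
    (hV : ∀ x y, IsSelfAdjoint x → ‖x‖ ≤ 1 → 0 ≤ y → y ≤ 1 → ‖V x y‖ ≤ 20 * (Θ (x * x) + Θ y))
    {h k : A} {R S : ℝ} (hR : 0 < R) (hS : 0 < S) (hh : IsSelfAdjoint h) (hhR : ‖h‖ ≤ R)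
    (hk : 0 ≤ k) (hkS : ‖k‖ ≤ S) :
    ‖V h k‖ ≤ 20 * (S / R * Θ (h * h) + R * Θ k) := by
  have hre : ∀ (t : ℝ) (x : A), t • x = (t : ℂ) • x := fun t x => (Complex.coe_smul t x).symm
  have hk0 := smul_nonneg (inv_nonneg.2 hS.le) hk
  have h1 := hV (R⁻¹ • h) (S⁻¹ • k) ((IsSelfAdjoint.all R⁻¹).smul hh)
    (by rw [norm_smul, Real.norm_of_nonneg (inv_nonneg.2 hR.le)]; exact (inv_mul_le_one₀ hR).2 hhR)
    hk0 ((IsSelfAdjoint.of_nonneg hk0).le_one_of_norm_le_one (by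
      rw [norm_smul, Real.norm_of_nonneg (inv_nonneg.2 hS.le)]; exact (inv_mul_le_one₀ hS).2 hkS))
  have h2 : ‖V (R⁻¹ • h) (S⁻¹ • k)‖ = R⁻¹ * S⁻¹ * ‖V h k‖ := by
    rw [hre, hre, map_smul, map_smul, LinearMap.smul_apply, norm_smul, norm_smul, Complex.norm_real,
      Complex.norm_real, Real.norm_of_nonneg (inv_nonneg.2 hS.le),
      Real.norm_of_nonneg (inv_nonneg.2 hR.le)]
    ring
  rw [h2, smul_mul_smul_comm, map_smul, map_smul, smul_eq_mul, smul_eq_mul] at h1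
  have h3 := mul_le_mul_of_nonneg_left h1 (mul_pos hR hS).le
  have h4 : R * S * (R⁻¹ * S⁻¹ * ‖V h k‖) = ‖V h k‖ := by field_simp
  have h5 : R * S * (20 * (R⁻¹ * R⁻¹ * Θ (h * h) + S⁻¹ * Θ k))
    = 20 * (S / R * Θ (h * h) + R * Θ k) := by field_simp
  rwa [h4, h5] at h3

theorem norm_le_quartic (hΘ : ∀ t, 0 ≤ t → 0 ≤ Θ t)
    (hl : ∀ x y, IsSelfAdjoint x → ‖x‖ ≤ 1 → 0 ≤ y → y ≤ 1 → ‖V x y‖ ≤ 20 * (Θ (x * x) + Θ y))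
    (hr : ∀ x y, 0 ≤ x → x ≤ 1 → IsSelfAdjoint y → ‖y‖ ≤ 1 → ‖V x y‖ ≤ 20 * (Θ x + Θ (y * y)))
    {X Y : A} (hX : IsSelfAdjoint X) (hY : IsSelfAdjoint Y) :
    ‖V X Y‖ ≤ 2560 * (Θ (1 + X ^ 4) + Θ (1 + Y ^ 4)) := by
  obtain ⟨P, hP0, hPn, hPΘ, hPΘ2, hPX⟩ := exists_layers hΘ hX
  obtain ⟨Q, hQ0, hQn, hQΘ, hQΘ2, hQY⟩ := exists_layers hΘ hY
  have hq : ∀ Z : A, IsSelfAdjoint Z → 0 ≤ Θ (1 + Z ^ 4) := by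
    intro Z hZ
    refine hΘ _ (add_nonneg zero_le_one ?_)
    have := (hZ.pow 2).mul_self_nonneg'
    rwa [← pow_add] at this
  have hqX := hq X hX
  have hqY := hq Y hY
  set qX := Θ (1 + X ^ 4)
  set qY := Θ (1 + Y ^ 4)
  have hr' : ∀ x y, IsSelfAdjoint x → ‖x‖ ≤ 1 → 0 ≤ y → y ≤ 1 →
      ‖V.flip x y‖ ≤ 20 * (Θ (x * x) + Θ y) := by
    intro x y hx hx1 hy0 hy1
    rw [LinearMap.flip_apply, add_comm]
    exact hr y x hy0 hy1 hx hx1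
  have hbound : ∀ (a b x y x' y' : ℝ), 0 < a → a ≤ b → x' ≤ 4 / a ^ 2 * x → y' ≤ 8 / b ^ 3 * y →
      0 ≤ x → 0 ≤ y → 20 * (b / (b ^ 2 / a) * x' + b ^ 2 / a * y') ≤ 160 * (x + y) * (a⁻¹ * b⁻¹) := by
    intro a b x y x' y' ha hab hx' hy' hx hy
    have hb : 0 < b := ha.trans_le hab
    calc 20 * (b / (b ^ 2 / a) * x' + b ^ 2 / a * y')
        ≤ 20 * (b / (b ^ 2 / a) * (4 / a ^ 2 * x) + b ^ 2 / a * (8 / b ^ 3 * y)) := by gcongr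
      _ = (80 * x + 160 * y) * (a⁻¹ * b⁻¹) := by field_simp; ring
      _ ≤ _ := by gcongr; linarith
  have hPQ : ∀ i k, ‖V (P i) (Q k)‖ ≤ 160 * (qX + qY) * ((1 / 2) ^ i.1 * (1 / 2) ^ k.1) := by
    intro i k
    rw [one_div, inv_pow, inv_pow]
    have hi : (0 : ℝ) < 2 ^ i.1 := by positivity
    have hk : (0 : ℝ) < 2 ^ k.1 := by positivity
    rcases le_total ((2 : ℝ) ^ i.1) (2 ^ k.1) with h | h
    · refine (norm_le_of_control_left hl (R := (2 ^ k.1) ^ 2 / 2 ^ i.1) (S := 2 ^ k.1)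
        (by positivity) hk (.of_nonneg (hP0 i)) ((hPn i).trans ?_) (hQ0 k) (hQn k)).trans ?_
      · rw [le_div_iff₀ hi, sq]; gcongr
      · exact hbound _ _ _ _ _ _ hi h (hPΘ2 i) (hQΘ k) hqX hqY
    · have := (norm_le_of_control_left hr' (R := (2 ^ i.1) ^ 2 / 2 ^ k.1) (S := 2 ^ i.1)
        (by positivity) hi (.of_nonneg (hQ0 k)) ((hQn k).trans (by
          rw [le_div_iff₀ hk, sq]; gcongr)) (hP0 i) (hPn i)).trans
        (hbound _ _ _ _ _ _ hk h (hQΘ2 k) (hPΘ i) hqY hqX)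
      rwa [LinearMap.flip_apply, add_comm qY, mul_comm (_ : ℝ)⁻¹] at this
  obtain ⟨n, hn⟩ : ∃ n : ℕ, max ‖X‖ ‖Y‖ < (2 : ℝ) ^ n := pow_unbounded_of_one_lt _ one_lt_two
  rw [hPX n ((le_max_left _ _).trans hn.le), hQY n ((le_max_right _ _).trans hn.le)]
  simp only [map_sum, LinearMap.sum_apply]
  have hterm : ∀ j k, ‖V (P (j, true) - P (j, false)) (Q (k, true) - Q (k, false))‖ ≤
      640 * (qX + qY) * ((1 / 2) ^ j * (1 / 2) ^ k) := by
    intro j k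
    simp only [map_sub, LinearMap.sub_apply]
    refine (norm_sub_le _ _).trans ?_
    have h1 := norm_sub_le (V (P (j, true)) (Q (k, true))) (V (P (j, false)) (Q (k, true)))
    have h2 := norm_sub_le (V (P (j, true)) (Q (k, false))) (V (P (j, false)) (Q (k, false)))
    have h3 := hPQ (j, true) (k, true)
    have h4 := hPQ (j, true) (k, false)
    have h5 := hPQ (j, false) (k, true)
    have h6 := hPQ (j, false) (k, false)
    simp only at h3 h4 h5 h6
    linarith
  have hgeom : ∀ n, ∑ j ∈ Finset.range n, ((1 : ℝ) / 2) ^ j ≤ 2 := fun n => sum_geometric_two_le n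
  have hgeom0 : ∀ n, 0 ≤ ∑ j ∈ Finset.range n, ((1 : ℝ) / 2) ^ j := fun n =>
    Finset.sum_nonneg fun j _ => by positivity
  calc _ ≤ ∑ k ∈ Finset.range (n + 1), ∑ j ∈ Finset.range (n + 1),
        640 * (qX + qY) * ((1 / 2) ^ j * (1 / 2) ^ k) :=
        (norm_sum_le _ _).trans (Finset.sum_le_sum fun k _ => (norm_sum_le _ _).trans
          (Finset.sum_le_sum fun j _ => hterm j k))
    _ = 640 * (qX + qY) * ((∑ j ∈ Finset.range (n + 1), (1 / 2) ^ j) *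
        ∑ k ∈ Finset.range (n + 1), (1 / 2) ^ k) := by
        rw [Finset.sum_comm, Finset.sum_mul_sum, Finset.mul_sum]
        simp only [Finset.mul_sum]
    _ ≤ 640 * (qX + qY) * (2 * 2) := by
        gcongr
        · exact hgeom _
        · exact hgeom _
    _ = _ := by ring

end Layers

section Square

variable {A : Type*} [CStarAlgebra A] [PartialOrder A] [StarOrderedRing A]

/-- The sum of the compressions `h * z * h` over a list. -/
def conjSum (l : List A) (z : A) : A := (l.map fun h => h * z * h).sum

theorem conjSum_nil (z : A) : conjSum [] z = 0 := rfl

theorem conjSum_cons (h : A) (l : List A) (z : A) :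
    conjSum (h :: l) z = h * z * h + conjSum l z := by simp [conjSum]

theorem conjSum_append (l l' : List A) (z : A) :
    conjSum (l ++ l') z = conjSum l z + conjSum l' z := by simp [conjSum]

theorem conjSum_add (l : List A) (y z : A) : conjSum l (y + z) = conjSum l y + conjSum l z := by
  induction l with
  | nil => simp [conjSum_nil]
  | cons h l ih => rw [conjSum_cons, conjSum_cons, conjSum_cons, ih, mul_add, add_mul]; abel

theorem conjSum_nonneg {l : List A} (hl : ∀ h ∈ l, IsSelfAdjoint h) {z : A} (hz : 0 ≤ z) :
    0 ≤ conjSum l z := by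
  induction l with
  | nil => exact le_rfl
  | cons h l ih =>
    rw [conjSum_cons]
    exact add_nonneg (conj_mul_nonneg hz (hl h (by simp)))
      (ih fun k hk => hl k (List.mem_cons_of_mem _ hk))

theorem conjSum_mono {l : List A} (hl : ∀ h ∈ l, IsSelfAdjoint h) {y z : A} (h : y ≤ z) :
    conjSum l y ≤ conjSum l z := by
  have h1 := conjSum_nonneg hl (sub_nonneg.2 h)
  have h2 := conjSum_add l (z - y) y
  rw [sub_add_cancel] at h2
  rw [h2]
  exact le_add_of_nonneg_left h1

/-- A quartic majorant for the averaging argument. -/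
def quartic (X : A) (l : List A) : A :=
  X ^ 4 + X * X * conjSum l 1 + conjSum l 1 * (X * X) + 2 * (X * conjSum l 1 * X)
    + 2 * conjSum l (X * X) + conjSum l 1 * conjSum l 1 + 2 * conjSum l (conjSum l 1)

theorem quartic_nil (X : A) : quartic X [] = X ^ 4 := by simp [quartic, conjSum_nil]

theorem quartic_average_le {X h : A} (hX : IsSelfAdjoint X) (hh : IsSelfAdjoint h) (l : List A) :
    quartic (X + h) l + quartic (X - h) l ≤ 2 * quartic X (h :: l) := by
  have h1 : 0 ≤ (X * h - h * X) * (h * X - X * h) := by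
    have := mul_star_self_nonneg (X * h - h * X)
    rwa [star_sub, star_mul, star_mul, hX.star_eq, hh.star_eq] at this
  have h2 : 0 ≤ h * h * (h * h) :=
    (show IsSelfAdjoint (h * h) by rw [← sq]; exact hh.pow 2).mul_self_nonneg'
  have h3 : 0 ≤ 2 * ((X * h - h * X) * (h * X - X * h)) + 4 * (h * h * (h * h)) :=
    add_nonneg (by rw [two_mul]; exact add_nonneg h1 h1) (by
      rw [show (4 : A) * (h * h * (h * h)) = 2 * (2 * (h * h * (h * h))) by noncomm_ring,
        two_mul, two_mul]
      exact add_nonneg (add_nonneg h2 h2) (add_nonneg h2 h2))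
  rw [← sub_nonneg]
  refine h3.trans_eq ?_
  have e1 : conjSum l ((X + h) * (X + h)) + conjSum l ((X - h) * (X - h)) =
      2 * conjSum l (X * X) + 2 * conjSum l (h * h) := by
    rw [← conjSum_add, two_mul, two_mul, ← conjSum_add, ← conjSum_add, ← conjSum_add]
    congr 1; noncomm_ring
  have e2 : conjSum l (h * 1 * h + conjSum l 1) = conjSum l (h * h) + conjSum l (conjSum l 1) := by
    rw [conjSum_add, mul_one]
  simp only [quartic, conjSum_cons]
  rw [e2]
  rw [eq_comm, ← sub_eq_zero]
  rw [← sub_eq_zero] at e1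
  rw [← mul_zero (-2 : A), ← e1]
  generalize conjSum l 1 = S
  generalize conjSum l ((X + h) * (X + h)) = a
  generalize conjSum l ((X - h) * (X - h)) = b
  generalize conjSum l (X * X) = c
  generalize conjSum l (h * h) = d
  generalize conjSum l S = e
  noncomm_ring

variable {V : A →ₗ[ℂ] A →ₗ[ℂ] ℂ} {Θ : A →ₗ[ℝ] ℝ} {C : ℝ}

theorem re_add_sum_le (hΘ : ∀ t, 0 ≤ t → 0 ≤ Θ t) (hC : 0 ≤ C)
    (hV : ∀ X Y, IsSelfAdjoint X → IsSelfAdjoint Y →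
      (V X Y).re ≤ C * (Θ (1 + X ^ 4) + Θ (1 + Y ^ 4)))
    (l : List (A × A)) (hl : ∀ i ∈ l, IsSelfAdjoint i.1 ∧ IsSelfAdjoint i.2) :
    ∀ X Y : A, IsSelfAdjoint X → IsSelfAdjoint Y →
      (V X Y).re + (l.map fun i => (V i.1 i.2).re).sum ≤
        C * (Θ (1 + quartic X (l.map Prod.fst)) + Θ (1 + quartic Y (l.map Prod.snd))) := by
  have hmono : ∀ a b, a ≤ b → Θ a ≤ Θ b := fun a b h => by
    have := hΘ _ (sub_nonneg.2 h); rw [map_sub] at this; linarith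
  induction l with
  | nil =>
    intro X Y hX hY
    simpa [quartic_nil] using hV X Y hX hY
  | cons i l ih =>
    intro X Y hX hY
    obtain ⟨h, k⟩ := i
    obtain ⟨hh, hk⟩ := hl (h, k) (by simp)
    simp only at hh hk
    have ih' := ih fun i hi => hl i (List.mem_cons_of_mem _ hi)
    have h1 := ih' _ _ (hX.add hh) (hY.add hk)
    have h2 := ih' _ _ (hX.sub hh) (hY.sub hk)
    have h3 : ∀ (X h : A) (l : List A), IsSelfAdjoint X → IsSelfAdjoint h →
        Θ (1 + quartic (X + h) l) + Θ (1 + quartic (X - h) l) ≤ 2 * Θ (1 + quartic X (h :: l)) := by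
      intro X h l hX hh
      have := hmono _ _ (quartic_average_le hX hh l)
      rw [two_mul, map_add, map_add] at this
      simp only [map_add]; linarith
    have h4 := mul_le_mul_of_nonneg_left (h3 X h (l.map Prod.fst) hX hh) hC
    have h5 := mul_le_mul_of_nonneg_left (h3 Y k (l.map Prod.snd) hY hk) hC
    simp only [map_add, map_sub, LinearMap.add_apply, LinearMap.sub_apply, Complex.add_re,
      Complex.sub_re, List.map_cons, List.sum_cons] at h1 h2 h4 h5 ⊢
    linarith

theorem sum_re_le_of_le_one (hΘ : ∀ t, 0 ≤ t → 0 ≤ Θ t) (hC : 0 ≤ C)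
    (hV : ∀ X Y, IsSelfAdjoint X → IsSelfAdjoint Y →
      (V X Y).re ≤ C * (Θ (1 + X ^ 4) + Θ (1 + Y ^ 4)))
    (l : List (A × A)) (hl : ∀ i ∈ l, IsSelfAdjoint i.1 ∧ IsSelfAdjoint i.2)
    (h1 : conjSum (l.map Prod.fst) 1 ≤ 1) (h2 : conjSum (l.map Prod.snd) 1 ≤ 1) :
    (l.map fun i => (V i.1 i.2).re).sum ≤ 8 * C * Θ 1 := by
  have hmono : ∀ a b, a ≤ b → Θ a ≤ Θ b := fun a b h => by
    have := hΘ _ (sub_nonneg.2 h); rw [map_sub] at this; linarith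
  have h := re_add_sum_le hΘ hC hV l hl 0 0 (.zero A) (.zero A)
  have hq : ∀ l : List A, (∀ h ∈ l, IsSelfAdjoint h) → conjSum l 1 ≤ 1 →
      Θ (1 + quartic 0 l) ≤ 4 * Θ 1 := by
    intro l hl h1
    have h0 := conjSum_nonneg hl (zero_le_one (α := A))
    have e1 := hmono _ _ ((mul_self_le_of_le_one h0 h1).trans h1)
    have e2 := hmono _ _ ((conjSum_mono hl h1).trans h1)
    have hz : conjSum l 0 = 0 := by
      have := conjSum_add l 0 0
      rwa [add_zero, left_eq_add] at this
    simp only [quartic, mul_zero, zero_mul, hz, zero_add, add_zero, two_mul, map_add, ne_eq,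
      OfNat.ofNat_ne_zero, not_false_eq_true, zero_pow]
    linarith
  have h3 := hq (l.map Prod.fst) (by
    intro h hh; obtain ⟨i, hi, rfl⟩ := List.mem_map.1 hh; exact (hl i hi).1) h1
  have h4 := hq (l.map Prod.snd) (by
    intro h hh; obtain ⟨i, hi, rfl⟩ := List.mem_map.1 hh; exact (hl i hi).2) h2
  rw [map_zero, Complex.zero_re, zero_add] at h
  refine h.trans ((mul_le_mul_of_nonneg_left (add_le_add h3 h4) hC).trans_eq (by ring))

theorem sum_re_le (hΘ : ∀ t, 0 ≤ t → 0 ≤ Θ t) (hC : 0 ≤ C)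
    (hV : ∀ X Y, IsSelfAdjoint X → IsSelfAdjoint Y →
      (V X Y).re ≤ C * (Θ (1 + X ^ 4) + Θ (1 + Y ^ 4)))
    (l : List (A × A)) (hl : ∀ i ∈ l, IsSelfAdjoint i.1 ∧ IsSelfAdjoint i.2) {t : ℝ} (ht : 0 < t)
    (h1 : conjSum (l.map Prod.fst) 1 ≤ t • 1) (h2 : conjSum (l.map Prod.snd) 1 ≤ t • 1) :
    (l.map fun i => (V i.1 i.2).re).sum ≤ 8 * C * Θ 1 * t := by
  set c : ℝ := (Real.sqrt t)⁻¹ with hc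
  have hcc : c * c = t⁻¹ := by rw [hc, ← mul_inv, Real.mul_self_sqrt ht.le]
  have hsc : ∀ l : List A, conjSum (l.map fun h => c • h) 1 = t⁻¹ • conjSum l 1 := by
    intro l
    induction l with
    | nil => simp [conjSum_nil]
    | cons h l ih =>
      rw [List.map_cons, conjSum_cons, ih, conjSum_cons, smul_add, mul_one, mul_one,
        smul_mul_smul_comm, hcc]
  have hle : ∀ l : List A, conjSum l 1 ≤ t • 1 → conjSum (l.map fun h => c • h) 1 ≤ 1 := by
    intro l h
    rw [hsc]
    have := smul_le_smul_of_nonneg_left h (inv_nonneg.2 ht.le)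
    rwa [smul_smul, inv_mul_cancel₀ ht.ne', one_smul] at this
  have h := sum_re_le_of_le_one hΘ hC hV (l.map fun i => (c • i.1, c • i.2)) (by
      intro i hi
      obtain ⟨j, hj, rfl⟩ := List.mem_map.1 hi
      exact ⟨(IsSelfAdjoint.all c).smul (hl j hj).1, (IsSelfAdjoint.all c).smul (hl j hj).2⟩)
    (by have := hle _ h1; rw [List.map_map] at this ⊢; exact this)
    (by have := hle _ h2; rw [List.map_map] at this ⊢; exact this)
  have hre : ∀ (t : ℝ) (x : A), t • x = (t : ℂ) • x := fun t x => (Complex.coe_smul t x).symm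
  have hs : ((l.map fun i => (c • i.1, c • i.2)).map fun i => (V i.1 i.2).re).sum
      = t⁻¹ * (l.map fun i => (V i.1 i.2).re).sum := by
    rw [List.map_map, ← List.sum_map_mul_left]
    congr 1
    refine List.map_congr_left fun i _ => ?_
    simp only [Function.comp, hre, map_smul, LinearMap.smul_apply, smul_eq_mul,
      Complex.re_ofReal_mul]
    rw [← mul_assoc, hcc]
  rw [hs, inv_mul_le_iff₀ ht] at h
  linarith

end Square

section Domination

variable {A : Type*} [CStarAlgebra A] [PartialOrder A] [StarOrderedRing A]

theorem half_star_mul_add (x : A) :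
    (1 / 2 : ℝ) • (star x * x + x * star x)
      = (realPart x : A) * (realPart x : A) + (imaginaryPart x : A) * (imaginaryPart x : A) := by
  rw [star_mul_self_add_self_mul_star, ← Nat.cast_smul_eq_nsmul ℝ, smul_smul]
  norm_num

theorem re_apply_star (V : A →ₗ[ℂ] A →ₗ[ℂ] ℂ) (x : A) :
    (V x (star x)).re = (V (realPart x) (realPart x)).re + (V (imaginaryPart x) (imaginaryPart x)).re
      + (((Complex.I • V) (imaginaryPart x) (realPart x)).re
        + ((Complex.I • V) (-(realPart x : A)) (imaginaryPart x)).re) := by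
  have h1 : star x = (realPart x : A) - Complex.I • (imaginaryPart x : A) := by
    conv_lhs => rw [← realPart_add_I_smul_imaginaryPart x]
    rw [star_add, star_smul, (realPart x).2.star_eq, (imaginaryPart x).2.star_eq, RCLike.star_def,
      Complex.conj_I, neg_smul, sub_eq_add_neg]
  have h2 := (realPart_add_I_smul_imaginaryPart x).symm
  generalize (realPart x : A) = a at *
  generalize (imaginaryPart x : A) = b at *
  rw [h1, h2]
  simp only [map_add, map_sub, map_neg, map_smul, LinearMap.add_apply, LinearMap.smul_apply,
    LinearMap.neg_apply, smul_eq_mul, Complex.add_re, Complex.sub_re, Complex.neg_re,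
    Complex.mul_re, Complex.add_im, Complex.mul_im, Complex.I_re, Complex.I_im]
  ring

theorem exists_sum_re_le (V : A →ₗ[ℂ] A →ₗ[ℂ] ℂ) {K : ℝ} (hK0 : 0 ≤ K)
    (hK : ∀ x y, ‖V x y‖ ≤ K * ‖x‖ * ‖y‖) :
    ∃ C : ℝ, 0 ≤ C ∧ ∀ (xs : List A) (t : ℝ), 0 < t →
      (xs.map fun x => (1 / 2 : ℝ) • (star x * x + x * star x)).sum ≤ t • 1 →
      (xs.map fun x => (V x (star x)).re).sum ≤ C * t := by
  obtain ⟨Θ, hΘ, hl, hr⟩ := exists_control V hK0 hK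
  have hV : ∀ X Y, IsSelfAdjoint X → IsSelfAdjoint Y →
      (V X Y).re ≤ 2560 * (Θ (1 + X ^ 4) + Θ (1 + Y ^ 4)) := fun X Y hX hY =>
    (Complex.re_le_norm _).trans (norm_le_quartic hΘ hl hr hX hY)
  have hIV : ∀ X Y, IsSelfAdjoint X → IsSelfAdjoint Y →
      ((Complex.I • V) X Y).re ≤ 2560 * (Θ (1 + X ^ 4) + Θ (1 + Y ^ 4)) := fun X Y hX hY => by
    refine (Complex.re_le_norm _).trans ?_
    rw [LinearMap.smul_apply, LinearMap.smul_apply, norm_smul, Complex.norm_I, one_mul]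
    exact norm_le_quartic hΘ hl hr hX hY
  refine ⟨16 * 2560 * Θ 1, by have := hΘ 1 zero_le_one; positivity, fun xs t ht hxs => ?_⟩
  set l : List (A × A) := xs.map (fun x => ((realPart x : A), (realPart x : A))) ++
    xs.map (fun x => ((imaginaryPart x : A), (imaginaryPart x : A))) with hl'
  set l' : List (A × A) := xs.map (fun x => ((imaginaryPart x : A), (realPart x : A))) ++
    xs.map (fun x => (-(realPart x : A), (imaginaryPart x : A))) with hl''
  have hsum : ∀ f g : A → A, (∀ x, f x * f x + g x * g x = (1 / 2 : ℝ) • (star x * x + x * star x)) →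
      conjSum (xs.map f ++ xs.map g) 1 ≤ t • 1 := by
    intro f g h
    refine le_of_eq_of_le ?_ hxs
    rw [conjSum_append, conjSum, conjSum, List.map_map, List.map_map, ← List.sum_map_add]
    congr 1
    refine List.map_congr_left fun x _ => ?_
    simp only [Function.comp, mul_one, h]
  have h1 := sum_re_le hΘ (by norm_num) hV l (by
      intro i hi
      rcases List.mem_append.1 hi with h | h <;> obtain ⟨x, -, rfl⟩ := List.mem_map.1 h
      · exact ⟨(realPart x).2, (realPart x).2⟩
      · exact ⟨(imaginaryPart x).2, (imaginaryPart x).2⟩) ht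
    (by
      rw [hl', List.map_append, List.map_map, List.map_map]
      exact hsum _ _ fun x => (half_star_mul_add x).symm)
    (by
      rw [hl', List.map_append, List.map_map, List.map_map]
      exact hsum _ _ fun x => (half_star_mul_add x).symm)
  have h2 := sum_re_le hΘ (by norm_num) hIV l' (by
      intro i hi
      rcases List.mem_append.1 hi with h | h <;> obtain ⟨x, -, rfl⟩ := List.mem_map.1 h
      · exact ⟨(imaginaryPart x).2, (realPart x).2⟩
      · exact ⟨(realPart x).2.neg, (imaginaryPart x).2⟩) ht
    (by
      rw [hl'', List.map_append, List.map_map, List.map_map]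
      exact hsum _ _ fun x => by
        simp only [Function.comp, neg_mul_neg]; rw [half_star_mul_add, add_comm])
    (by
      rw [hl'', List.map_append, List.map_map, List.map_map]
      exact hsum _ _ fun x => by
        simp only [Function.comp]; rw [half_star_mul_add])
  have h3 : (xs.map fun x => (V x (star x)).re).sum = (l.map fun i => (V i.1 i.2).re).sum +
      (l'.map fun i => ((Complex.I • V) i.1 i.2).re).sum := by
    rw [hl', hl'', List.map_append, List.map_append, List.map_map, List.map_map, List.map_map,
      List.map_map, List.sum_append, List.sum_append, ← List.sum_map_add, ← List.sum_map_add,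
      ← List.sum_map_add]
    congr 1
    refine List.map_congr_left fun x _ => ?_
    rw [re_apply_star]
    rfl
  rw [h3]
  linarith

variable [Nontrivial A]

/-- A bounded bilinear form is dominated on the diagonal by a state. -/
theorem exists_dominating_functional (V : A →ₗ[ℂ] A →ₗ[ℂ] ℂ) {K : ℝ} (hK0 : 0 ≤ K)
    (hK : ∀ x y, ‖V x y‖ ≤ K * ‖x‖ * ‖y‖) :
    ∃ (C : ℝ) (g : A →ₗ[ℝ] ℝ), 0 < C ∧ (∀ z, 0 ≤ z → 0 ≤ g z) ∧ g 1 = 1 ∧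
      ∀ x, (V x (star x)).re ≤ C * g ((1 / 2 : ℝ) • (star x * x + x * star x)) := by
  obtain ⟨C₀, hC₀, hbound⟩ := exists_sum_re_le V hK0 hK
  set C : ℝ := C₀ + 1 with hC
  have hC0 : 0 < C := by positivity
  set T : A → A := fun x => (1 / 2 : ℝ) • (star x * x + x * star x) with hT
  have hT0 : ∀ x, 0 ≤ T x := fun x => smul_nonneg (by norm_num)
    (add_nonneg (star_mul_self_nonneg x) (mul_star_self_nonneg x))
  have hsqrt : ∀ c : ℝ, 0 < c → ∀ x, T (Real.sqrt c • x) = c • T x ∧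
      (V (Real.sqrt c • x) (star (Real.sqrt c • x))).re = c * (V x (star x)).re := by
    intro c hc x
    have hre : ∀ (t : ℝ) (x : A), t • x = (t : ℂ) • x := fun t x => (Complex.coe_smul t x).symm
    have h1 : star (Real.sqrt c • x) = Real.sqrt c • star x := by
      rw [star_smul, star_trivial]
    have hs := Real.mul_self_sqrt hc.le
    constructor
    · simp only [hT, h1, smul_mul_smul_comm, hs]
      rw [← smul_add, smul_comm]
    · rw [h1, hre, hre, map_smul, map_smul, LinearMap.smul_apply, smul_eq_mul, smul_eq_mul,
        Complex.re_ofReal_mul, Complex.re_ofReal_mul, ← mul_assoc, hs]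
  let cone : ConvexCone ℝ A :=
    { carrier := {z | ∃ xs : List A, C • (xs.map T).sum -
        (xs.map fun x => (V x (star x)).re).sum • (1 : A) ≤ (realPart z : A)}
      smul_mem' := by
        rintro c hc z ⟨xs, h⟩
        refine ⟨xs.map fun x => Real.sqrt c • x, ?_⟩
        have h1 : ((xs.map fun x => Real.sqrt c • x).map T).sum = c • (xs.map T).sum := by
          rw [List.smul_sum, List.map_map, List.map_map]
          congr 1
          exact List.map_congr_left fun x _ => (hsqrt c hc x).1
        have h2 : ((xs.map fun x => Real.sqrt c • x).map fun x => (V x (star x)).re).sum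
            = c * (xs.map fun x => (V x (star x)).re).sum := by
          rw [← List.sum_map_mul_left, List.map_map]
          congr 1
          exact List.map_congr_left fun x _ => (hsqrt c hc x).2
        rw [h1, h2, map_smul, smul_comm C c, mul_smul, ← smul_sub]
        exact smul_le_smul_of_nonneg_left h hc.le
      add_mem' := by
        rintro y ⟨xs, hx⟩ z ⟨ys, hy⟩
        refine ⟨xs ++ ys, ?_⟩
        rw [List.map_append, List.map_append, List.sum_append, List.sum_append, map_add,
          smul_add C, add_smul _ _ (1 : A), add_sub_add_comm]
        exact add_le_add hx hy }
  have hcone : ∀ {z}, z ∈ cone ↔ ∃ xs : List A, C • (xs.map T).sum -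
        (xs.map fun x => (V x (star x)).re).sum • (1 : A) ≤ (realPart z : A) := Iff.rfl
  have hpt : cone.Pointed := hcone.2 ⟨[], by simp⟩
  have hreal : ∀ {z : A}, IsSelfAdjoint z → (realPart z : A) = z := fun h => h.coe_realPart
  have hsa1 : ∀ a : ℝ, IsSelfAdjoint (a • (1 : A)) := fun a =>
    (IsSelfAdjoint.all a).smul (IsSelfAdjoint.one A)
  have hpos1 : ∀ a : ℝ, 0 ≤ a • (1 : A) → 0 ≤ a := by
    intro a ha
    by_contra hn
    have h1 : 0 ≤ (-a) • (1 : A) := smul_nonneg (by linarith) zero_le_one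
    rw [neg_smul] at h1
    have h2 : a • (1 : A) = 0 := le_antisymm (neg_nonneg.1 h1) ha
    rcases smul_eq_zero.1 h2 with h | h
    · exact hn h.ge
    · exact one_ne_zero h
  let f : A →ₗ.[ℝ] ℝ := LinearPMap.mkSpanSingleton (1 : A) (1 : ℝ) one_ne_zero
  have hdom : ∀ a : ℝ, a • (1 : A) ∈ f.domain := fun a => Submodule.mem_span_singleton.2 ⟨a, rfl⟩
  have hf : ∀ (a : ℝ) (h : a • (1 : A) ∈ f.domain), f ⟨a • (1 : A), h⟩ = a := by
    intro a h
    have := LinearPMap.mkSpanSingleton'_apply (σ := RingHom.id ℝ) (1 : A) (1 : ℝ)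
      (fun c hc => by rcases smul_eq_zero.1 hc with h | h; · simp [h]
                      · exact absurd h one_ne_zero) a h
    exact this.trans (by simp)
  obtain ⟨g, hgf, hgs⟩ := riesz_extension (cone.toPointedCone hpt) f (by
      rintro ⟨z, hz⟩ hzs
      obtain ⟨a, rfl⟩ := Submodule.mem_span_singleton.1 hz
      rw [hf]
      obtain ⟨xs, h⟩ := hcone.1 hzs
      simp only at h
      rw [hreal (hsa1 a)] at h
      set σ := (xs.map fun x => (V x (star x)).re).sum with hσ
      have h1 : (xs.map T).sum ≤ ((a + σ) / C) • (1 : A) := by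
        rw [sub_le_iff_le_add, ← add_smul] at h
        have := smul_le_smul_of_nonneg_left h (inv_nonneg.2 hC0.le)
        rwa [smul_smul, inv_mul_cancel₀ hC0.ne', one_smul, smul_smul, inv_mul_eq_div] at this
      have h2 : 0 ≤ (a + σ) / C := hpos1 _ (le_trans (List.sum_nonneg fun y hy => by
        obtain ⟨x, -, rfl⟩ := List.mem_map.1 hy; exact hT0 x) h1)
      have h3 : σ ≤ C₀ * ((a + σ) / C) := by
        refine le_of_forall_pos_le_add fun ε hε => ?_
        have h4 : 0 < ε / C := by positivity
        have := hbound xs ((a + σ) / C + ε / C) (by linarith) (h1.trans (by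
          rw [add_smul]; exact le_add_of_nonneg_right (smul_nonneg h4.le zero_le_one)))
        refine this.trans ?_
        have h5 : C₀ * (ε / C) ≤ ε := by
          rw [← mul_div_assoc, div_le_iff₀ hC0]
          nlinarith
        linarith
      have h6 : C * ((a + σ) / C) = a + σ := mul_div_cancel₀ _ hC0.ne'
      have h7 : C₀ * ((a + σ) / C) ≤ C * ((a + σ) / C) :=
        mul_le_mul_of_nonneg_right (by linarith) h2
      linarith) (by
      intro z
      refine ⟨⟨‖z‖ • (1 : A), hdom _⟩, hcone.2 ⟨[], ?_⟩⟩
      simp only [List.map_nil, List.sum_nil, smul_zero, zero_smul, sub_zero, map_add]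
      rw [AddSubgroup.coe_add, hreal (hsa1 _)]
      have h1 := (realPart z).2.neg_algebraMap_norm_le_self
      have h2 : ‖(realPart z : A)‖ ≤ ‖z‖ := realPart.norm_le z
      have h3 : 0 ≤ (‖z‖ - ‖(realPart z : A)‖) • (1 : A) :=
        smul_nonneg (sub_nonneg.2 h2) zero_le_one
      rw [Algebra.algebraMap_eq_smul_one] at h1
      rw [sub_smul] at h3
      have h4 := add_nonneg h3 (neg_le_iff_add_nonneg.1 h1)
      refine h4.trans_eq ?_
      abel)
  have hg1 : g 1 = 1 := by
    have h1 := hgf ⟨(1 : ℝ) • (1 : A), hdom 1⟩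
    rw [hf] at h1
    simpa using h1
  refine ⟨C, g, hC0, fun z hz => hgs z (hcone.2 ⟨[], ?_⟩), ?_, fun x => ?_⟩
  · simp only [List.map_nil, List.sum_nil, smul_zero, zero_smul, sub_zero]
    rw [hreal (.of_nonneg hz)]; exact hz
  · exact hg1
  · have hsaT : IsSelfAdjoint (C • T x - (V x (star x)).re • (1 : A)) :=
      ((IsSelfAdjoint.all C).smul (.of_nonneg (hT0 x))).sub (hsa1 _)
    have h1 := hgs (C • T x - (V x (star x)).re • (1 : A)) (hcone.2 ⟨[x], by
      rw [hreal hsaT]; simp⟩)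
    rw [map_sub, map_smul g C, map_smul g (V x (star x)).re, hg1, smul_eq_mul, smul_eq_mul,
      mul_one] at h1
    exact sub_nonneg.1 h1

/-- A bounded bilinear form is dominated on the diagonal by a hermitian form built from a state. -/
theorem exists_dominating_linear (V : A →ₗ[ℂ] A →ₗ[ℂ] ℂ) {K : ℝ} (hK0 : 0 ≤ K)
    (hK : ∀ x y, ‖V x y‖ ≤ K * ‖x‖ * ‖y‖) :
    ∃ φ : A →ₗ[ℂ] ℂ, (∀ z, φ (star z) = star (φ z)) ∧ (∀ z, 0 ≤ z → 0 ≤ (φ z).re) ∧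
      ∀ x, (V x (star x)).re ≤ (φ (star x * x + x * star x)).re := by
  obtain ⟨C, g, hC, hg, hg1, hdom⟩ := exists_dominating_functional V hK0 hK
  have hbd : ∀ z, IsSelfAdjoint z → ‖((Complex.ofRealCLM : ℝ →L[ℝ] ℂ) : ℝ →ₗ[ℝ] ℂ) (g z)‖
      ≤ 1 * ‖z‖ := by
    intro z hz
    have h1 := hg _ (sub_nonneg.2 hz.le_algebraMap_norm_self)
    have h2 := hg _ (neg_le_iff_add_nonneg.1 hz.neg_algebraMap_norm_le_self)
    rw [Algebra.algebraMap_eq_smul_one, map_sub, map_smul, hg1, smul_eq_mul, mul_one] at h1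
    rw [Algebra.algebraMap_eq_smul_one, map_add, map_smul, hg1, smul_eq_mul, mul_one] at h2
    rw [one_mul]
    change ‖((g z : ℝ) : ℂ)‖ ≤ _
    rw [Complex.norm_real, Real.norm_eq_abs, abs_le]
    constructor <;> linarith
  obtain ⟨ψ, hψ, -⟩ := exists_clm_of_selfAdjoint
    (((Complex.ofRealCLM : ℝ →L[ℝ] ℂ) : ℝ →ₗ[ℝ] ℂ) ∘ₗ g) hbd
  have hψ' : ∀ z, IsSelfAdjoint z → ψ z = (g z : ℂ) := fun z hz => hψ z hz
  refine ⟨((C / 2 : ℝ) : ℂ) • ψ, fun z => ?_, fun z hz => ?_, fun x => ?_⟩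
  · have h1 : star z = (realPart z : A) - Complex.I • (imaginaryPart z : A) := by
      conv_lhs => rw [← realPart_add_I_smul_imaginaryPart z]
      rw [star_add, star_smul, (realPart z).2.star_eq, (imaginaryPart z).2.star_eq,
        RCLike.star_def, Complex.conj_I, neg_smul, sub_eq_add_neg]
    have h2 : ψ z = g (realPart z) + Complex.I * g (imaginaryPart z) := by
      conv_lhs => rw [← realPart_add_I_smul_imaginaryPart z]
      rw [map_add, map_smul, hψ' _ (realPart z).2, hψ' _ (imaginaryPart z).2, smul_eq_mul]
    rw [LinearMap.smul_apply, LinearMap.smul_apply, h2, h1, map_sub, map_smul,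
      hψ' _ (realPart z).2, hψ' _ (imaginaryPart z).2]
    simp only [smul_eq_mul, RCLike.star_def, map_mul, map_add, Complex.conj_ofReal, Complex.conj_I]
    ring
  · rw [LinearMap.smul_apply, hψ' z (.of_nonneg hz), smul_eq_mul, Complex.re_ofReal_mul,
      Complex.ofReal_re]
    exact mul_nonneg (by positivity) (hg z hz)
  · have hsa : IsSelfAdjoint (star x * x + x * star x) :=
      .of_nonneg (add_nonneg (star_mul_self_nonneg x) (mul_star_self_nonneg x))
    have := hdom x
    rw [map_smul, smul_eq_mul] at this
    rw [LinearMap.smul_apply, hψ' _ hsa, smul_eq_mul, Complex.re_ofReal_mul, Complex.ofReal_re]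
    linarith

end Domination

theorem IsPosSesquilinearForm.of_left {s : (H →L[ℂ] H) → (H →L[ℂ] H) → ℂ}
    (hadd : ∀ x x' y, s (x + x') y = s x y + s x' y)
    (hsmul : ∀ (c : ℂ) x y, s (c • x) y = c * s x y)
    (hsymm : ∀ x y, s x y = (starRingEnd ℂ) (s y x)) (hpos : ∀ x, 0 ≤ (s x x).re) :
    IsPosSesquilinearForm s := by
  refine ⟨hadd, hsmul, fun x y y' => ?_, fun c x y => ?_, hsymm, fun x => ⟨?_, hpos x⟩⟩
  · rw [hsymm, hadd, map_add, ← hsymm, ← hsymm]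
  · rw [hsymm, hsmul, map_mul, ← hsymm]
  · exact Complex.conj_eq_iff_im.1 (hsymm x x).symm

/-- Wright's representation theorem (difference-of-semi-inner-products
form). Any bounded decoherence functional on `B(H)`, for `H` infinite dimensional
or of finite dimension `> 2`, is the difference of two positive semidefinite
hermitian sesquilinear forms on pairs of projections. -/
theorem wright_difference_representation
    (hdim : ¬ FiniteDimensional ℂ H ∨ 2 < Module.finrank ℂ H)
    (d : (H →L[ℂ] H) → (H →L[ℂ] H) → ℂ)
    (hpos : ∀ p : H →L[ℂ] H, IsSelfAdjoint p → p * p = p →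
      (d p p).im = 0 ∧ 0 ≤ (d p p).re)
    (hherm : ∀ p q : H →L[ℂ] H, IsSelfAdjoint p → p * p = p →
      IsSelfAdjoint q → q * q = q → d p q = (starRingEnd ℂ) (d q p))
    (hnorm : d 1 1 = 1)
    (hzero : ∀ p : H →L[ℂ] H, IsSelfAdjoint p → p * p = p → d 0 p = 0)
    (hadd : ∀ p₁ p₂ q : H →L[ℂ] H, IsSelfAdjoint p₁ → p₁ * p₁ = p₁ →
      IsSelfAdjoint p₂ → p₂ * p₂ = p₂ → IsSelfAdjoint q → q * q = q → p₁ * p₂ = 0 →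
      d (p₁ + p₂) q = d p₁ q + d p₂ q)
    (hbdd : ∃ C : ℝ, ∀ p q : H →L[ℂ] H, IsSelfAdjoint p → p * p = p →
      IsSelfAdjoint q → q * q = q → ‖d p q‖ ≤ C) :
    ∃ s₁ s₂ : (H →L[ℂ] H) → (H →L[ℂ] H) → ℂ,
      IsPosSesquilinearForm s₁ ∧ IsPosSesquilinearForm s₂ ∧
      ∀ p q : H →L[ℂ] H, IsSelfAdjoint p → p * p = p → IsSelfAdjoint q → q * q = q →
        d p q = s₁ p q - s₂ p q := by
  have hH : Nontrivial H := by
    by_contra h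
    rw [not_nontrivial_iff_subsingleton] at h
    rcases hdim with h1 | h1
    · exact h1 inferInstance
    · rw [Module.finrank_zero_of_subsingleton] at h1; omega
  obtain ⟨M, hM⟩ := hbdd
  have hl : ∀ p q r : H →L[ℂ] H, IsStarProjection p → IsStarProjection q → IsStarProjection r →
      p * q = 0 → d (p + q) r = d p r + d q r := fun p q r hp hq hr h =>
    hadd p q r hp.isSelfAdjoint hp.isIdempotentElem hq.isSelfAdjoint hq.isIdempotentElem
      hr.isSelfAdjoint hr.isIdempotentElem h
  have hsymm : ∀ p q : H →L[ℂ] H, IsStarProjection p → IsStarProjection q →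
      d p q = (starRingEnd ℂ) (d q p) := fun p q hp hq =>
    hherm p q hp.isSelfAdjoint hp.isIdempotentElem hq.isSelfAdjoint hq.isIdempotentElem
  have hM0 : 0 ≤ M := (norm_nonneg _).trans
    (hM 1 1 (IsSelfAdjoint.one _) (mul_one 1) (IsSelfAdjoint.one _) (mul_one 1))
  obtain ⟨V, hVd, hVK⟩ := (hasGleason hdim).exists_bilinear exists_rangeProj hl
    (fun p q r hp hq hr h => by
      rw [hsymm r (p + q) hr (hp.add hq h), hl p q r hp hq hr h, map_add, ← hsymm r p hr hp,
        ← hsymm r q hr hq])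
    (fun p q hp hq => hM p q hp.isSelfAdjoint hp.isIdempotentElem hq.isSelfAdjoint
      hq.isIdempotentElem)
  obtain ⟨φ, hφstar, hφ0, hφV⟩ := exists_dominating_linear V (K := 64 * M) (by positivity) hVK
  set s : (H →L[ℂ] H) → (H →L[ℂ] H) → ℂ := fun x y => φ (star y * x + x * star y) with hs
  set D : (H →L[ℂ] H) → (H →L[ℂ] H) → ℂ := fun x y =>
    1 / 2 * (V x (star y) + (starRingEnd ℂ) (V y (star x))) with hD
  have hsadd : ∀ x x' y, s (x + x') y = s x y + s x' y := fun x x' y => by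
    simp only [hs, ← map_add, mul_add, add_mul]; congr 1; abel
  have hssmul : ∀ (c : ℂ) x y, s (c • x) y = c * s x y := fun c x y => by
    simp only [hs]
    rw [mul_smul_comm, smul_mul_assoc, ← smul_add, map_smul, smul_eq_mul]
  have hssymm : ∀ x y, s x y = (starRingEnd ℂ) (s y x) := fun x y => by
    simp only [hs]
    rw [← RCLike.star_def, ← hφstar, star_add, star_mul, star_mul, star_star]
  have hDadd : ∀ x x' y, D (x + x') y = D x y + D x' y := fun x x' y => by
    simp only [hD, star_add, map_add, LinearMap.add_apply]; ring
  have hDsmul : ∀ (c : ℂ) x y, D (c • x) y = c * D x y := fun c x y => by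
    simp only [hD, star_smul, map_smul, LinearMap.smul_apply, smul_eq_mul, map_mul, RCLike.star_def,
      Complex.conj_conj]
    ring
  have hDsymm : ∀ x y, D x y = (starRingEnd ℂ) (D y x) := fun x y => by
    simp only [hD, map_mul, map_add, Complex.conj_conj, map_div₀, map_one, map_ofNat]
    ring
  have hDre : ∀ x, (D x x).re = (V x (star x)).re := fun x => by
    have : D x x = ((V x (star x)).re : ℂ) := by
      simp only [hD, Complex.add_conj, Complex.ofReal_mul, Complex.ofReal_ofNat]; ring
    rw [this, Complex.ofReal_re]
  refine ⟨s, fun x y => s x y - D x y, .of_left hsadd hssmul hssymm fun x => ?_,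
    .of_left (fun x x' y => ?_) (fun c x y => ?_) (fun x y => ?_) (fun x => ?_),
    fun p q hp hp2 hq hq2 => ?_⟩
  · exact hφ0 _ (add_nonneg (star_mul_self_nonneg x) (mul_star_self_nonneg x))
  · rw [hsadd, hDadd]; ring
  · rw [hssmul, hDsmul]; ring
  · rw [map_sub, ← hssymm, ← hDsymm]
  · rw [Complex.sub_re, hDre, sub_nonneg]
    exact hφV x
  · rw [sub_sub_cancel]
    have hp' : IsStarProjection p := ⟨hp2, hp⟩
    have hq' : IsStarProjection q := ⟨hq2, hq⟩
    simp only [hD, hp.star_eq, hq.star_eq, hVd p q hp' hq', hVd q p hq' hp', ← hsymm p q hp' hq']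
    ring
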